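/- arXiv:math/9810153 — 4 statements merged into one kernel-verified Lean document; each statement's English description precedes it below -/
import Mathlib

section
/- The abelianization of Sp(4,ℤ), i.e. the quotient of Sp(4,ℤ) by its commutator subgroup, is isomorphic to the cyclic group ℤ/2ℤ. -/
open Matrix

/-- The subgroup of `GL n R` consisting of matrices `M` with `ᵀM · J · M = J`. -/
def sympGroup (n : Type*) [Fintype n] [DecidableEq n] (R : Type*) [CommRing R]
    (J : Matrix n n R) : Subgroup (GL n R) where
  carrier := {g | (g : Matrix n n R)ᵀ * J * (g : Matrix n n R) = J}
  one_mem' := by simp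
  mul_mem' := by
    intro a b ha hb
    simp only [Set.mem_setOf_eq] at ha hb ⊢
    have hab : ((a * b : GL n R) : Matrix n n R) = (a : Matrix n n R) * (b : Matrix n n R) :=
      rfl
    rw [hab, Matrix.transpose_mul]
    calc (b : Matrix n n R)ᵀ * (a : Matrix n n R)ᵀ * J * ((a : Matrix n n R) * (b : Matrix n n R))
        = (b : Matrix n n R)ᵀ * ((a : Matrix n n R)ᵀ * J * (a : Matrix n n R)) *
            (b : Matrix n n R) := by
          simp only [Matrix.mul_assoc]
      _ = J := by rw [ha, hb]
  inv_mem' := by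
    intro a ha
    simp only [Set.mem_setOf_eq] at ha ⊢
    have key : ((a : GL n R) : Matrix n n R) * ((a⁻¹ : GL n R) : Matrix n n R) = 1 := by
      rw [← Units.val_mul, mul_inv_cancel, Units.val_one]
    have h2 : ((a⁻¹ : GL n R) : Matrix n n R)ᵀ * ((a : GL n R) : Matrix n n R)ᵀ = 1 := by
      rw [← Matrix.transpose_mul, key, Matrix.transpose_one]
    calc ((a⁻¹ : GL n R) : Matrix n n R)ᵀ * J * ((a⁻¹ : GL n R) : Matrix n n R)
        = ((a⁻¹ : GL n R) : Matrix n n R)ᵀ *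
            ((a : Matrix n n R)ᵀ * J * (a : Matrix n n R)) *
            ((a⁻¹ : GL n R) : Matrix n n R) := by rw [ha]
      _ = (((a⁻¹ : GL n R) : Matrix n n R)ᵀ * ((a : GL n R) : Matrix n n R)ᵀ) * J *
            (((a : GL n R) : Matrix n n R) * ((a⁻¹ : GL n R) : Matrix n n R)) := by
          simp only [Matrix.mul_assoc]
      _ = J := by rw [h2, key, Matrix.one_mul, Matrix.mul_one]

/-- `Sp(2g,ℤ)`: the group of `2g×2g` integer matrices `M` with `ᵀM·J·M = J`,
where `J = ((0, I_g), (−I_g, 0))` is the standard symplectic form. -/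
def SpZ (g : ℕ) : Subgroup (GL (Fin g ⊕ Fin g) ℤ) :=
  sympGroup (Fin g ⊕ Fin g) ℤ (Matrix.fromBlocks 0 1 (-1) 0)

namespace SpZ

section General

variable {g : ℕ}

/-- The standard symplectic form of size `2g`. -/
abbrev form (g : ℕ) : Matrix (Fin g ⊕ Fin g) (Fin g ⊕ Fin g) ℤ :=
  fromBlocks 0 1 (-1) 0

theorem form_mul_form : form g * form g = -1 := by
  simp [form, fromBlocks_multiply, ← fromBlocks_one, fromBlocks_neg]

/-- The underlying matrix of an element of `Sp(2g,ℤ)`. -/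
def toMatrix : SpZ g →* Matrix (Fin g ⊕ Fin g) (Fin g ⊕ Fin g) ℤ :=
  (Units.coeHom _).comp (SpZ g).subtype

theorem toMatrix_injective : Function.Injective (toMatrix (g := g)) :=
  fun _ _ h => Subtype.ext (Units.ext h)

theorem transpose_mul_form_mul (x : SpZ g) :
    (toMatrix x)ᵀ * form g * toMatrix x = form g :=
  x.2

/-- The element of `Sp(2g,ℤ)` given by a matrix preserving the symplectic form. -/
def ofMatrix (M : Matrix (Fin g ⊕ Fin g) (Fin g ⊕ Fin g) ℤ)
    (h : Mᵀ * form g * M = form g) : SpZ g :=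
  have hl : -(form g * Mᵀ * form g) * M = 1 := by
    rw [neg_mul, Matrix.mul_assoc, Matrix.mul_assoc, ← Matrix.mul_assoc Mᵀ, h, form_mul_form,
      neg_neg]
  ⟨⟨M, -(form g * Mᵀ * form g), mul_eq_one_comm.1 hl, hl⟩, h⟩

@[simp]
theorem toMatrix_ofMatrix (M : Matrix (Fin g ⊕ Fin g) (Fin g ⊕ Fin g) ℤ)
    (h : Mᵀ * form g * M = form g) : toMatrix (ofMatrix M h) = M :=
  rfl

/-- The Siegel Levi embedding `A ↦ diag(A, ᵀA⁻¹)`. -/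
def levi : GL (Fin g) ℤ →* SpZ g where
  toFun A := ofMatrix (fromBlocks A 0 0 (A⁻¹ : GL (Fin g) ℤ).valᵀ) <| by
    simp only [form, fromBlocks_transpose, fromBlocks_multiply]
    simp [← transpose_mul, ← Units.val_mul, -coe_units_inv]
  map_one' := toMatrix_injective <| by simp
  map_mul' A B := toMatrix_injective <| by
    simp only [map_mul, toMatrix_ofMatrix, fromBlocks_multiply]
    simp [← transpose_mul, -coe_units_inv]

theorem toMatrix_levi (A : GL (Fin g) ℤ) :
    toMatrix (levi A) = fromBlocks A 0 0 (A⁻¹ : GL (Fin g) ℤ).valᵀ :=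
  rfl

/-- The elements `((1, B), (0, 1))`, for `B` symmetric, of the Siegel unipotent radical. -/
def unip (B : Matrix (Fin g) (Fin g) ℤ) (hB : B.IsSymm) : SpZ g :=
  ofMatrix (fromBlocks 1 B 0 1) <| by
    simp [form, fromBlocks_transpose, fromBlocks_multiply, hB.eq]

theorem toMatrix_unip (B : Matrix (Fin g) (Fin g) ℤ) (hB : B.IsSymm) :
    toMatrix (unip B hB) = fromBlocks 1 B 0 1 :=
  rfl

theorem unip_mul_unip {B C : Matrix (Fin g) (Fin g) ℤ} (hB : B.IsSymm) (hC : C.IsSymm) :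
    unip B hB * unip C hC = unip (B + C) (hB.add hC) :=
  toMatrix_injective <| by
    simp [toMatrix_unip, fromBlocks_multiply, add_comm]

theorem isSymm_mul_mul_transpose {B : Matrix (Fin g) (Fin g) ℤ} (hB : B.IsSymm)
    (A : Matrix (Fin g) (Fin g) ℤ) : (A * B * Aᵀ).IsSymm := by
  simp [Matrix.IsSymm, transpose_mul, hB.eq, Matrix.mul_assoc]

theorem levi_conj_unip (A : GL (Fin g) ℤ) {B : Matrix (Fin g) (Fin g) ℤ} (hB : B.IsSymm) :
    levi A * unip B hB * (levi A)⁻¹ =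
      unip ((A : Matrix (Fin g) (Fin g) ℤ) * B * (A : Matrix (Fin g) (Fin g) ℤ)ᵀ)
        (isSymm_mul_mul_transpose hB _) := by
  rw [mul_inv_eq_iff_eq_mul]
  refine toMatrix_injective ?_
  simp only [map_mul, toMatrix_unip, toMatrix_levi, fromBlocks_multiply]
  simp [Matrix.mul_assoc, ← transpose_mul, ← Units.val_mul, -coe_units_inv]

end General

section GenusTwo

/-- The embedding of `SL(2,ℤ)` acting on the first hyperbolic plane. -/
def plane : SpecialLinearGroup (Fin 2) ℤ →* SpZ 2 where
  toFun A := ofMatrix (fromBlocks !![A 0 0, 0; 0, 1] !![A 0 1, 0; 0, 0]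
      !![A 1 0, 0; 0, 0] !![A 1 1, 0; 0, 1]) <| by
    have h := A.det_coe
    rw [det_fin_two] at h
    simp only [form, fromBlocks_transpose, fromBlocks_multiply]
    congr 1 <;> ext i j <;> fin_cases i <;> fin_cases j <;>
      simp [Matrix.mul_apply, Fin.sum_univ_two] <;> linarith
  map_one' := toMatrix_injective <| by
    simp only [map_one, toMatrix_ofMatrix, ← fromBlocks_one]
    congr 1 <;> ext i j <;> fin_cases i <;> fin_cases j <;> simp
  map_mul' A B := toMatrix_injective <| by
    simp only [map_mul, toMatrix_ofMatrix, fromBlocks_multiply]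
    congr 1 <;> ext i j <;> fin_cases i <;> fin_cases j <;>
      simp [Matrix.mul_apply, Fin.sum_univ_two]

theorem toMatrix_plane (A : SpecialLinearGroup (Fin 2) ℤ) :
    toMatrix (plane A) = fromBlocks !![A 0 0, 0; 0, 1] !![A 0 1, 0; 0, 0]
      !![A 1 0, 0; 0, 0] !![A 1 1, 0; 0, 1] :=
  rfl

/-- The permutation matrix exchanging the two hyperbolic planes. -/
def swapGL : GL (Fin 2) ℤ :=
  ⟨!![0, 1; 1, 0], !![0, 1; 1, 0], by decide, by decide⟩

/-- The embedding of `SL(2,ℤ)` acting on the second hyperbolic plane. -/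
def plane' (A : SpecialLinearGroup (Fin 2) ℤ) : SpZ 2 :=
  levi swapGL * plane A * (levi swapGL)⁻¹

theorem toMatrix_plane' (A : SpecialLinearGroup (Fin 2) ℤ) :
    toMatrix (plane' A) = fromBlocks !![1, 0; 0, A 0 0] !![0, 0; 0, A 0 1]
      !![0, 0; 0, A 1 0] !![1, 0; 0, A 1 1] := by
  have h : (levi swapGL)⁻¹ = levi swapGL := by
    rw [← map_inv]
    rfl
  rw [plane', h]
  simp only [map_mul, toMatrix_levi, toMatrix_plane, fromBlocks_multiply]
  congr 1 <;> ext i j <;> fin_cases i <;> fin_cases j <;>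
    simp [Matrix.mul_apply, Fin.sum_univ_two, swapGL, vecMul, dotProduct]

/-- The class of the transvection along the first basis vector. -/
def transvectionClass : Abelianization (SpZ 2) :=
  Abelianization.of (plane ModularGroup.T)

/-- The elements whose class is a power of the class of a transvection. -/
def transvectionSubgroup : Subgroup (SpZ 2) :=
  (Subgroup.zpowers transvectionClass).comap Abelianization.of

instance : transvectionSubgroup.Normal :=
  inferInstanceAs ((Subgroup.zpowers transvectionClass).comap Abelianization.of).Normal

theorem range_le_of_map_T_mem {f : SpecialLinearGroup (Fin 2) ℤ →* SpZ 2}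
    (hT : f ModularGroup.T ∈ transvectionSubgroup) (A : SpecialLinearGroup (Fin 2) ℤ) :
    f A ∈ transvectionSubgroup := by
  have hrel : (ModularGroup.S * ModularGroup.T) ^ 3 = ModularGroup.S ^ 2 := by
    decide
  have hST : Abelianization.of (f ModularGroup.S) =
      (Abelianization.of (f ModularGroup.T) ^ 3)⁻¹ := by
    have h := congrArg (fun x => Abelianization.of (f x)) hrel
    simp only [map_pow, map_mul, mul_pow] at h
    rw [eq_inv_iff_mul_eq_one]
    rw [pow_succ _ 2, mul_assoc, mul_eq_left] at h
    exact h
  have hS : f ModularGroup.S ∈ transvectionSubgroup := by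
    rw [transvectionSubgroup, Subgroup.mem_comap, hST]
    exact inv_mem (pow_mem hT 3)
  have hle : Subgroup.closure {ModularGroup.S, ModularGroup.T} ≤ transvectionSubgroup.comap f := by
    rw [Subgroup.closure_le]
    rintro x (rfl | rfl)
    exacts [hS, hT]
  rw [SpecialLinearGroup.SL2Z_generators] at hle
  exact hle (Subgroup.mem_top A)

theorem plane_mem (A : SpecialLinearGroup (Fin 2) ℤ) : plane A ∈ transvectionSubgroup :=
  range_le_of_map_T_mem (Subgroup.mem_zpowers transvectionClass) A

theorem plane'_mem (A : SpecialLinearGroup (Fin 2) ℤ) : plane' A ∈ transvectionSubgroup :=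
  Subgroup.Normal.conj_mem inferInstance _ (plane_mem A) _

theorem isSymm_fin_two (x y z : ℤ) : !![x, y; y, z].IsSymm := by
  ext i j
  fin_cases i <;> fin_cases j <;> rfl

/-- The element of the Siegel unipotent radical with entries `x, y, z`. -/
def unipTwo (x y z : ℤ) : SpZ 2 :=
  unip !![x, y; y, z] (isSymm_fin_two x y z)

theorem unip_eq_unipTwo {B : Matrix (Fin 2) (Fin 2) ℤ} (hB : B.IsSymm) :
    unip B hB = unipTwo (B 0 0) (B 0 1) (B 1 1) := by
  refine toMatrix_injective ?_
  simp only [unipTwo, toMatrix_unip]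
  congr 1
  ext i j
  fin_cases i <;> fin_cases j <;> simp [hB.apply]

theorem unipTwo_mul (x y z x' y' z' : ℤ) :
    unipTwo x y z * unipTwo x' y' z' = unipTwo (x + x') (y + y') (z + z') := by
  rw [unipTwo, unipTwo, unip_mul_unip, unip_eq_unipTwo]
  simp

theorem plane_T_zpow (x : ℤ) : plane (ModularGroup.T ^ x) = unipTwo x 0 0 := by
  refine toMatrix_injective ?_
  rw [toMatrix_plane, unipTwo, toMatrix_unip, ModularGroup.coe_T_zpow]
  congr 1 <;> ext i j <;> fin_cases i <;> fin_cases j <;> simp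

/-- The elementary lower triangular matrix. -/
def lowerGL : GL (Fin 2) ℤ :=
  ⟨!![1, 0; 1, 1], !![1, 0; -1, 1], by decide, by decide⟩

/-- The diagonal matrix `diag(1, -1)`. -/
def reflGL : GL (Fin 2) ℤ :=
  ⟨!![1, 0; 0, -1], !![1, 0; 0, -1], by decide, by decide⟩

theorem swap_conj (x y z : ℤ) :
    levi swapGL * unipTwo x y z * (levi swapGL)⁻¹ = unipTwo z y x := by
  rw [unipTwo, levi_conj_unip, unip_eq_unipTwo]
  simp [swapGL, Matrix.mul_apply, Fin.sum_univ_two, vecHead, vecTail]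

theorem lower_conj (x : ℤ) :
    levi lowerGL * unipTwo x 0 0 * (levi lowerGL)⁻¹ = unipTwo x x x := by
  rw [unipTwo, levi_conj_unip, unip_eq_unipTwo]
  simp [lowerGL, Matrix.mul_apply, Fin.sum_univ_two, vecHead, vecTail]

theorem refl_conj (x y z : ℤ) :
    levi reflGL * unipTwo x y z * (levi reflGL)⁻¹ = unipTwo x (-y) z := by
  rw [unipTwo, levi_conj_unip, unip_eq_unipTwo]
  simp [reflGL, Matrix.mul_apply, Fin.sum_univ_two, vecHead, vecTail]

theorem unipTwo_mem (x y z : ℤ) : unipTwo x y z ∈ transvectionSubgroup := by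
  have h₁ (x : ℤ) : unipTwo x 0 0 ∈ transvectionSubgroup := plane_T_zpow x ▸ plane_mem _
  have h₂ (z : ℤ) : unipTwo 0 0 z ∈ transvectionSubgroup :=
    swap_conj z 0 0 ▸ Subgroup.Normal.conj_mem inferInstance _ (h₁ z) _
  have h₃ (y : ℤ) : unipTwo y y y ∈ transvectionSubgroup :=
    lower_conj y ▸ Subgroup.Normal.conj_mem inferInstance _ (h₁ y) _
  have h := mul_mem (mul_mem (h₁ (x - y)) (h₃ y)) (h₂ (z - y))
  simpa [unipTwo_mul] using h

theorem of_conj {G : Type*} [Group G] (a b : G) :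
    Abelianization.of (a * b * a⁻¹) = Abelianization.of b := by
  simp

theorem transvectionClass_sq : transvectionClass ^ 2 = 1 := by
  have h₁ : Abelianization.of (unipTwo 1 0 0) = transvectionClass := by
    rw [← plane_T_zpow, zpow_one, transvectionClass]
  have h₂ : Abelianization.of (unipTwo 0 0 1) = transvectionClass := by
    rw [← swap_conj, of_conj, h₁]
  have h₃ : Abelianization.of (unipTwo 1 1 1) = transvectionClass := by
    rw [← lower_conj, of_conj, h₁]
  have h₄ : Abelianization.of (unipTwo 1 (-1) 1) = transvectionClass := by
    rw [← refl_conj, of_conj, h₃]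
  have h : unipTwo 1 1 1 * unipTwo 1 (-1) 1 =
      unipTwo 1 0 0 * unipTwo 1 0 0 * (unipTwo 0 0 1 * unipTwo 0 0 1) := by
    simp [unipTwo_mul]
  have := congrArg Abelianization.of h
  simp only [map_mul, h₁, h₂, h₃, h₄] at this
  rw [sq]
  exact left_eq_mul.1 this

theorem levi_toGL_mem (A : SpecialLinearGroup (Fin 2) ℤ) :
    levi (SpecialLinearGroup.toGL A) ∈ transvectionSubgroup := by
  refine range_le_of_map_T_mem (f := levi.comp SpecialLinearGroup.toGL) ?_ A
  have h : plane' ModularGroup.S * unipTwo 0 (-1) 0 * (plane' ModularGroup.S)⁻¹ =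
      levi (SpecialLinearGroup.toGL ModularGroup.T) := by
    rw [mul_inv_eq_iff_eq_mul]
    refine toMatrix_injective ?_
    simp only [map_mul, toMatrix_plane', unipTwo, toMatrix_unip, toMatrix_levi,
      fromBlocks_multiply, ← map_inv]
    decide
  exact h ▸ Subgroup.Normal.conj_mem inferInstance _ (unipTwo_mem _ _ _) _

/-- Every integer vector of length two is moved to `(gcd, 0)` by `SL(2,ℤ)`. -/
theorem exists_SL2_gcd (a b : ℤ) : ∃ A : SpecialLinearGroup (Fin 2) ℤ,
    A 0 0 * a + A 0 1 * b = Int.gcd a b ∧ A 1 0 * a + A 1 1 * b = 0 := by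
  by_cases hd : (Int.gcd a b : ℤ) = 0
  · have h := Int.gcd_eq_zero_iff.1 (Int.natCast_eq_zero.1 hd)
    exact ⟨1, by simp [h.1, h.2]⟩
  obtain ⟨a', ha⟩ := Int.gcd_dvd_left a b
  obtain ⟨b', hb⟩ := Int.gcd_dvd_right a b
  have hbez := Int.gcd_eq_gcd_ab a b
  set d : ℤ := ((Int.gcd a b : ℕ) : ℤ)
  refine ⟨⟨!![Int.gcdA a b, Int.gcdB a b; -b', a'], ?_⟩, ?_, ?_⟩
  · rw [det_fin_two_of]
    refine mul_left_cancel₀ hd ?_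
    linear_combination Int.gcdA a b * -ha + Int.gcdB a b * -hb - hbez
  · simp
    linear_combination -hbez
  · simp
    linear_combination -b' * ha + a' * hb

theorem levi_toGL_entry (A : SpecialLinearGroup (Fin 2) ℤ) (x : SpZ 2) (i : Fin 2)
    (j : Fin 2 ⊕ Fin 2) : toMatrix (levi (SpecialLinearGroup.toGL A) * x) (Sum.inl i) j =
      A i 0 * toMatrix x (Sum.inl 0) j + A i 1 * toMatrix x (Sum.inl 1) j := by
  simp [toMatrix_levi, Matrix.mul_apply]

theorem mem_of_fixes_plane {x : SpZ 2}
    (he : ∀ i, toMatrix x i (Sum.inl 0) = if i = Sum.inl 0 then 1 else 0)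
    (hf : ∀ i, toMatrix x i (Sum.inr 0) = if i = Sum.inr 0 then 1 else 0) :
    x ∈ transvectionSubgroup := by
  have h (i j) := congrFun₂ (transpose_mul_form_mul x) i j
  simp only [Matrix.mul_apply, transpose_apply, Fintype.sum_sum_type, Fin.sum_univ_two] at h
  have h₁ := h (Sum.inl 0) (Sum.inl 1)
  have h₂ := h (Sum.inl 0) (Sum.inr 1)
  have h₃ := h (Sum.inr 0) (Sum.inl 1)
  have h₄ := h (Sum.inr 0) (Sum.inr 1)
  have h₅ := h (Sum.inl 1) (Sum.inr 1)
  simp [he, hf, form] at h₁ h₂ h₃ h₄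
  simp [form, h₁, h₂, h₃, h₄] at h₅
  have hx : x = plane' ⟨!![
      toMatrix x (Sum.inl 1) (Sum.inl 1), toMatrix x (Sum.inl 1) (Sum.inr 1);
      toMatrix x (Sum.inr 1) (Sum.inl 1), toMatrix x (Sum.inr 1) (Sum.inr 1)], by
      rw [det_fin_two_of]
      linarith⟩ := by
    refine toMatrix_injective (Eq.trans ?_ (toMatrix_plane' _).symm)
    ext i j
    rcases i with i | i <;> rcases j with j | j <;> fin_cases i <;> fin_cases j <;>
      simp [he, hf, h₁, h₂, h₃, h₄]
  rw [hx]
  exact plane'_mem _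

theorem mem_of_fixes_vector {x : SpZ 2}
    (he : ∀ i, toMatrix x i (Sum.inl 0) = if i = Sum.inl 0 then 1 else 0) :
    x ∈ transvectionSubgroup := by
  obtain ⟨A, hA, hA'⟩ :=
    exists_SL2_gcd (toMatrix x (Sum.inl 1) (Sum.inr 0)) (toMatrix x (Sum.inr 1) (Sum.inr 0))
  have h := congrFun₂ (transpose_mul_form_mul x) (Sum.inl 0) (Sum.inr 0)
  simp [Matrix.mul_apply, he, form] at h
  set d : ℤ := ((Int.gcd (toMatrix x (Sum.inl 1) (Sum.inr 0))
    (toMatrix x (Sum.inr 1) (Sum.inr 0)) : ℕ) : ℤ)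
  have hu := unipTwo_mem (-toMatrix x (Sum.inl 0) (Sum.inr 0)) (-d) 0
  rw [← Subgroup.mul_mem_cancel_left _ (plane'_mem A), ← Subgroup.mul_mem_cancel_left _ hu]
  refine mem_of_fixes_plane ?_ ?_ <;>
    simp [Sum.forall, Fin.forall_fin_two, Matrix.mul_apply, toMatrix_plane', unipTwo,
      toMatrix_unip, he, h, hA, hA']

theorem mem_transvectionSubgroup (x : SpZ 2) : x ∈ transvectionSubgroup := by
  obtain ⟨A, -, hA⟩ :=
    exists_SL2_gcd (toMatrix x (Sum.inl 0) (Sum.inl 0)) (toMatrix x (Sum.inr 0) (Sum.inl 0))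
  obtain ⟨B, -, hB⟩ :=
    exists_SL2_gcd (toMatrix x (Sum.inl 1) (Sum.inl 0)) (toMatrix x (Sum.inr 1) (Sum.inl 0))
  rw [← Subgroup.mul_mem_cancel_left _ (plane_mem A),
    ← Subgroup.mul_mem_cancel_left _ (plane'_mem B)]
  have hy₀ : toMatrix (plane' B * (plane A * x)) (Sum.inr 0) (Sum.inl 0) = 0 := by
    simp [Matrix.mul_apply, toMatrix_plane', toMatrix_plane, hA]
  have hy₁ : toMatrix (plane' B * (plane A * x)) (Sum.inr 1) (Sum.inl 0) = 0 := by
    simp [Matrix.mul_apply, toMatrix_plane', toMatrix_plane, hB]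
  generalize plane' B * (plane A * x) = y at hy₀ hy₁ ⊢
  obtain ⟨C, hC, hC'⟩ :=
    exists_SL2_gcd (toMatrix y (Sum.inl 0) (Sum.inl 0)) (toMatrix y (Sum.inl 1) (Sum.inl 0))
  rw [← Subgroup.mul_mem_cancel_left _ (levi_toGL_mem C)]
  rw [← levi_toGL_entry] at hC hC'
  have hz (i : Fin 2) :
      toMatrix (levi (SpecialLinearGroup.toGL C) * y) (Sum.inr i) (Sum.inl 0) = 0 := by
    simp [Matrix.mul_apply, toMatrix_levi, hy₀, hy₁]
  generalize levi (SpecialLinearGroup.toGL C) * y = z at hz hC hC' ⊢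
  have h := congrFun₂ (transpose_mul_form_mul z) (Sum.inl 0) (Sum.inr 0)
  simp [Matrix.mul_apply, hz, hC, hC', form] at h
  have hd := Int.eq_one_of_mul_eq_one_right (Int.natCast_nonneg _) h
  refine mem_of_fixes_vector ?_
  simp [Sum.forall, Fin.forall_fin_two, hz, hC, hC', hd]

end GenusTwo

section OddForms

/-- The symplectic form modulo two. -/
def pairing (x y : Fin 2 ⊕ Fin 2 → ZMod 2) : ZMod 2 :=
  x ⬝ᵥ (form 2).map (Int.castRingHom (ZMod 2)) *ᵥ y

/-- Reduction modulo two of symplectic matrices. -/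
def reduction : SpZ 2 →* Matrix (Fin 2 ⊕ Fin 2) (Fin 2 ⊕ Fin 2) (ZMod 2) :=
  (Int.castRingHom (ZMod 2)).mapMatrix.toMonoidHom.comp toMatrix

theorem pairing_reduction (g : SpZ 2) (x y : Fin 2 ⊕ Fin 2 → ZMod 2) :
    pairing (reduction g *ᵥ x) (reduction g *ᵥ y) = pairing x y := by
  have h := congrArg (Int.castRingHom (ZMod 2)).mapMatrix (transpose_mul_form_mul g)
  simp only [map_mul] at h
  simp only [pairing]
  rw [← vecMul_transpose, ← dotProduct_mulVec, mulVec_mulVec, mulVec_mulVec]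
  exact congrArg (fun M => x ⬝ᵥ M *ᵥ y) h

/-- The quadratic forms over `𝔽₂` of Arf invariant one whose polar form is the symplectic
form, that is, those which take the value one ten times. -/
@[ext]
structure OddForm where
  /-- The underlying function. -/
  toFun : (Fin 2 ⊕ Fin 2 → ZMod 2) → ZMod 2
  map_add : ∀ x y, toFun (x + y) = toFun x + toFun y + pairing x y
  sum_sign : ∑ x, (if toFun x = 0 then 1 else -1 : ℤ) = -4

instance : CoeFun OddForm fun _ => (Fin 2 ⊕ Fin 2 → ZMod 2) → ZMod 2 :=
  ⟨OddForm.toFun⟩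

/-- The permutation of `𝔽₂⁴` given by a symplectic matrix. -/
def reductionEquiv (g : SpZ 2) : Equiv.Perm (Fin 2 ⊕ Fin 2 → ZMod 2) where
  toFun x := reduction g *ᵥ x
  invFun x := reduction g⁻¹ *ᵥ x
  left_inv x := by simp [← map_mul]
  right_inv x := by simp [← map_mul]

instance : MulAction (SpZ 2) OddForm where
  smul g q := ⟨fun x => q (reduction g⁻¹ *ᵥ x),
    fun x y => by simp only [mulVec_add, q.map_add, pairing_reduction],
    (Equiv.sum_comp (reductionEquiv g⁻¹) fun x => (if q x = 0 then 1 else -1 : ℤ)).trans q.sum_sign⟩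
  one_smul q := OddForm.ext <| funext fun x => congrArg q <| by simp
  mul_smul g h q := OddForm.ext <| funext fun x => congrArg q <| by simp

theorem OddForm.smul_apply (g : SpZ 2) (q : OddForm) (x : Fin 2 ⊕ Fin 2 → ZMod 2) :
    (g • q) x = q (reduction g⁻¹ *ᵥ x) :=
  rfl

instance : Finite OddForm :=
  Finite.of_injective OddForm.toFun fun _ _ => OddForm.ext

open Classical in
/-- The sign of the permutation of the six odd forms induced by a symplectic matrix. -/
noncomputable def signHom : SpZ 2 →* ℤˣ :=
  letI := Fintype.ofFinite OddForm
  Equiv.Perm.sign.comp (MulAction.toPermHom (SpZ 2) OddForm)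

theorem OddForm.map_smul_add (q : OddForm) (c : ZMod 2) (v y : Fin 2 ⊕ Fin 2 → ZMod 2) :
    q (c • v + y) = c * q v + q y + c * pairing v y := by
  obtain rfl | rfl : c = 0 ∨ c = 1 := by decide +revert
  · simp
  · simp [q.map_add]

theorem pairing_eq (x y : Fin 2 ⊕ Fin 2 → ZMod 2) :
    pairing x y = x (Sum.inl 0) * y (Sum.inr 0) + x (Sum.inl 1) * y (Sum.inr 1) +
      x (Sum.inr 0) * y (Sum.inl 0) + x (Sum.inr 1) * y (Sum.inl 1) := by
  simp [pairing, form, dotProduct, mulVec, Matrix.one_apply]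
  ring

/-- The quadratic form with the given values on the standard basis. -/
def quadForm (a b c d : ZMod 2) (x : Fin 2 ⊕ Fin 2 → ZMod 2) : ZMod 2 :=
  a * x (Sum.inl 0) + b * x (Sum.inl 1) + c * x (Sum.inr 0) + d * x (Sum.inr 1) +
    x (Sum.inl 0) * x (Sum.inr 0) + x (Sum.inl 1) * x (Sum.inr 1)

theorem OddForm.eq_quadForm (q : OddForm) :
    q.toFun = quadForm (q (Pi.single (Sum.inl 0) 1)) (q (Pi.single (Sum.inl 1) 1))
      (q (Pi.single (Sum.inr 0) 1)) (q (Pi.single (Sum.inr 1) 1)) := by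
  funext x
  have h0 : q 0 = 0 := by simpa [pairing] using q.map_add 0 0
  have hx : x = x (Sum.inl 0) • Pi.single (Sum.inl 0) 1 +
      (x (Sum.inl 1) • Pi.single (Sum.inl 1) 1 + (x (Sum.inr 0) • Pi.single (Sum.inr 0) 1 +
        (x (Sum.inr 1) • Pi.single (Sum.inr 1) 1 + 0))) := by
    ext (i | i) <;> fin_cases i <;> simp
  conv_lhs => rw [hx]
  simp only [map_smul_add, h0, pairing_eq, quadForm]
  simp
  ring

theorem sum_quadForm (a b c d : ZMod 2) :
    ∑ x, (if quadForm a b c d x = 0 then 1 else -1 : ℤ) = if a * c + b * d = 1 then -4 else 4 := by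
  decide +revert

theorem quadForm_add (a b c d : ZMod 2) (x y : Fin 2 ⊕ Fin 2 → ZMod 2) :
    quadForm a b c d (x + y) = quadForm a b c d x + quadForm a b c d y + pairing x y := by
  simp only [quadForm, pairing_eq, Pi.add_apply]
  ring

/-- The odd forms which vanish on the first basis vector. -/
def vanishingForm (c : ZMod 2) : OddForm :=
  ⟨quadForm 0 1 c 1, quadForm_add 0 1 c 1, by simp [sum_quadForm]⟩

theorem OddForm.eq_vanishingForm (q : OddForm) (hq : q (Pi.single (Sum.inl 0) 1) = 0) :
    q = vanishingForm (q (Pi.single (Sum.inr 0) 1)) := by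
  have h := q.sum_sign
  rw [q.eq_quadForm, sum_quadForm, hq] at h
  have hbd : ∀ b d : ZMod 2, b * d = 1 → b = 1 ∧ d = 1 := by decide
  have h' := hbd _ _ (by simpa using h)
  refine OddForm.ext ?_
  exact q.eq_quadForm.trans (by rw [hq, h'.1, h'.2]; rfl)

theorem reduction_transvection (x : Fin 2 ⊕ Fin 2 → ZMod 2) :
    reduction (plane ModularGroup.T)⁻¹ *ᵥ x =
      x (Sum.inr 0) • Pi.single (Sum.inl 0) 1 + x := by
  have h : reduction (plane ModularGroup.T)⁻¹ = fromBlocks 1 !![1, 0; 0, 0] 0 1 := by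
    rw [← map_inv]
    decide
  rw [h]
  ext (i | i) <;> fin_cases i <;> simp [mulVec, dotProduct, add_comm]

theorem OddForm.transvection_smul_apply (q : OddForm) (x : Fin 2 ⊕ Fin 2 → ZMod 2) :
    (plane ModularGroup.T • q) x =
      q x + x (Sum.inr 0) * (q (Pi.single (Sum.inl 0) 1) + 1) := by
  rw [smul_apply, reduction_transvection, map_smul_add, pairing_eq]
  have h : ∀ c : ZMod 2, c * c = c := by decide
  simp [h]
  ring

theorem transvection_smul_vanishingForm (c : ZMod 2) :
    plane ModularGroup.T • vanishingForm c = vanishingForm (c + 1) := by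
  refine OddForm.ext (funext fun x => ?_)
  rw [OddForm.transvection_smul_apply]
  simp [vanishingForm, quadForm]
  ring

theorem signHom_transvection : signHom (plane ModularGroup.T) = -1 := by
  classical
  have hne : vanishingForm 0 ≠ vanishingForm 1 := fun h => by
    simpa [vanishingForm, quadForm] using
      congrArg (fun q : OddForm => q (Pi.single (Sum.inr 0) 1)) h
  have hswap : MulAction.toPermHom (SpZ 2) OddForm (plane ModularGroup.T) =
      Equiv.swap (vanishingForm 0) (vanishingForm 1) := by
    refine Equiv.ext fun q => ?_
    rw [MulAction.toPermHom_apply, MulAction.toPerm_apply]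
    obtain hq | hq : q (Pi.single (Sum.inl 0) 1) = 0 ∨ q (Pi.single (Sum.inl 0) 1) = 1 := by
      generalize q _ = c
      decide +revert
    · rw [q.eq_vanishingForm hq, transvection_smul_vanishingForm]
      generalize q _ = c
      obtain rfl | rfl : c = 0 ∨ c = 1 := by decide +revert
      · simp
      · rw [Equiv.swap_apply_right]
        rfl
    · rw [Equiv.swap_apply_of_ne_of_ne]
      · refine OddForm.ext (funext fun x => ?_)
        rw [OddForm.transvection_smul_apply, hq, CharTwo.add_self_eq_zero, mul_zero, add_zero]
      all_goals
        rintro rfl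
        simp [vanishingForm, quadForm] at hq
  rw [signHom, MonoidHom.comp_apply, hswap]
  convert Equiv.Perm.sign_swap hne

theorem transvectionClass_ne_one : transvectionClass ≠ 1 := fun h => by
  have h' := congrArg (Abelianization.lift signHom) h
  rw [transvectionClass, Abelianization.lift_apply_of, signHom_transvection, map_one] at h'
  exact absurd h' (by decide)

end OddForms

theorem card_abelianization : Nat.card (Abelianization (SpZ 2)) = 2 := by
  have htop : Subgroup.zpowers transvectionClass = ⊤ := by
    rw [eq_top_iff]
    rintro x -
    obtain ⟨g, rfl⟩ := QuotientGroup.mk_surjective x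
    exact mem_transvectionSubgroup g
  rw [← Subgroup.card_top, ← htop, Nat.card_zpowers]
  exact orderOf_eq_prime transvectionClass_sq transvectionClass_ne_one

end SpZ

/-- The abelianization of `Sp(4,ℤ)` is isomorphic to `ℤ/2ℤ`. -/
theorem abelianization_Sp4Z_iso_zmod2 :
    Nonempty (Abelianization (SpZ 2) ≃* Multiplicative (ZMod 2)) := by
  have : Fact (Nat.Prime 2) := ⟨Nat.prime_two⟩
  exact ⟨mulEquivOfPrimeCardEq (p := 2) SpZ.card_abelianization (by simp)⟩
end

section
/- Let t be a positive integer and set t_1 = gcd(t,12) and t_2 = gcd(2t,12). Then the abelianization of the paramodular group Γ_{1,t}, i.e. the quotient Γ_{1,t}/Γ_{1,t}′ by its commutator subgroup, is isomorphic to ℤ/t_1ℤ × ℤ/t_2ℤ. -/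
open Matrix

/-- The standard symplectic form `J = ((0, I_2), (−I_2, 0))`. -/
def J4 (R : Type*) [CommRing R] : Matrix (Fin 4) (Fin 4) R :=
  !![0, 0, 1, 0; 0, 0, 0, 1; -1, 0, 0, 0; 0, -1, 0, 0]

/-- Membership in the paramodular group `Γ_{1,t} ⊂ Sp(4,ℚ)`: the matrix is symplectic and
its entries satisfy the integrality pattern
`(ℤ,ℤ,ℤ,tℤ; tℤ,ℤ,tℤ,tℤ; ℤ,ℤ,ℤ,tℤ; ℤ,t⁻¹ℤ,ℤ,ℤ)`. -/
def IsParamodular (t : ℕ) (M : Matrix (Fin 4) (Fin 4) ℚ) : Prop :=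
  Mᵀ * J4 ℚ * M = J4 ℚ ∧
  (∃ n : ℤ, M 0 0 = n) ∧ (∃ n : ℤ, M 0 1 = n) ∧
  (∃ n : ℤ, M 0 2 = n) ∧ (∃ n : ℤ, M 0 3 = t * n) ∧
  (∃ n : ℤ, M 1 0 = t * n) ∧ (∃ n : ℤ, M 1 1 = n) ∧
  (∃ n : ℤ, M 1 2 = t * n) ∧ (∃ n : ℤ, M 1 3 = t * n) ∧
  (∃ n : ℤ, M 2 0 = n) ∧ (∃ n : ℤ, M 2 1 = n) ∧
  (∃ n : ℤ, M 2 2 = n) ∧ (∃ n : ℤ, M 2 3 = t * n) ∧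
  (∃ n : ℤ, M 3 0 = n) ∧ (∃ n : ℤ, M 3 1 = n / t) ∧
  (∃ n : ℤ, M 3 2 = n) ∧ (∃ n : ℤ, M 3 3 = n)

namespace Paramodular

open ModularGroup MatrixGroups

/-- The Gram matrix of the alternating form of type `(1, t)` on `ℤ⁴`. -/
def form (t : ℤ) : Matrix (Fin 4) (Fin 4) ℤ :=
  !![0, 0, 1, 0; 0, 0, 0, t; -1, 0, 0, 0; 0, -t, 0, 0]

/-- The isometry group of the alternating form of type `(1, t)` on `ℤ⁴`. -/
def isometryGroup (t : ℤ) : Subgroup (Matrix (Fin 4) (Fin 4) ℤ)ˣ where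
  carrier := {N | (N : Matrix (Fin 4) (Fin 4) ℤ)ᵀ * form t * N = form t}
  one_mem' := by simp
  mul_mem' {a b} ha hb := by
    simp only [Set.mem_ofPred_eq, Units.val_mul, transpose_mul] at *
    calc _ = (b : Matrix (Fin 4) (Fin 4) ℤ)ᵀ *
          ((a : Matrix (Fin 4) (Fin 4) ℤ)ᵀ * form t * a) * b := by simp only [Matrix.mul_assoc]
      _ = form t := by rw [ha, hb]
  inv_mem' {a} ha := by
    simp only [Set.mem_ofPred_eq] at *
    have h : (a : Matrix (Fin 4) (Fin 4) ℤ) * (a⁻¹ : (Matrix (Fin 4) (Fin 4) ℤ)ˣ) = 1 := a.mul_inv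
    have h' := congrArg transpose h
    rw [transpose_mul, transpose_one] at h'
    conv_lhs => rw [← ha]
    simp only [Matrix.mul_assoc, h, Matrix.mul_one]
    rw [← Matrix.mul_assoc, h', Matrix.one_mul]

lemma mem_isometryGroup {t : ℤ} {N : (Matrix (Fin 4) (Fin 4) ℤ)ˣ} :
    N ∈ isometryGroup t ↔ (N : Matrix (Fin 4) (Fin 4) ℤ)ᵀ * form t * N = form t := Iff.rfl

/-- The underlying matrix of an isometry. -/
abbrev mat {t : ℤ} (N : isometryGroup t) : Matrix (Fin 4) (Fin 4) ℤ :=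
  (N : (Matrix (Fin 4) (Fin 4) ℤ)ˣ)

lemma mat_injective {t : ℤ} : Function.Injective (mat (t := t)) :=
  fun _ _ h => Subtype.ext (Units.ext h)

/-- The value of the alternating form of type `(1, t)`. -/
def pair (t : ℤ) (v w : Fin 4 → ℤ) : ℤ :=
  v 0 * w 2 - v 2 * w 0 + t * (v 1 * w 3 - v 3 * w 1)

lemma pair_eq (t : ℤ) (v w : Fin 4 → ℤ) : pair t v w = v ⬝ᵥ (form t *ᵥ w) := by
  simp [pair, form, dotProduct, mulVec, Fin.sum_univ_four]
  ring

lemma pair_mulVec {t : ℤ} (N : isometryGroup t) (v w : Fin 4 → ℤ) :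
    pair t (mat N *ᵥ v) (mat N *ᵥ w) = pair t v w := by
  rw [pair_eq, pair_eq, ← vecMul_transpose, ← dotProduct_mulVec, mulVec_mulVec, mulVec_mulVec,
    mem_isometryGroup.1 N.2]

lemma pair_col {t : ℤ} (N : isometryGroup t) (i j : Fin 4) :
    pair t (fun k => mat N k i) (fun k => mat N k j) = form t i j := by
  have h := pair_mulVec N (Pi.single i 1) (Pi.single j 1)
  rw [pair_eq t (Pi.single i 1)] at h
  simp only [mulVec_single_one, single_one_dotProduct] at h
  exact h

/-- An isometry from a matrix with a given inverse. -/
def ofMat {t : ℤ} (A B : Matrix (Fin 4) (Fin 4) ℤ) (h : A * B = 1)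
    (hA : Aᵀ * form t * A = form t) : isometryGroup t :=
  ⟨⟨A, B, h, mul_eq_one_comm.1 h⟩, hA⟩

/-- The matrix acting by `g` on the first hyperbolic plane. -/
def blockMat₁ (g : Matrix (Fin 2) (Fin 2) ℤ) : Matrix (Fin 4) (Fin 4) ℤ :=
  !![g 0 0, 0, g 0 1, 0; 0, 1, 0, 0; g 1 0, 0, g 1 1, 0; 0, 0, 0, 1]

/-- The matrix acting by `g` on the second hyperbolic plane. -/
def blockMat₂ (g : Matrix (Fin 2) (Fin 2) ℤ) : Matrix (Fin 4) (Fin 4) ℤ :=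
  !![1, 0, 0, 0; 0, g 0 0, 0, g 0 1; 0, 0, 1, 0; 0, g 1 0, 0, g 1 1]

lemma blockMat₁_mul (g h : Matrix (Fin 2) (Fin 2) ℤ) :
    blockMat₁ (g * h) = blockMat₁ g * blockMat₁ h := by
  ext i j
  fin_cases i <;> fin_cases j <;>
    simp [blockMat₁, Matrix.mul_apply, Fin.sum_univ_four]

lemma blockMat₂_mul (g h : Matrix (Fin 2) (Fin 2) ℤ) :
    blockMat₂ (g * h) = blockMat₂ g * blockMat₂ h := by
  ext i j
  fin_cases i <;> fin_cases j <;>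
    simp [blockMat₂, Matrix.mul_apply, Fin.sum_univ_four]

lemma blockMat₁_one : blockMat₁ 1 = 1 := by
  ext i j
  fin_cases i <;> fin_cases j <;> simp [blockMat₁]

lemma blockMat₂_one : blockMat₂ 1 = 1 := by
  ext i j
  fin_cases i <;> fin_cases j <;> simp [blockMat₂]

lemma blockMat₁_isometry (t : ℤ) (g : SL(2, ℤ)) :
    (blockMat₁ g)ᵀ * form t * blockMat₁ g = form t := by
  have h := g.det_coe
  rw [det_fin_two] at h
  ext i j
  fin_cases i <;> fin_cases j <;>
    simp [blockMat₁, form, Matrix.mul_apply, Fin.sum_univ_four] <;> linarith only [h]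

lemma blockMat₂_isometry (t : ℤ) (g : SL(2, ℤ)) :
    (blockMat₂ g)ᵀ * form t * blockMat₂ g = form t := by
  have h := g.det_coe
  rw [det_fin_two] at h
  ext i j
  fin_cases i <;> fin_cases j <;>
    simp [blockMat₂, form, Matrix.mul_apply, Fin.sum_univ_four] <;>
    first
    | linear_combination 0 * h
    | linear_combination t * h
    | linear_combination -t * h

/-- `SL(2, ℤ)` acting on the first hyperbolic plane. -/
def block₁ (t : ℤ) : SL(2, ℤ) →* isometryGroup t where
  toFun g := ofMat (blockMat₁ g) (blockMat₁ (g⁻¹ : SL(2, ℤ)))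
    ((blockMat₁_mul _ _).symm.trans ((congrArg (fun h : SL(2, ℤ) => blockMat₁ h)
      (mul_inv_cancel g)).trans blockMat₁_one)) (blockMat₁_isometry t g)
  map_one' := mat_injective (blockMat₁_one)
  map_mul' g h := mat_injective (blockMat₁_mul g h)

/-- `SL(2, ℤ)` acting on the second hyperbolic plane. -/
def block₂ (t : ℤ) : SL(2, ℤ) →* isometryGroup t where
  toFun g := ofMat (blockMat₂ g) (blockMat₂ (g⁻¹ : SL(2, ℤ)))
    ((blockMat₂_mul _ _).symm.trans ((congrArg (fun h : SL(2, ℤ) => blockMat₂ h)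
      (mul_inv_cancel g)).trans blockMat₂_one)) (blockMat₂_isometry t g)
  map_one' := mat_injective (blockMat₂_one)
  map_mul' g h := mat_injective (blockMat₂_mul g h)

lemma mat_block₁ (t : ℤ) (g : SL(2, ℤ)) : mat (block₁ t g) = blockMat₁ g := rfl

lemma mat_block₂ (t : ℤ) (g : SL(2, ℤ)) : mat (block₂ t g) = blockMat₂ g := rfl

/-- The matrix of `e₀ ↦ e₀ + s e₁`, `e₃ ↦ e₃ - t s e₂`. -/
def shearMat (t s : ℤ) : Matrix (Fin 4) (Fin 4) ℤ :=
  !![1, 0, 0, 0; s, 1, 0, 0; 0, 0, 1, -(t * s); 0, 0, 0, 1]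

lemma shearMat_add (t s r : ℤ) : shearMat t (s + r) = shearMat t s * shearMat t r := by
  ext i j
  fin_cases i <;> fin_cases j <;>
    simp [shearMat, Matrix.mul_apply, Fin.sum_univ_four]
  ring

lemma shearMat_zero (t : ℤ) : shearMat t 0 = 1 := by
  ext i j
  fin_cases i <;> fin_cases j <;> simp [shearMat]

lemma shearMat_isometry (t s : ℤ) : (shearMat t s)ᵀ * form t * shearMat t s = form t := by
  ext i j
  fin_cases i <;> fin_cases j <;>
    simp [shearMat, form, Matrix.mul_apply, Fin.sum_univ_four]
  ring

/-- The one-parameter group of isometries `e₀ ↦ e₀ + s e₁`, `e₃ ↦ e₃ - t s e₂`. -/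
def shear (t : ℤ) : Multiplicative ℤ →* isometryGroup t where
  toFun s := ofMat (shearMat t s.toAdd) (shearMat t (-s.toAdd))
    (by rw [← shearMat_add, add_neg_cancel, shearMat_zero]) (shearMat_isometry t s.toAdd)
  map_one' := mat_injective (shearMat_zero t)
  map_mul' s r := mat_injective (shearMat_add t s.toAdd r.toAdd)

lemma mat_shear (t s : ℤ) : mat (shear t (.ofAdd s)) = shearMat t s := rfl

lemma shear_eq_zpow (t s : ℤ) : shear t (.ofAdd s) = shear t (.ofAdd 1) ^ s := by
  rw [← map_zpow, ← ofAdd_zsmul]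
  simp

lemma conj_S_shear₁ (t s : ℤ) :
    mat (block₁ t S * shear t (.ofAdd s) * (block₁ t S)⁻¹) =
      !![1, 0, 0, t * s; 0, 1, s, 0; 0, 0, 1, 0; 0, 0, 0, 1] := by
  have : mat (block₁ t S * shear t (.ofAdd s) * (block₁ t S)⁻¹) =
      blockMat₁ S * shearMat t s * blockMat₁ (S⁻¹ : SL(2, ℤ)) := rfl
  rw [this]
  ext i j
  fin_cases i <;> fin_cases j <;>
    simp [blockMat₁, shearMat, Matrix.mul_apply, Fin.sum_univ_four, S_inv, coe_S]

lemma conj_S_shear₂ (t s : ℤ) :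
    mat (block₂ t S * shear t (.ofAdd s) * (block₂ t S)⁻¹) =
      !![1, 0, 0, 0; 0, 1, 0, 0; 0, t * s, 1, 0; s, 0, 0, 1] := by
  have : mat (block₂ t S * shear t (.ofAdd s) * (block₂ t S)⁻¹) =
      blockMat₂ S * shearMat t s * blockMat₂ (S⁻¹ : SL(2, ℤ)) := rfl
  rw [this]
  ext i j
  fin_cases i <;> fin_cases j <;>
    simp [blockMat₂, shearMat, Matrix.mul_apply, Fin.sum_univ_four, S_inv, coe_S]

lemma conj_S_shear₃ (t s : ℤ) :
    mat (block₂ t S * (block₁ t S * shear t (.ofAdd s) * (block₁ t S)⁻¹) * (block₂ t S)⁻¹) =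
      !![1, -(t * s), 0, 0; 0, 1, 0, 0; 0, 0, 1, 0; 0, 0, s, 1] := by
  have : mat (block₂ t S * (block₁ t S * shear t (.ofAdd s) * (block₁ t S)⁻¹) * (block₂ t S)⁻¹) =
      blockMat₂ S * mat (block₁ t S * shear t (.ofAdd s) * (block₁ t S)⁻¹) *
        blockMat₂ (S⁻¹ : SL(2, ℤ)) := rfl
  rw [this, conj_S_shear₁]
  ext i j
  fin_cases i <;> fin_cases j <;>
    simp [blockMat₂, Matrix.mul_apply, Fin.sum_univ_four, S_inv, coe_S]

lemma exists_SL2_mulVec_eq_gcd (a c : ℤ) : ∃ g : SL(2, ℤ),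
    g 0 0 * a + g 0 1 * c = Int.gcd a c ∧ g 1 0 * a + g 1 1 * c = 0 := by
  by_cases h : Int.gcd a c = 0
  · obtain ⟨rfl, rfl⟩ := Int.gcd_eq_zero_iff.1 h
    exact ⟨1, by simp⟩
  · obtain ⟨x, hx⟩ := Int.gcd_dvd_left a c
    obtain ⟨y, hy⟩ := Int.gcd_dvd_right a c
    have hb := Int.gcd_eq_gcd_ab a c
    have h' : (Int.gcd a c : ℤ) ≠ 0 := by exact_mod_cast h
    generalize Int.gcdA a c = u at *
    generalize Int.gcdB a c = v at *
    generalize (Int.gcd a c : ℤ) = d at *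
    refine ⟨⟨!![u, v; -y, x], ?_⟩, ?_, ?_⟩
    · rw [det_fin_two_of]
      apply mul_left_cancel₀ h'
      linear_combination -hb - u * hx - v * hy
    · change u * a + v * c = d
      linear_combination -hb
    · change -y * a + x * c = 0
      linear_combination -y * hx + x * hy

lemma blockMat₁_mulVec (g : Matrix (Fin 2) (Fin 2) ℤ) (a b c d : ℤ) :
    blockMat₁ g *ᵥ ![a, b, c, d] =
      ![g 0 0 * a + g 0 1 * c, b, g 1 0 * a + g 1 1 * c, d] := by
  ext i
  fin_cases i <;> simp [blockMat₁, mulVec, dotProduct, Fin.sum_univ_four]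

lemma blockMat₂_mulVec (g : Matrix (Fin 2) (Fin 2) ℤ) (a b c d : ℤ) :
    blockMat₂ g *ᵥ ![a, b, c, d] =
      ![a, g 0 0 * b + g 0 1 * d, c, g 1 0 * b + g 1 1 * d] := by
  ext i
  fin_cases i <;> simp [blockMat₂, mulVec, dotProduct, Fin.sum_univ_four]

lemma mat_mul_mulVec {t : ℤ} (M N : isometryGroup t) (v : Fin 4 → ℤ) :
    mat (M * N) *ᵥ v = mat M *ᵥ (mat N *ᵥ v) := by
  rw [mulVec_mulVec]
  rfl

section Generation

variable {t : ℤ} {C : Subgroup (isometryGroup t)}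

lemma exists_mulVec_eq_e₀ (h₁ : ∀ g, block₁ t g ∈ C) (h₂ : ∀ g, block₂ t g ∈ C)
    (h₃ : ∀ s, shear t s ∈ C) {v w : Fin 4 → ℤ} (h : pair t v w = 1) :
    ∃ k ∈ C, mat k *ᵥ v = ![1, 0, 0, 0] := by
  obtain ⟨g₁, hg₁, hg₁'⟩ := exists_SL2_mulVec_eq_gcd (v 0) (v 2)
  obtain ⟨g₂, hg₂, hg₂'⟩ := exists_SL2_mulVec_eq_gcd (v 1) (v 3)
  generalize (Int.gcd (v 0) (v 2) : ℤ) = a at *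
  generalize (Int.gcd (v 1) (v 3) : ℤ) = b at *
  have hk₁ : mat (block₁ t g₁ * block₂ t g₂) *ᵥ v = ![a, b, 0, 0] := by
    have hv : v = ![v 0, v 1, v 2, v 3] := by ext i; fin_cases i <;> rfl
    rw [mat_mul_mulVec, mat_block₁, mat_block₂, hv, blockMat₂_mulVec, blockMat₁_mulVec,
      hg₁, hg₁', hg₂, hg₂']
  have hab : Int.gcd a (t * b) = 1 := by
    rw [← pair_mulVec (block₁ t g₁ * block₂ t g₂), hk₁] at h
    generalize mat (block₁ t g₁ * block₂ t g₂) *ᵥ w = u at h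
    rw [← Int.isCoprime_iff_gcd_eq_one]
    refine ⟨u 2, u 3, ?_⟩
    simp [pair] at h
    linear_combination h
  obtain ⟨g₃, hg₃, hg₃'⟩ := exists_SL2_mulVec_eq_gcd a (t * b)
  obtain ⟨g₄, hg₄, hg₄'⟩ := exists_SL2_mulVec_eq_gcd b a
  rw [hab] at hg₃
  generalize (Int.gcd b a : ℤ) = e at *
  refine ⟨shear t (.ofAdd (-e)) * (block₂ t g₄ * (block₁ t g₃ *
    ((block₂ t S * shear t (.ofAdd 1) * (block₂ t S)⁻¹) * (block₁ t g₁ * block₂ t g₂)))),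
    ?_, ?_⟩
  · exact C.mul_mem (h₃ _) (C.mul_mem (h₂ _) (C.mul_mem (h₁ _) (C.mul_mem
      (C.mul_mem (C.mul_mem (h₂ _) (h₃ _)) (C.inv_mem (h₂ _))) (C.mul_mem (h₁ _) (h₂ _)))))
  · have hE : mat (block₂ t S * shear t (.ofAdd 1) * (block₂ t S)⁻¹) *ᵥ ![a, b, 0, 0] =
        ![a, b, t * b, a] := by
      rw [conj_S_shear₂]
      ext i
      fin_cases i <;> simp [mulVec, dotProduct, Fin.sum_univ_four]
    rw [mat_mul_mulVec, mat_mul_mulVec, mat_mul_mulVec, mat_mul_mulVec, hk₁, hE, mat_block₁,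
      blockMat₁_mulVec, hg₃, hg₃', mat_block₂, blockMat₂_mulVec, hg₄, hg₄', mat_shear]
    ext i
    fin_cases i <;> simp [shearMat, mulVec, dotProduct, Fin.sum_univ_four]

lemma exists_mulVec_eq_e₂ (h₁ : ∀ g, block₁ t g ∈ C) (h₂ : ∀ g, block₂ t g ∈ C)
    (h₃ : ∀ s, shear t s ∈ C) {w : Fin 4 → ℤ} (h : w 2 = 1) :
    ∃ k ∈ C, mat k *ᵥ ![1, 0, 0, 0] = ![1, 0, 0, 0] ∧ mat k *ᵥ w = ![0, 0, 1, 0] := by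
  have hw : w = ![w 0, w 1, 1, w 3] := by ext i; fin_cases i <;> simp [h]
  have h₄ (s) : block₁ t S * shear t (.ofAdd s) * (block₁ t S)⁻¹ ∈ C :=
    C.mul_mem (C.mul_mem (h₁ _) (h₃ _)) (C.inv_mem (h₁ _))
  refine ⟨block₁ t (T ^ (-(w 0 + t * w 3 * w 1))) *
    ((block₁ t S * shear t (.ofAdd (-w 1)) * (block₁ t S)⁻¹) *
    (block₂ t S * (block₁ t S * shear t (.ofAdd (-w 3)) * (block₁ t S)⁻¹) * (block₂ t S)⁻¹)),
    C.mul_mem (h₁ _) (C.mul_mem (h₄ _) (C.mul_mem (C.mul_mem (h₂ _) (h₄ _))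
      (C.inv_mem (h₂ _)))), ?_, ?_⟩
  · rw [mat_mul_mulVec, mat_mul_mulVec, conj_S_shear₁, conj_S_shear₃, mat_block₁, coe_T_zpow]
    ext i
    fin_cases i <;> simp [blockMat₁, mulVec, dotProduct, Fin.sum_univ_four]
  · rw [mat_mul_mulVec, mat_mul_mulVec, conj_S_shear₁, conj_S_shear₃, mat_block₁, coe_T_zpow, hw]
    ext i
    fin_cases i <;> simp [blockMat₁, mulVec, dotProduct, Fin.sum_univ_four]

lemma exists_eq_block₂ (ht : t ≠ 0) {N : isometryGroup t}
    (h₀ : mat N *ᵥ ![1, 0, 0, 0] = ![1, 0, 0, 0])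
    (h₂ : mat N *ᵥ ![0, 0, 1, 0] = ![0, 0, 1, 0]) : ∃ g, N = block₂ t g := by
  have h (i : Fin 4) := congrFun h₀ i
  have h' (i : Fin 4) := congrFun h₂ i
  have e₀ := h 0; have e₁ := h 1; have e₂ := h 2; have e₃ := h 3
  have e₀' := h' 0; have e₁' := h' 1; have e₂' := h' 2; have e₃' := h' 3
  simp [mulVec, dotProduct, Fin.sum_univ_four] at e₀ e₁ e₂ e₃ e₀' e₁' e₂' e₃'
  have p₁ := pair_col N 0 1
  have p₂ := pair_col N 0 3
  have p₃ := pair_col N 2 1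
  have p₄ := pair_col N 2 3
  have p₅ := pair_col N 1 3
  simp [pair, form, e₀, e₁, e₂, e₃, e₀', e₁', e₂', e₃'] at p₁ p₂ p₃ p₄ p₅
  simp [p₁, p₂, p₃, p₄] at p₅
  refine ⟨⟨!![mat N 1 1, mat N 1 3; mat N 3 1, mat N 3 3], ?_⟩, ?_⟩
  · rw [det_fin_two_of]
    apply mul_left_cancel₀ ht
    linear_combination p₅
  · apply mat_injective
    change mat N = blockMat₂ !![mat N 1 1, mat N 1 3; mat N 3 1, mat N 3 3]
    ext i j
    fin_cases i <;> fin_cases j <;> simp [blockMat₂, *]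

/-- The isometry group of the form of type `(1, t)` is generated by the two copies of `SL(2, ℤ)`
and one shear. -/
theorem eq_top_of_block_mem (ht : t ≠ 0) (h₁ : ∀ g, block₁ t g ∈ C) (h₂ : ∀ g, block₂ t g ∈ C)
    (h₃ : shear t (.ofAdd 1) ∈ C) : C = ⊤ := by
  have h₃ (s : Multiplicative ℤ) : shear t s ∈ C := by
    rw [← ofAdd_toAdd s, shear_eq_zpow]
    exact C.zpow_mem h₃ _
  refine eq_top_iff.2 fun N _ => ?_
  have hp : pair t ![1, 0, 0, 0] ![0, 0, 1, 0] = 1 := by simp [pair]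
  obtain ⟨k, hk, hk₀⟩ := exists_mulVec_eq_e₀ h₁ h₂ h₃ ((pair_mulVec N _ _).trans hp)
  have hp' := (pair_mulVec (k * N) _ _).trans hp
  rw [mat_mul_mulVec, hk₀] at hp'
  obtain ⟨l, hl, hl₀, hl₂⟩ := exists_mulVec_eq_e₂ h₁ h₂ h₃
    (w := mat (k * N) *ᵥ ![0, 0, 1, 0]) (by simpa [pair] using hp')
  obtain ⟨g, hg⟩ := exists_eq_block₂ ht (N := l * (k * N))
    (by rw [mat_mul_mulVec, mat_mul_mulVec, hk₀, hl₀]) (by rw [mat_mul_mulVec, hl₂])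
  have : N = k⁻¹ * (l⁻¹ * block₂ t g) := by rw [← hg]; group
  rw [this]
  exact C.mul_mem (C.inv_mem hk) (C.mul_mem (C.inv_mem hl) (h₂ g))

end Generation

section Characters

/-- The generator of the character group of `SL(2, ℤ)`, as a polynomial in the entries. -/
def chi {R : Type*} [CommRing R] (a b c d : R) : R :=
  (1 - c ^ 2) * (b * d + 3 * (c - 1) * d + c + 3) + c * (a + d - 3)

lemma chi_left_mul {m : ℕ} (hm : m = 2 ∨ m = 3 ∨ m = 4) : ∀ a b c d : ZMod m, a * d - b * c = 1 →
    chi (a + c) (b + d) c d = 1 + chi a b c d ∧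
    chi (-c) (-d) a b = chi 0 (-1) 1 0 + chi a b c d := by
  rcases hm with rfl | rfl | rfl <;> unfold chi <;> decide +kernel

/-- An extension of `chi` to invertible matrices over `ZMod 4` with determinant `±1`. -/
def chiExt (a b c d : ZMod 4) : ZMod 4 :=
  chi a b ((a * d - b * c) * c) ((a * d - b * c) * d)

/-- A quadratic function on `2 × 2` matrices. -/
def quad (p q r s : ZMod 4) : ZMod 4 :=
  p + q + r + s + p * s + q * s + p * r + p * q + r * s

lemma chiExt_left_mul : ∀ a b c d : ZMod 4, (a * d - b * c) ^ 2 = 1 →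
    chiExt (a + c) (b + d) c d = chiExt a b c d + (a * d - b * c) ∧
    chiExt (-c) (-d) a b = chiExt a b c d + (a * d - b * c) := by
  unfold chiExt chi
  decide +kernel

lemma chiExt_add_row : ∀ a b c d : ZMod 4, (a * d - b * c) ^ 2 = 1 → ∀ r s : ZMod 4,
    chiExt a b (c + 2 * (r * a + s * c)) (d + 2 * (r * b + s * d)) = chiExt a b c d + 2 * r ∧
    chiExt (a + 2 * (s * a + r * c)) (b + 2 * (s * b + r * d)) c d =
      chiExt a b c d + 2 * r + 2 * s := by
  unfold chiExt chi
  decide +kernel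

lemma two_mul_quad : ∀ p q r s : ZMod 4,
    2 * quad p (q - p) r (s - r) = 2 * quad p q r s + 2 * (p * s - q * r) ∧
    2 * quad (-q) p (-s) r = 2 * quad p q r s + 2 * (p * s - q * r) ∧
    2 * quad (p + r) (q + s) r s = 2 * quad p q r s + 2 * (p * s - q * r) ∧
    2 * quad (-r) (-s) p q = 2 * quad p q r s + 2 * (p * s - q * r) ∧
    2 * quad (p + 1) q r s = 2 * quad p q r s + 2 * (1 + q + r + s) := by
  unfold quad
  decide +kernel

/-- The nontrivial character of `Sp(4, 𝔽₂) ≃ S₆`, as a polynomial in the entries of the columns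
`a`, `b`, `c`, `d`. -/
def sgn (a₀ a₁ a₂ a₃ b₀ b₁ b₂ b₃ c₀ c₁ c₂ c₃ d₀ d₁ d₂ d₃ : ZMod 2) : ZMod 2 :=
  b₀ + a₁ + a₂ + a₃ + a₀ * c₁ + a₀ * c₂ + a₀ * c₃ + b₀ * d₁ + b₀ * c₂ + b₀ * d₃ + c₀ * a₂ +
  c₀ * b₂ + c₀ * d₂ + d₀ * c₂ + a₁ * c₁ + a₁ * a₃ + a₁ * c₃ + b₁ * d₁ + b₁ * d₃ + a₂ * c₂ +
  b₂ * d₂ + a₃ * c₃ + b₃ * d₃ + a₀ * b₀ * c₂ + a₀ * b₀ * d₂ + a₀ * c₀ * a₂ + a₀ * c₀ * b₂ +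
  a₀ * c₀ * c₂ + a₀ * c₀ * d₂ + a₀ * d₀ * c₂ + a₀ * c₁ * c₃ + a₀ * a₂ * c₂ + a₀ * b₂ * d₂ +
  b₀ * c₀ * d₂ + b₀ * d₀ * c₂ + b₀ * d₀ * d₂ + b₀ * d₁ * d₃ + a₀ * b₀ * c₀ * d₂ +
  a₀ * b₀ * d₀ * c₂

/-- The alternating form on `𝔽₂⁴`. -/
def pairTwo (a₀ a₁ a₂ a₃ b₀ b₁ b₂ b₃ : ZMod 2) : ZMod 2 :=
  a₀ * b₂ - a₂ * b₀ + (a₁ * b₃ - a₃ * b₁)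

set_option synthInstance.maxHeartbeats 0 in
set_option synthInstance.maxSize 100000 in
set_option maxRecDepth 100000 in
lemma sgn_left_mul : ∀ a₀ a₁ a₂ a₃ c₀ c₁ c₂ c₃ : ZMod 2, pairTwo a₀ a₁ a₂ a₃ c₀ c₁ c₂ c₃ = 1 →
    ∀ b₀ b₁ b₂ b₃ : ZMod 2, pairTwo a₀ a₁ a₂ a₃ b₀ b₁ b₂ b₃ = 0 →
    pairTwo c₀ c₁ c₂ c₃ b₀ b₁ b₂ b₃ = 0 → ∀ d₀ d₁ d₂ d₃ : ZMod 2,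
    pairTwo a₀ a₁ a₂ a₃ d₀ d₁ d₂ d₃ = 0 → pairTwo c₀ c₁ c₂ c₃ d₀ d₁ d₂ d₃ = 0 →
    pairTwo b₀ b₁ b₂ b₃ d₀ d₁ d₂ d₃ = 1 →
    sgn (a₀ + a₂) a₁ a₂ a₃ (b₀ + b₂) b₁ b₂ b₃ (c₀ + c₂) c₁ c₂ c₃ (d₀ + d₂) d₁ d₂ d₃ =
      1 + sgn a₀ a₁ a₂ a₃ b₀ b₁ b₂ b₃ c₀ c₁ c₂ c₃ d₀ d₁ d₂ d₃ ∧
    sgn (-a₂) a₁ a₀ a₃ (-b₂) b₁ b₀ b₃ (-c₂) c₁ c₀ c₃ (-d₂) d₁ d₀ d₃ =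
      1 + sgn a₀ a₁ a₂ a₃ b₀ b₁ b₂ b₃ c₀ c₁ c₂ c₃ d₀ d₁ d₂ d₃ ∧
    sgn a₀ (a₁ + a₃) a₂ a₃ b₀ (b₁ + b₃) b₂ b₃ c₀ (c₁ + c₃) c₂ c₃ d₀ (d₁ + d₃) d₂ d₃ =
      1 + sgn a₀ a₁ a₂ a₃ b₀ b₁ b₂ b₃ c₀ c₁ c₂ c₃ d₀ d₁ d₂ d₃ ∧
    sgn a₀ (-a₃) a₂ a₁ b₀ (-b₃) b₂ b₁ c₀ (-c₃) c₂ c₁ d₀ (-d₃) d₂ d₁ =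
      1 + sgn a₀ a₁ a₂ a₃ b₀ b₁ b₂ b₃ c₀ c₁ c₂ c₃ d₀ d₁ d₂ d₃ ∧
    sgn a₀ (a₀ + a₁) (a₂ + a₃) a₃ b₀ (b₀ + b₁) (b₂ + b₃) b₃ c₀ (c₀ + c₁) (c₂ + c₃) c₃
        d₀ (d₀ + d₁) (d₂ + d₃) d₃ =
      1 + sgn a₀ a₁ a₂ a₃ b₀ b₁ b₂ b₃ c₀ c₁ c₂ c₃ d₀ d₁ d₂ d₃ := by
  decide +kernel

/-- The character modulo `4` of the isometry group for `t ≡ 2 mod 4`, as a function of the blocks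
`(a, b; c, d)`, `(p, q; r, s)` and `(e, f; g, h)` of a matrix. -/
def chiFour (a b c d p q r s e f g h : ZMod 4) : ZMod 4 :=
  chiExt a b c d + chiExt e f g h +
    2 * quad (p * d - q * c) (q * a - p * b) (r * d - s * c) (s * a - r * b)

lemma two_mul_quad_add_two_mul (p q r s p' q' r' s' : ZMod 4) :
    2 * quad (p + 2 * p') (q + 2 * q') (r + 2 * r') (s + 2 * s') = 2 * quad p q r s := by
  have h4 : (4 : ZMod 4) = 0 := rfl
  unfold quad
  linear_combination (p' + q' + r' + s' + p * s' + p' * s + 2 * p' * s' + q * s' + q' * s +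
    2 * q' * s' + p * r' + p' * r + 2 * p' * r' + p * q' + p' * q + 2 * p' * q' +
    r * s' + r' * s + 2 * r' * s') * h4

lemma chiFour_left_mul {a b c d p q r s e f g h a' b' c' d' : ZMod 4}
    (h₁ : a * d - b * c + 2 * (p * s - q * r) = 1)
    (h₂ : e * h - f * g + 2 * (a' * d' - b' * c') = 1)
    (h₃ : a * c' - c * a' + (p * g - r * e) = 0)
    (h₄ : a * d' - c * b' + (p * h - r * f) = 0)
    (h₅ : b * c' - d * a' + (q * g - s * e) = 0)
    (h₆ : b * d' - d * b' + (q * h - s * f) = 0) :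
    chiFour (a + c) (b + d) c d p q r s e f g h = 1 + chiFour a b c d p q r s e f g h ∧
    chiFour (-c) (-d) a b p q r s e f g h = 1 + chiFour a b c d p q r s e f g h ∧
    chiFour a b c d (p + r) (q + s) r s (e + g) (f + h) g h =
      1 + chiFour a b c d p q r s e f g h ∧
    chiFour a b c d (-r) (-s) p q (-g) (-h) e f = 1 + chiFour a b c d p q r s e f g h ∧
    chiFour a b (c - 2 * r) (d - 2 * s) (a + p) (b + q) r s (2 * a' + e) (2 * b' + f) g h =
      2 + chiFour a b c d p q r s e f g h := by
  have hsq : ∀ x y : ZMod 4, x + 2 * y = 1 → x ^ 2 = 1 ∧ 2 * x = 2 := by decide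
  obtain ⟨hP, hP'⟩ := hsq _ _ h₁
  obtain ⟨hR, hR'⟩ := hsq _ _ h₂
  have h4 : (4 : ZMod 4) = 0 := rfl
  obtain ⟨hP₁, hP₂⟩ := chiExt_left_mul a b c d hP
  obtain ⟨hR₁, hR₂⟩ := chiExt_left_mul e f g h hR
  obtain ⟨q₁, q₂, q₃, q₄, -⟩ :=
    two_mul_quad (p * d - q * c) (q * a - p * b) (r * d - s * c) (s * a - r * b)
  have hdet : 2 * (p * s - q * r) = 2 * (a' * d' - b' * c') := by
    linear_combination (p * s - q * r) * -hR' + (a' * d' - b' * c') * hP' -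
      2 * (b * d' - d * b') * h₃ + 2 * (p * g - r * e) * h₆ + 2 * (b * c' - d * a') * h₄ -
      2 * (p * h - r * f) * h₅
  refine ⟨?_, ?_, ?_, ?_, ?_⟩
  · unfold chiFour
    rw [hP₁, show q * (a + c) - p * (b + d) = q * a - p * b - (p * d - q * c) by ring,
      show s * (a + c) - r * (b + d) = s * a - r * b - (r * d - s * c) by ring, q₁]
    linear_combination h₁ + (p * s - q * r) * hP'
  · unfold chiFour
    rw [hP₂, show p * b - q * a = -(q * a - p * b) by ring,
      show r * b - s * a = -(s * a - r * b) by ring,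
      show q * -c - p * -d = p * d - q * c by ring, show s * -c - r * -d = r * d - s * c by ring,
      q₂]
    linear_combination h₁ + (p * s - q * r) * hP'
  · unfold chiFour
    rw [hR₁, show (p + r) * d - (q + s) * c = p * d - q * c + (r * d - s * c) by ring,
      show (q + s) * a - (p + r) * b = q * a - p * b + (s * a - r * b) by ring, q₃]
    linear_combination h₂ + (p * s - q * r) * hP' + hdet
  · unfold chiFour
    rw [hR₂, show -r * d - -s * c = -(r * d - s * c) by ring,
      show -s * a - -r * b = -(s * a - r * b) by ring, q₄]
    linear_combination h₂ + (p * s - q * r) * hP' + hdet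
  · have hP₃ := (chiExt_add_row a b c d hP (r * d - s * c) (s * a - r * b)).1
    have hR₃ := (chiExt_add_row e f g h hR (q * a - p * b) (s * a - r * b)).2
    have q₅ :=
      (two_mul_quad (p * d - q * c) (q * a - p * b) (r * d - s * c) (s * a - r * b)).2.2.2.2
    have q₆ := two_mul_quad_add_two_mul (p * d - q * c + 1) (q * a - p * b) (r * d - s * c)
      (s * a - r * b) (b * r + q * r - a * s - p * s - (p * s - q * r)) 0 0 0
    have hq : 2 * quad ((a + p) * (d - 2 * s) - (b + q) * (c - 2 * r)) ((b + q) * a - (a + p) * b)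
        (r * (d - 2 * s) - s * (c - 2 * r)) (s * a - r * b) =
        2 * quad (p * d - q * c + 1) (q * a - p * b) (r * d - s * c) (s * a - r * b) := by
      rw [← q₆]
      congr 2
      · linear_combination h₁
      all_goals ring
    unfold chiFour
    rw [hq, q₅, show c - 2 * r = c + 2 * ((r * d - s * c) * a + (s * a - r * b) * c) by
        linear_combination -r * hP' - r * h4,
      show d - 2 * s = d + 2 * ((r * d - s * c) * b + (s * a - r * b) * d) by
        linear_combination -s * hP' - s * h4,
      show 2 * a' + e = e + 2 * ((s * a - r * b) * e + (q * a - p * b) * g) by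
        linear_combination -a' * hP' - 2 * a * h₅ + 2 * b * h₃ - (s * a - r * b) * e * h4,
      show 2 * b' + f = f + 2 * ((s * a - r * b) * f + (q * a - p * b) * h) by
        linear_combination -b' * hP' - 2 * a * h₆ + 2 * b * h₄ - (s * a - r * b) * f * h4, hP₃, hR₃]
    linear_combination ((r * d - s * c) + (q * a - p * b) + (s * a - r * b)) * h4

end Characters

section CharacterGroup

lemma dvd_apply {t : ℤ} (N : isometryGroup t) :
    t ∣ mat N 0 1 ∧ t ∣ mat N 0 3 ∧ t ∣ mat N 2 1 ∧ t ∣ mat N 2 3 := by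
  have h : (mat N)ᵀ * form t = form t * mat N⁻¹ := by
    have h' : mat N * mat N⁻¹ = 1 := (N : (Matrix (Fin 4) (Fin 4) ℤ)ˣ).mul_inv
    conv_rhs => rw [← mem_isometryGroup.1 N.2]
    rw [Matrix.mul_assoc, h', Matrix.mul_one]
  have h (i j) := congrFun (congrFun h i) j
  have h₀ := h 1 2
  have h₁ := h 3 2
  have h₂ := h 1 0
  have h₃ := h 3 0
  simp only [Matrix.mul_apply, Fin.sum_univ_four, transpose_apply] at h₀ h₁ h₂ h₃
  simp [form] at h₀ h₁ h₂ h₃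
  exact ⟨⟨mat N⁻¹ 3 2, by linear_combination h₀⟩, ⟨-mat N⁻¹ 1 2, by linear_combination h₁⟩,
    ⟨-mat N⁻¹ 3 0, by linear_combination -h₂⟩, ⟨mat N⁻¹ 1 0, by linear_combination h₃⟩⟩

variable {t : ℤ} {A : Type*} [AddCommGroup A]

/-- A function on matrices that is translated by a constant under left multiplication by each
generator of the isometry group defines a character. -/
lemma exists_character (ht : t ≠ 0) (f : Matrix (Fin 4) (Fin 4) ℤ → A) (h1 : f 1 = 0)
    (hT₁ : ∃ c, ∀ N : isometryGroup t, f (blockMat₁ T * mat N) = c + f (mat N))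
    (hS₁ : ∃ c, ∀ N : isometryGroup t, f (blockMat₁ S * mat N) = c + f (mat N))
    (hT₂ : ∃ c, ∀ N : isometryGroup t, f (blockMat₂ T * mat N) = c + f (mat N))
    (hS₂ : ∃ c, ∀ N : isometryGroup t, f (blockMat₂ S * mat N) = c + f (mat N))
    (hE : ∃ c, ∀ N : isometryGroup t, f (shearMat t 1 * mat N) = c + f (mat N)) :
    ∃ φ : Abelianization (isometryGroup t) →* Multiplicative A,
      ∀ N, φ (Abelianization.of N) = .ofAdd (f (mat N)) := by
  let C : Subgroup (isometryGroup t) :=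
    { carrier := {g | ∃ c, ∀ N, f (mat (g * N)) = c + f (mat N)}
      one_mem' := ⟨0, by simp⟩
      mul_mem' := by
        rintro g h ⟨c, hc⟩ ⟨d, hd⟩
        exact ⟨c + d, fun N => by rw [mul_assoc, hc, hd, add_assoc]⟩
      inv_mem' := by
        rintro g ⟨c, hc⟩
        exact ⟨-c, fun N => by rw [eq_neg_add_iff_add_eq, ← hc, mul_inv_cancel_left]⟩ }
  have hC : C = ⊤ := by
    have hSL (φ : SL(2, ℤ) →* isometryGroup t) (hS : φ S ∈ C) (hT : φ T ∈ C) (g) : φ g ∈ C := by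
      have : Subgroup.closure {S, T} ≤ C.comap φ := by
        rw [Subgroup.closure_le]
        rintro x (rfl | rfl)
        exacts [hS, hT]
      rw [SpecialLinearGroup.SL2Z_generators] at this
      exact this (Subgroup.mem_top g)
    exact eq_top_of_block_mem ht (hSL _ hS₁ hT₁) (hSL _ hS₂ hT₂) hE
  have hf (g N : isometryGroup t) : f (mat (g * N)) = f (mat g) + f (mat N) := by
    obtain ⟨c, hc⟩ : g ∈ C := hC ▸ Subgroup.mem_top g
    have h1 : f (mat (1 : isometryGroup t)) = 0 := h1
    have hg := hc 1
    rw [mul_one, h1, add_zero] at hg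
    rw [hc, hg]
  exact ⟨Abelianization.lift
    { toFun := fun g => .ofAdd (f (mat g))
      map_one' := congrArg _ h1
      map_mul' := fun g h => by rw [hf, ofAdd_add] },
    fun N => Abelianization.lift_apply_of _ _⟩

lemma det_block (N : isometryGroup t) :
    mat N 0 0 * mat N 2 2 - mat N 0 2 * mat N 2 0 +
      t * (mat N 1 0 * mat N 3 2 - mat N 1 2 * mat N 3 0) = 1 := by
  have := pair_col N 0 2
  simp [pair, form] at this
  linear_combination this

/-- The entries of an isometry in terms of its reduction modulo `t`. -/
lemma exists_reduction (ht : t ≠ 0) (N : isometryGroup t) : ∃ a b c d : ℤ,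
    mat N 0 1 = t * a ∧ mat N 0 3 = t * b ∧ mat N 2 1 = t * c ∧ mat N 2 3 = t * d ∧
    mat N 1 1 * mat N 3 3 - mat N 1 3 * mat N 3 1 + t * (a * d - b * c) = 1 ∧
    mat N 0 0 * c - mat N 2 0 * a + (mat N 1 0 * mat N 3 1 - mat N 3 0 * mat N 1 1) = 0 ∧
    mat N 0 0 * d - mat N 2 0 * b + (mat N 1 0 * mat N 3 3 - mat N 3 0 * mat N 1 3) = 0 ∧
    mat N 0 2 * c - mat N 2 2 * a + (mat N 1 2 * mat N 3 1 - mat N 3 2 * mat N 1 1) = 0 ∧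
    mat N 0 2 * d - mat N 2 2 * b + (mat N 1 2 * mat N 3 3 - mat N 3 2 * mat N 1 3) = 0 := by
  obtain ⟨⟨a, ha⟩, ⟨b, hb⟩, ⟨c, hc⟩, ⟨d, hd⟩⟩ := dvd_apply N
  refine ⟨a, b, c, d, ha, hb, hc, hd, ?_⟩
  have h₁ := pair_col N 1 3
  have h₂ := pair_col N 0 1
  have h₃ := pair_col N 0 3
  have h₄ := pair_col N 2 1
  have h₅ := pair_col N 2 3
  simp only [pair, form, ha, hb, hc, hd] at h₁ h₂ h₃ h₄ h₅
  simp at h₁ h₂ h₃ h₄ h₅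
  refine ⟨?_, ?_, ?_, ?_, ?_⟩ <;> apply mul_left_cancel₀ ht
  · linear_combination h₁
  · linear_combination h₂
  · linear_combination h₃
  · linear_combination h₄
  · linear_combination h₅

lemma exists_character_mod₁ (ht : t ≠ 0) {m : ℕ} (hm : m = 2 ∨ m = 3 ∨ m = 4) (hmt : (m : ℤ) ∣ t) :
    ∃ φ : Abelianization (isometryGroup t) →* Multiplicative (ZMod m),
      φ (.of (block₁ t T)) = .ofAdd 1 ∧ φ (.of (block₂ t T)) = 1 := by
  have htm : (t : ZMod m) = 0 := (ZMod.intCast_zmod_eq_zero_iff_dvd t m).2 hmt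
  have hdet (N : isometryGroup t) :
      (mat N 0 0 : ZMod m) * mat N 2 2 - mat N 0 2 * mat N 2 0 = 1 := by
    have := congrArg (Int.cast (R := ZMod m)) (det_block N)
    push_cast at this
    rw [← this, htm]
    ring
  obtain ⟨φ, hφ⟩ := exists_character ht
    (fun N => chi (N 0 0 : ZMod m) (N 0 2) (N 2 0) (N 2 2)) (by simp [chi])
    ⟨1, fun N => by
      simpa [blockMat₁, Matrix.mul_apply, Fin.sum_univ_four, coe_T] using
        (chi_left_mul hm _ _ _ _ (hdet N)).1⟩
    ⟨chi 0 (-1) 1 0, fun N => by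
      simpa [blockMat₁, Matrix.mul_apply, Fin.sum_univ_four, coe_S] using
        (chi_left_mul hm _ _ _ _ (hdet N)).2⟩
    ⟨0, fun N => by simp [blockMat₂, Matrix.mul_apply, Fin.sum_univ_four]⟩
    ⟨0, fun N => by simp [blockMat₂, Matrix.mul_apply, Fin.sum_univ_four]⟩
    ⟨0, fun N => by simp [shearMat, Matrix.mul_apply, Fin.sum_univ_four, htm]⟩
  refine ⟨φ, ?_, ?_⟩ <;> rw [hφ] <;>
    simp [mat_block₁, mat_block₂, blockMat₁, blockMat₂, coe_T, chi]

lemma exists_character_mod₂ (ht : t ≠ 0) {m : ℕ} (hm : m = 2 ∨ m = 3 ∨ m = 4) (hmt : (m : ℤ) ∣ t) :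
    ∃ φ : Abelianization (isometryGroup t) →* Multiplicative (ZMod m),
      φ (.of (block₁ t T)) = 1 ∧ φ (.of (block₂ t T)) = .ofAdd 1 := by
  have htm : (t : ZMod m) = 0 := (ZMod.intCast_zmod_eq_zero_iff_dvd t m).2 hmt
  have hdet (N : isometryGroup t) :
      (mat N 1 1 : ZMod m) * mat N 3 3 - mat N 1 3 * mat N 3 1 = 1 := by
    obtain ⟨a, b, c, d, -, -, -, -, h, -⟩ := exists_reduction ht N
    have := congrArg (Int.cast (R := ZMod m)) h
    push_cast at this
    rw [← this, htm]
    ring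
  have hzero (N : isometryGroup t) : (mat N 0 1 : ZMod m) = 0 ∧ (mat N 0 3 : ZMod m) = 0 := by
    obtain ⟨a, b, c, d, ha, hb, -⟩ := exists_reduction ht N
    simp [ha, hb, htm]
  obtain ⟨φ, hφ⟩ := exists_character ht
    (fun N => chi (N 1 1 : ZMod m) (N 1 3) (N 3 1) (N 3 3)) (by simp [chi])
    ⟨0, fun N => by simp [blockMat₁, Matrix.mul_apply, Fin.sum_univ_four]⟩
    ⟨0, fun N => by simp [blockMat₁, Matrix.mul_apply, Fin.sum_univ_four]⟩
    ⟨1, fun N => by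
      simpa [blockMat₂, Matrix.mul_apply, Fin.sum_univ_four, coe_T] using
        (chi_left_mul hm _ _ _ _ (hdet N)).1⟩
    ⟨chi 0 (-1) 1 0, fun N => by
      simpa [blockMat₂, Matrix.mul_apply, Fin.sum_univ_four, coe_S] using
        (chi_left_mul hm _ _ _ _ (hdet N)).2⟩
    ⟨0, fun N => by simp [shearMat, Matrix.mul_apply, Fin.sum_univ_four, hzero N]⟩
  refine ⟨φ, ?_, ?_⟩ <;> rw [hφ] <;>
    simp [mat_block₁, mat_block₂, blockMat₁, blockMat₂, coe_T, chi]

lemma exists_character_odd (ht : t ≠ 0) (hodd : Odd t) :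
    ∃ φ : Abelianization (isometryGroup t) →* Multiplicative (ZMod 2),
      φ (.of (block₁ t T)) = .ofAdd 1 ∧ φ (.of (block₂ t T)) = .ofAdd 1 := by
  have ht2 : (t : ZMod 2) = 1 := ZMod.intCast_eq_one_iff_odd.2 hodd
  have hpair (N : isometryGroup t) (i j) : pairTwo (mat N 0 i) (mat N 1 i) (mat N 2 i) (mat N 3 i)
      (mat N 0 j) (mat N 1 j) (mat N 2 j) (mat N 3 j) = form t i j := by
    rw [← pair_col N]
    simp [pair, pairTwo, ht2]
  have key (N : isometryGroup t) := sgn_left_mul (mat N 0 0) (mat N 1 0) (mat N 2 0) (mat N 3 0)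
    (mat N 0 2) (mat N 1 2) (mat N 2 2) (mat N 3 2) ((hpair N 0 2).trans (by simp [form]))
    (mat N 0 1) (mat N 1 1) (mat N 2 1) (mat N 3 1) ((hpair N 0 1).trans (by simp [form]))
    ((hpair N 2 1).trans (by simp [form]))
    (mat N 0 3) (mat N 1 3) (mat N 2 3) (mat N 3 3) ((hpair N 0 3).trans (by simp [form]))
    ((hpair N 2 3).trans (by simp [form])) ((hpair N 1 3).trans (by simp [form, ht2]))
  obtain ⟨φ, hφ⟩ := exists_character ht
    (fun N => sgn (N 0 0) (N 1 0) (N 2 0) (N 3 0) (N 0 1) (N 1 1) (N 2 1) (N 3 1)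
      (N 0 2) (N 1 2) (N 2 2) (N 3 2) (N 0 3) (N 1 3) (N 2 3) (N 3 3))
    (by simp [sgn]; decide)
    ⟨1, fun N => by
      rw [← (key N).1]
      simp [blockMat₁, Matrix.mul_apply, Fin.sum_univ_four, coe_T]⟩
    ⟨1, fun N => by
      rw [← (key N).2.1]
      simp [blockMat₁, Matrix.mul_apply, Fin.sum_univ_four, coe_S]⟩
    ⟨1, fun N => by
      rw [← (key N).2.2.1]
      simp [blockMat₂, Matrix.mul_apply, Fin.sum_univ_four, coe_T]⟩
    ⟨1, fun N => by
      rw [← (key N).2.2.2.1]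
      simp [blockMat₂, Matrix.mul_apply, Fin.sum_univ_four, coe_S]⟩
    ⟨1, fun N => by
      rw [← (key N).2.2.2.2]
      simp [shearMat, Matrix.mul_apply, Fin.sum_univ_four, ht2]⟩
  refine ⟨φ, ?_, ?_⟩ <;> rw [hφ] <;>
    simp [mat_block₁, mat_block₂, blockMat₁, blockMat₂, coe_T, sgn] <;> decide

lemma exists_character_four (ht : t ≠ 0) (ht4 : (t : ZMod 4) = 2) :
    ∃ φ : Abelianization (isometryGroup t) →* Multiplicative (ZMod 4),
      φ (.of (block₁ t T)) = .ofAdd 1 ∧ φ (.of (block₂ t T)) = .ofAdd 1 := by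
  choose a' b' c' d' ha hb _ _ h₂ h₃ h₄ h₅ h₆ using exists_reduction ht
  have key (N : isometryGroup t) := by
    have h₁ := congrArg (Int.cast (R := ZMod 4)) (det_block N)
    have h₂ := congrArg (Int.cast (R := ZMod 4)) (h₂ N)
    have h₃ := congrArg (Int.cast (R := ZMod 4)) (h₃ N)
    have h₄ := congrArg (Int.cast (R := ZMod 4)) (h₄ N)
    have h₅ := congrArg (Int.cast (R := ZMod 4)) (h₅ N)
    have h₆ := congrArg (Int.cast (R := ZMod 4)) (h₆ N)
    push_cast [ht4] at h₁ h₂ h₃ h₄ h₅ h₆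
    exact chiFour_left_mul h₁ h₂ h₃ h₄ h₅ h₆
  obtain ⟨φ, hφ⟩ := exists_character ht
    (fun N => chiFour (N 0 0) (N 0 2) (N 2 0) (N 2 2) (N 1 0) (N 1 2) (N 3 0) (N 3 2)
      (N 1 1) (N 1 3) (N 3 1) (N 3 3))
    (by simp [chiFour, chiExt, chi, quad])
    ⟨1, fun N => by
      obtain ⟨h, -⟩ := key N
      rw [← h]
      simp [blockMat₁, Matrix.mul_apply, Fin.sum_univ_four, coe_T]⟩
    ⟨1, fun N => by
      obtain ⟨-, h, -⟩ := key N
      rw [← h]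
      simp [blockMat₁, Matrix.mul_apply, Fin.sum_univ_four, coe_S]⟩
    ⟨1, fun N => by
      obtain ⟨-, -, h, -⟩ := key N
      rw [← h]
      simp [blockMat₂, Matrix.mul_apply, Fin.sum_univ_four, coe_T]⟩
    ⟨1, fun N => by
      obtain ⟨-, -, -, h, -⟩ := key N
      rw [← h]
      simp [blockMat₂, Matrix.mul_apply, Fin.sum_univ_four, coe_S]⟩
    ⟨2, fun N => by
      obtain ⟨-, -, -, -, h⟩ := key N
      rw [← h]
      simp [shearMat, Matrix.mul_apply, Fin.sum_univ_four, ht4, ha N, hb N, sub_eq_add_neg]⟩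
  refine ⟨φ, ?_, ?_⟩ <;> rw [hφ] <;>
    simp [mat_block₁, mat_block₂, blockMat₁, blockMat₂, coe_T, chiFour, chiExt, chi, quad]

end CharacterGroup

section AbelianizationIsometryGroup

lemma map_S_eq_zpow {A : Type*} [CommGroup A] (φ : SL(2, ℤ) →* A) :
    φ S = φ T ^ (-3 : ℤ) ∧ φ T ^ 12 = 1 := by
  have h₁ : φ S ^ 4 = 1 := by
    rw [← map_pow, show S ^ 4 = 1 by decide, map_one]
  have h₂ : φ S ^ 5 * φ T ^ 3 = 1 := by
    have := congrArg φ T_S_rel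
    simp only [smul_eq_mul, map_mul, map_inv] at this
    rw [eq_inv_iff_mul_eq_one] at this
    rw [← this]
    simp only [pow_succ, pow_zero, one_mul]
    ac_rfl
  rw [pow_succ, h₁, one_mul] at h₂
  refine ⟨by rw [_root_.zpow_neg]; exact eq_inv_of_mul_eq_one_left (by exact_mod_cast h₂), ?_⟩
  have h₃ := congrArg (· ^ 4) h₂
  simpa [mul_pow, h₁, ← pow_mul] using h₃

lemma map_mem_of_map_T_mem {A : Type*} [CommGroup A] (φ : SL(2, ℤ) →* A) {B : Subgroup A}
    (h : φ T ∈ B) (g : SL(2, ℤ)) : φ g ∈ B := by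
  have : Subgroup.closure {S, T} ≤ B.comap φ := by
    rw [Subgroup.closure_le]
    rintro x (rfl | rfl)
    · rw [SetLike.mem_coe, Subgroup.mem_comap, (map_S_eq_zpow φ).1]
      exact B.zpow_mem h _
    · exact h
  rw [SpecialLinearGroup.SL2Z_generators] at this
  exact this (Subgroup.mem_top g)

lemma shear_mul_block₁ (t : ℤ) :
    shear t (.ofAdd 1) * block₁ t T = block₁ t T * block₂ t (T ^ t) *
      (block₁ t S * shear t (.ofAdd 1) * (block₁ t S)⁻¹) * shear t (.ofAdd 1) := by
  apply mat_injective
  change shearMat t 1 * blockMat₁ T = blockMat₁ T * blockMat₂ ↑(T ^ t) *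
    mat (block₁ t S * shear t (.ofAdd 1) * (block₁ t S)⁻¹) * shearMat t 1
  rw [conj_S_shear₁]
  ext i j
  fin_cases i <;> fin_cases j <;>
    simp [blockMat₁, blockMat₂, shearMat, Matrix.mul_apply, Fin.sum_univ_four, coe_T, coe_T_zpow]

lemma conj_shear_mul_block₂ (t : ℤ) :
    block₂ t S * (block₁ t S * shear t (.ofAdd (-1)) * (block₁ t S)⁻¹) * (block₂ t S)⁻¹ *
      block₂ t T = block₂ t T * block₁ t (T ^ t) *
      (block₁ t S * shear t (.ofAdd 1) * (block₁ t S)⁻¹) *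
      (block₂ t S * (block₁ t S * shear t (.ofAdd (-1)) * (block₁ t S)⁻¹) * (block₂ t S)⁻¹) := by
  apply mat_injective
  change mat (block₂ t S * (block₁ t S * shear t (.ofAdd (-1)) * (block₁ t S)⁻¹) * (block₂ t S)⁻¹) *
      blockMat₂ T = blockMat₂ T * blockMat₁ ↑(T ^ t) *
      mat (block₁ t S * shear t (.ofAdd 1) * (block₁ t S)⁻¹) *
      mat (block₂ t S * (block₁ t S * shear t (.ofAdd (-1)) * (block₁ t S)⁻¹) * (block₂ t S)⁻¹)
  rw [conj_S_shear₁, conj_S_shear₃]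
  ext i j
  fin_cases i <;> fin_cases j <;>
    simp [blockMat₁, blockMat₂, Matrix.mul_apply, Fin.sum_univ_four, coe_T, coe_T_zpow]

lemma block₂_mul_shear (t : ℤ) :
    block₂ t (S * S) * shear t (.ofAdd 1) = shear t (.ofAdd (-1)) * block₂ t (S * S) := by
  apply mat_injective
  change blockMat₂ ↑(S * S) * shearMat t 1 = shearMat t (-1) * blockMat₂ ↑(S * S)
  ext i j
  fin_cases i <;> fin_cases j <;>
    simp [blockMat₂, shearMat, Matrix.mul_apply, Fin.sum_univ_four, coe_S]

/-- The images of the generators of the isometry group under a homomorphism to a commutative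
group. -/
lemma map_generators {A : Type*} [CommGroup A] (t : ℤ) (φ : isometryGroup t →* A) :
    φ (block₁ t T) ^ t = φ (block₂ t T) ^ t ∧ φ (block₁ t T) ^ (2 * t) = 1 ∧
      φ (shear t (.ofAdd 1)) = φ (block₁ t T) ^ (-t) := by
  have h₁ := congrArg φ (shear_mul_block₁ t)
  have h₂ := congrArg φ (conj_shear_mul_block₂ t)
  have h₃ := congrArg φ (block₂_mul_shear t)
  rw [shear_eq_zpow t (-1)] at h₂ h₃
  simp only [map_mul, map_inv, map_zpow, mul_inv_cancel_comm, _root_.zpow_neg_one] at h₁ h₂ h₃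
  generalize φ (block₁ t T) = x at *
  generalize φ (block₂ t T) = y at *
  generalize φ (shear t (.ofAdd 1)) = b at *
  generalize φ (block₂ t S) = r at *
  have h₁ : y ^ t * b = 1 := by
    apply mul_left_cancel (a := b * x)
    rw [mul_one]
    conv_rhs => rw [h₁]
    ac_rfl
  have h₂ : x ^ t * b = 1 := by
    apply mul_left_cancel (a := b⁻¹ * y)
    rw [mul_one]
    conv_rhs => rw [h₂]
    ac_rfl
  have h₃ : b * b = 1 := by
    apply mul_left_cancel (a := r * r)
    rw [← mul_assoc, h₃, mul_comm b⁻¹, inv_mul_cancel_right, mul_one]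
  refine ⟨mul_right_cancel (h₂.trans h₁.symm), ?_, ?_⟩
  · rw [two_mul, _root_.zpow_add, eq_inv_of_mul_eq_one_left h₂, ← mul_inv, h₃, inv_one]
  · rw [_root_.zpow_neg]
    exact (inv_eq_of_mul_eq_one_right h₂).symm

variable {t : ℕ}

lemma dvd_of_zpow_mul_zpow_eq_one (ht : 0 < t) {i j : ℤ}
    (h : Abelianization.of (block₁ t T) ^ i * Abelianization.of (block₂ t T) ^ j = 1) :
    (Nat.gcd t 12 : ℤ) ∣ j ∧ (Nat.gcd (2 * t) 12 : ℤ) ∣ i + j := by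
  have ht' : (t : ℤ) ≠ 0 := by omega
  have key {m : ℕ} (c d : ZMod m)
      (hφ : ∃ φ : Abelianization (isometryGroup t) →* Multiplicative (ZMod m),
        φ (.of (block₁ t T)) = .ofAdd c ∧ φ (.of (block₂ t T)) = .ofAdd d) :
      (i * c + j * d : ZMod m) = 0 := by
    obtain ⟨φ, h₁, h₂⟩ := hφ
    have := congrArg φ h
    rw [map_mul, map_zpow, map_zpow, h₁, h₂, map_one, ← ofAdd_zsmul, ← ofAdd_zsmul, ← ofAdd_add,
      ofAdd_eq_one, zsmul_eq_mul, zsmul_eq_mul] at this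
    exact this
  have hmod {m : ℕ} (hm : m = 2 ∨ m = 3 ∨ m = 4) (hmt : (m : ℤ) ∣ t) :
      (m : ℤ) ∣ i ∧ (m : ℤ) ∣ j := by
    have h₁ := key 1 0 (exists_character_mod₁ ht' hm hmt)
    have h₂ := key 0 1 (exists_character_mod₂ ht' hm hmt)
    simp only [mul_one, mul_zero, add_zero, zero_add, ZMod.intCast_zmod_eq_zero_iff_dvd] at h₁ h₂
    exact ⟨h₁, h₂⟩
  have h2 := hmod (m := 2) (by simp)
  have h3 := hmod (m := 3) (by simp)
  have h4 := hmod (m := 4) (by simp)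
  have hodd (h : t % 2 = 1) : (2 : ℤ) ∣ i + j := by
    have := key 1 1 (exists_character_odd ht' ((Int.odd_coe_nat t).2 (Nat.odd_iff.2 h)))
    rw [mul_one, mul_one, ← Int.cast_add] at this
    exact_mod_cast (ZMod.intCast_zmod_eq_zero_iff_dvd _ 2).1 this
  have heven (h : t % 4 = 2) : (4 : ℤ) ∣ i + j := by
    have := key 1 1 (exists_character_four ht' (by
      rw [Int.cast_natCast, ← ZMod.natCast_mod, h]
      rfl))
    rw [mul_one, mul_one, ← Int.cast_add] at this
    exact_mod_cast (ZMod.intCast_zmod_eq_zero_iff_dvd _ 4).1 this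
  push_cast at h2 h3 h4
  have hr : t % 12 < 12 := Nat.mod_lt _ (by norm_num)
  have ht12 := Nat.div_add_mod t 12
  rw [Nat.gcd_comm t, Nat.gcd_comm (2 * t), Nat.gcd_rec, Nat.gcd_rec 12 (2 * t), Nat.mul_mod]
  generalize t % 12 = r at *
  generalize t / 12 = k at *
  interval_cases r <;> norm_num <;> omega

/-- The abelianization of the isometry group of the form of type `(1, t)`. -/
theorem nonempty_abelianization_isometryGroup (ht : 0 < t) :
    Nonempty (Multiplicative (ZMod (Nat.gcd t 12) × ZMod (Nat.gcd (2 * t) 12)) ≃*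
      Abelianization (isometryGroup t)) := by
  obtain ⟨hxy, hx, hb⟩ := map_generators (t : ℤ) Abelianization.of
  have hx12 := (map_S_eq_zpow (Abelianization.of.comp (block₁ (t : ℤ)))).2
  have hy12 := (map_S_eq_zpow (Abelianization.of.comp (block₂ (t : ℤ)))).2
  have hdvd {i j : ℤ} := dvd_of_zpow_mul_zpow_eq_one ht (i := i) (j := j)
  set x : Abelianization (isometryGroup t) := .of (block₁ t T) with hx_def
  set y : Abelianization (isometryGroup t) := .of (block₂ t T) with hy_def
  simp only [MonoidHom.comp_apply, ← hx_def, ← hy_def] at hx12 hy12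
  have hu : (x * y⁻¹) ^ Nat.gcd t 12 = 1 := by
    rw [pow_gcd_eq_one, mul_pow, mul_pow, inv_pow, inv_pow, hx12, hy12]
    simp only [zpow_natCast] at hxy
    simp [hxy]
  have hv : x ^ Nat.gcd (2 * t) 12 = 1 := by
    rw [pow_gcd_eq_one]
    exact ⟨by exact_mod_cast hx, hx12⟩
  let f : ZMod (Nat.gcd t 12) × ZMod (Nat.gcd (2 * t) 12) →+
      Additive (Abelianization (isometryGroup t)) :=
    (ZMod.lift _ ⟨zmultiplesHom _ (.ofMul (x * y⁻¹)), by
      rw [zmultiplesHom_apply, natCast_zsmul, ← ofMul_pow, hu, ofMul_one]⟩).coprod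
      (ZMod.lift _ ⟨zmultiplesHom _ (.ofMul x), by
        rw [zmultiplesHom_apply, natCast_zsmul, ← ofMul_pow, hv, ofMul_one]⟩)
  have hf (a b : ℤ) : f (a, b) = .ofMul (x ^ (a + b) * y ^ (-a)) := by
    simp only [f, AddMonoidHom.coprod_apply, ZMod.lift_coe, zmultiplesHom_apply, ← ofMul_zpow,
      ← ofMul_mul]
    rw [mul_zpow, _root_.zpow_add, _root_.zpow_neg, _root_.inv_zpow, mul_right_comm]
  refine ⟨(AddEquiv.ofBijective f ⟨?_, ?_⟩).toMultiplicativeLeft⟩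
  · rw [injective_iff_map_eq_zero]
    rintro ⟨a, b⟩ h
    obtain ⟨a, rfl⟩ := ZMod.intCast_surjective a
    obtain ⟨b, rfl⟩ := ZMod.intCast_surjective b
    rw [hf, ofMul_eq_zero] at h
    obtain ⟨ha, hb⟩ := hdvd h
    rw [dvd_neg] at ha
    rw [add_neg_cancel_comm] at hb
    simp [ZMod.intCast_zmod_eq_zero_iff_dvd, ha, hb]
  · let B : Subgroup (Abelianization (isometryGroup t)) :=
      (AddMonoidHom.toMultiplicativeLeft f).range
    have hB (a b : ℤ) : x ^ (a + b) * y ^ (-a) ∈ B := ⟨.ofAdd (a, b), hf a b⟩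
    have hxB : x ∈ B := by simpa using hB 0 1
    have hyB : y ∈ B := by simpa using hB (-1) 1
    have htop := eq_top_of_block_mem (C := B.comap Abelianization.of) (t := t) (by omega)
      (map_mem_of_map_T_mem (Abelianization.of.comp (block₁ (t : ℤ))) hxB)
      (map_mem_of_map_T_mem (Abelianization.of.comp (block₂ (t : ℤ))) hyB)
      (by
        rw [Subgroup.mem_comap, hb]
        exact B.zpow_mem hxB _)
    intro z
    obtain ⟨g, hg⟩ := QuotientGroup.mk_surjective z.toMul
    obtain ⟨w, hw⟩ : Abelianization.of g ∈ B := by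
      rw [← Subgroup.mem_comap, htop]
      exact Subgroup.mem_top g
    exact ⟨w.toAdd, hw.trans hg⟩

end AbelianizationIsometryGroup

section ParamodularGroup

/-- The diagonal matrix `diag(1, t, 1, 1)`, which conjugates the isometry group of the form of type
`(1, t)` to the paramodular group. -/
def diagUnit {t : ℕ} (ht : 0 < t) : GL (Fin 4) ℚ where
  val := diagonal ![1, t, 1, 1]
  inv := diagonal ![1, (t : ℚ)⁻¹, 1, 1]
  val_inv := by
    have : (t : ℚ) ≠ 0 := by positivity
    rw [diagonal_mul_diagonal, ← diagonal_one]
    congr 1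
    ext i
    fin_cases i <;> simp [this]
  inv_val := by
    have : (t : ℚ) ≠ 0 := by positivity
    rw [diagonal_mul_diagonal, ← diagonal_one]
    congr 1
    ext i
    fin_cases i <;> simp [this]

/-- The embedding of the isometry group of the form of type `(1, t)` onto the paramodular group. -/
def toGL {t : ℕ} (ht : 0 < t) : isometryGroup t →* GL (Fin 4) ℚ :=
  (MulAut.conj (diagUnit ht)).toMonoidHom.comp
    ((Units.map (Int.castRingHom ℚ).mapMatrix.toMonoidHom).comp
      (isometryGroup t).subtype)

variable {t : ℕ}

lemma coe_toGL (ht : 0 < t) (N : isometryGroup t) : (toGL ht N : Matrix (Fin 4) (Fin 4) ℚ) =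
    diagonal ![1, (t : ℚ), 1, 1] * (mat N).map (Int.cast : ℤ → ℚ) *
      diagonal ![1, (t : ℚ)⁻¹, 1, 1] := rfl

lemma toGL_injective (ht : 0 < t) : Function.Injective (toGL ht) := by
  have hinj : Function.Injective (Units.map
      (Int.castRingHom ℚ).mapMatrix.toMonoidHom : (Matrix (Fin 4) (Fin 4) ℤ)ˣ →* GL (Fin 4) ℚ) :=
    Units.map_injective (map_injective Int.cast_injective)
  exact (MulAut.conj (diagUnit ht)).injective.comp
    (hinj.comp (isometryGroup t).subtype_injective)

lemma transpose_mul_J4_mul_iff (ht : 0 < t) (N : Matrix (Fin 4) (Fin 4) ℤ)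
    (M : Matrix (Fin 4) (Fin 4) ℚ)
    (hM : M = diagonal ![1, (t : ℚ), 1, 1] * N.map (Int.cast : ℤ → ℚ) *
      diagonal ![1, (t : ℚ)⁻¹, 1, 1]) :
    Mᵀ * J4 ℚ * M = J4 ℚ ↔ Nᵀ * form t * N = form t := by
  set D : Matrix (Fin 4) (Fin 4) ℚ := diagonal ![1, (t : ℚ), 1, 1] with hD
  set E : Matrix (Fin 4) (Fin 4) ℚ := diagonal ![1, (t : ℚ)⁻¹, 1, 1] with hE
  have hDE : D * E = 1 := (diagUnit ht).val_inv
  have hED : E * D = 1 := (diagUnit ht).inv_val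
  have hform : D * J4 ℚ * D = (form t).map (Int.cast : ℤ → ℚ) := by
    ext i j
    rw [hD, mul_diagonal, diagonal_mul]
    fin_cases i <;> fin_cases j <;> simp [J4, form]
  have hJ : Mᵀ * J4 ℚ * M = E * ((Nᵀ * form t * N).map (Int.cast : ℤ → ℚ)) * E := by
    have : (Nᵀ * form t * N).map (Int.cast : ℤ → ℚ) =
        (N.map (Int.cast : ℤ → ℚ))ᵀ * (form t).map (Int.cast : ℤ → ℚ) *
          N.map (Int.cast : ℤ → ℚ) := by
      rw [← transpose_map]
      simp only [Matrix.map_mul_intCast]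
    rw [this, ← hform, hM]
    simp only [transpose_mul, Matrix.mul_assoc, hD, hE, diagonal_transpose]
  have hJ' : J4 ℚ = E * ((form t).map (Int.cast : ℤ → ℚ)) * E := by
    rw [← hform]
    calc _ = (E * D) * J4 ℚ * (D * E) := by rw [hED, hDE, Matrix.one_mul, Matrix.mul_one]
      _ = _ := by simp only [Matrix.mul_assoc]
  rw [hJ]
  conv_lhs => rhs; rw [hJ']
  constructor
  · intro h
    apply map_injective (Int.cast_injective (α := ℚ))
    have := congrArg (fun X => D * X * D) h
    simp only [Matrix.mul_assoc, hED, Matrix.mul_one] at this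
    simpa only [← Matrix.mul_assoc, hDE, Matrix.one_mul] using this
  · intro h
    rw [h]

lemma isUnit_of_transpose_mul_form_mul (ht : 0 < t) {N : Matrix (Fin 4) (Fin 4) ℤ}
    (h : Nᵀ * form t * N = form t) : IsUnit N := by
  rw [isUnit_iff_isUnit_det]
  have hdet := congrArg det h
  have hform : (form t).det = t ^ 2 := by
    simp [form, det_succ_row_zero, Fin.sum_univ_succ, Fin.succAbove]
    ring
  rw [det_mul, det_mul, det_transpose, hform] at hdet
  apply IsUnit.of_mul_eq_one N.det
  have : (t : ℤ) ^ 2 ≠ 0 := by positivity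
  apply mul_right_cancel₀ this
  linear_combination hdet

lemma isParamodular_iff_mem_range (ht : 0 < t) (g : GL (Fin 4) ℚ) :
    IsParamodular t (g : Matrix (Fin 4) (Fin 4) ℚ) ↔ g ∈ (toGL ht).range := by
  have ht0 : (t : ℚ) ≠ 0 := by positivity
  constructor
  · rintro ⟨hJ, ⟨n₀₀, h₀₀⟩, ⟨n₀₁, h₀₁⟩, ⟨n₀₂, h₀₂⟩, ⟨n₀₃, h₀₃⟩, ⟨n₁₀, h₁₀⟩, ⟨n₁₁, h₁₁⟩, ⟨n₁₂, h₁₂⟩,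
      ⟨n₁₃, h₁₃⟩, ⟨n₂₀, h₂₀⟩, ⟨n₂₁, h₂₁⟩, ⟨n₂₂, h₂₂⟩, ⟨n₂₃, h₂₃⟩, ⟨n₃₀, h₃₀⟩, ⟨n₃₁, h₃₁⟩,
      ⟨n₃₂, h₃₂⟩, ⟨n₃₃, h₃₃⟩⟩
    let N : Matrix (Fin 4) (Fin 4) ℤ := !![n₀₀, t * n₀₁, n₀₂, t * n₀₃; n₁₀, n₁₁, n₁₂, n₁₃;
      n₂₀, t * n₂₁, n₂₂, t * n₂₃; n₃₀, n₃₁, n₃₂, n₃₃]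
    have hg : (g : Matrix (Fin 4) (Fin 4) ℚ) = diagonal ![1, (t : ℚ), 1, 1] *
        N.map (Int.cast : ℤ → ℚ) * diagonal ![1, (t : ℚ)⁻¹, 1, 1] := by
      ext i j
      rw [mul_diagonal, diagonal_mul]
      fin_cases i <;> fin_cases j <;> simp [N, *] <;> field_simp
    have hN := (transpose_mul_J4_mul_iff ht N g hg).1 hJ
    obtain ⟨u, hu⟩ := isUnit_of_transpose_mul_form_mul ht hN
    clear_value N
    subst hu
    exact ⟨⟨u, hN⟩, Units.ext hg.symm⟩
  · rintro ⟨N, rfl⟩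
    have hval (i j) : (toGL ht N : Matrix (Fin 4) (Fin 4) ℚ) i j =
        (![1, (t : ℚ), 1, 1] : Fin 4 → ℚ) i * mat N i j *
          (![1, (t : ℚ)⁻¹, 1, 1] : Fin 4 → ℚ) j := by
      rw [coe_toGL, mul_diagonal, diagonal_mul, map_apply]
    obtain ⟨⟨a, ha⟩, ⟨b, hb⟩, ⟨c, hc⟩, ⟨d, hd⟩⟩ := dvd_apply N
    refine ⟨(transpose_mul_J4_mul_iff ht _ _ (coe_toGL ht N)).2 N.2, ?_⟩
    simp only [hval]
    refine ⟨⟨mat N 0 0, ?_⟩, ⟨a, ?_⟩, ⟨mat N 0 2, ?_⟩, ⟨b, ?_⟩, ⟨mat N 1 0, ?_⟩, ⟨mat N 1 1, ?_⟩,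
      ⟨mat N 1 2, ?_⟩, ⟨mat N 1 3, ?_⟩, ⟨mat N 2 0, ?_⟩, ⟨c, ?_⟩, ⟨mat N 2 2, ?_⟩, ⟨d, ?_⟩,
      ⟨mat N 3 0, ?_⟩, ⟨mat N 3 1, ?_⟩, ⟨mat N 3 2, ?_⟩, ⟨mat N 3 3, ?_⟩⟩ <;>
      simp [ha, hb, hc, hd] <;> field_simp

end ParamodularGroup

end Paramodular

/-- The abelianization of the paramodular group `Γ_{1,t}` is isomorphic to
`ℤ/t_1ℤ × ℤ/t_2ℤ`, where `t_1 = gcd(t,12)` and `t_2 = gcd(2t,12)`. -/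
theorem paramodular_abelianization (t : ℕ) (ht : 0 < t)
    (Γ : Subgroup (GL (Fin 4) ℚ))
    (hΓ : ∀ g : GL (Fin 4) ℚ, g ∈ Γ ↔ IsParamodular t (g : Matrix (Fin 4) (Fin 4) ℚ)) :
    Nonempty (Abelianization Γ ≃*
      Multiplicative (ZMod (Nat.gcd t 12) × ZMod (Nat.gcd (2 * t) 12))) := by
  obtain ⟨e⟩ := Paramodular.nonempty_abelianization_isometryGroup ht
  obtain rfl : Γ = (Paramodular.toGL ht).range := by
    ext g
    rw [hΓ, Paramodular.isParamodular_iff_mem_range ht]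
  exact ⟨(MonoidHom.ofInjective (Paramodular.toGL_injective ht)).symm.abelianizationCongr.trans
    e.symm⟩
end

section
/- Every subgroup H of finite index in Sp(4,ℤ) contains a principal congruence subgroup: there exists an integer n ≥ 1 such that Γ_2(n) = ker(Sp(4,ℤ) → Sp(4, ℤ/nℤ)) ⊆ H, where the map is entrywise reduction modulo n. -/
open Matrix

/-- `Sp(4,ℤ)`: the group of `4×4` integer matrices `M` with `ᵀM·J·M = J`,
where `J = ((0, I_2), (−I_2, 0))` is the standard symplectic form. -/
def Sp4Z : Subgroup (GL (Fin 2 ⊕ Fin 2) ℤ) :=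
  sympGroup (Fin 2 ⊕ Fin 2) ℤ (Matrix.fromBlocks 0 1 (-1) 0)

open scoped NumberTheorySymbols in
theorem jacobiSym_natCast_eq_of_dvd_add {a p b : ℕ} (ha : a % 8 = 1) (hp : p % 8 = 7)
    (hb : b ≠ 0) (h : b ∣ p + a) : J(b | p) = J(b | a) := by
  have ha2 : Odd a := Nat.odd_iff.2 (by omega)
  have hp2 : Odd p := Nat.odd_iff.2 (by omega)
  obtain ⟨k, m, hm, rfl⟩ := Nat.exists_eq_two_pow_mul_odd hb
  have h2a : J(2 | a) = 1 := by
    rw [jacobiSym.at_two ha2, ZMod.χ₈_nat_eq_if_mod_eight]; simp [ha]; omega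
  have h2p : J(2 | p) = 1 := by
    rw [jacobiSym.at_two hp2, ZMod.χ₈_nat_eq_if_mod_eight]; simp [hp]; omega
  have hma : J(m | a) = J(a | m) :=
    jacobiSym.quadratic_reciprocity_one_mod_four' hm (by omega)
  have hpa : J(p | m) = J(-1 | m) * J(a | m) := by
    rw [← jacobiSym.mul_left]
    refine jacobiSym.mod_left' (Int.ModEq.symm (Int.modEq_iff_dvd.2 ?_))
    have : ((m : ℕ) : ℤ) ∣ ((p + a : ℕ) : ℤ) :=
      Int.natCast_dvd_natCast.2 ((Dvd.intro_left _ rfl).trans h)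
    push_cast at this
    simpa using this
  have hmp : J(m | p) = J(a | m) := by
    rcases Nat.odd_mod_four_iff.1 (Nat.odd_iff.1 hm) with h4 | h4
    · rw [jacobiSym.quadratic_reciprocity_one_mod_four h4 hp2, hpa, jacobiSym.at_neg_one hm,
        ZMod.χ₄_nat_one_mod_four h4, one_mul]
    · rw [jacobiSym.quadratic_reciprocity_three_mod_four h4 (by omega), hpa,
        jacobiSym.at_neg_one hm, ZMod.χ₄_nat_three_mod_four h4]
      ring
  push_cast
  rw [jacobiSym.mul_left, jacobiSym.mul_left, jacobiSym.pow_left, jacobiSym.pow_left, h2a, h2p,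
    hma, hmp]

open scoped NumberTheorySymbols in
theorem jacobiSym_neg_natCast_eq_of_dvd_add {a p b : ℕ} (ha : a % 8 = 1) (hp : p % 8 = 7)
    (hb : b ≠ 0) (h : b ∣ p + a) : J(-(b : ℤ) | p) = -J(-(b : ℤ) | a) := by
  have ha2 : Odd a := Nat.odd_iff.2 (by omega)
  have hp2 : Odd p := Nat.odd_iff.2 (by omega)
  have ha4 : a % 4 = 1 := by omega
  have hp4 : p % 4 = 3 := by omega
  rw [jacobiSym.neg _ ha2, jacobiSym.neg _ hp2, jacobiSym_natCast_eq_of_dvd_add ha hp hb h,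
    ZMod.χ₄_nat_one_mod_four ha4, ZMod.χ₄_nat_three_mod_four hp4]
  ring

/-- By Dirichlet's theorem and quadratic reciprocity, a coprime pair `(a, b)` with `a > 0` can be
moved to a pair `(-p, b')` where `b'` is a square modulo the prime `p`. -/
theorem exists_prime_isSquare {n : ℕ} (hn : n ≠ 0) (h8 : 8 ∣ n) {a b : ℤ} (ha0 : 0 < a)
    (ha : (n : ℤ) ∣ a - 1) (hb : (n : ℤ) ∣ b) (hab : IsCoprime a b) :
    ∃ (t k : ℤ) (p : ℕ), p.Prime ∧ -(p : ℤ) = a + k * (b + n * t * a) ∧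
      IsSquare (((b + n * t * a : ℤ)) : ZMod p) := by
  lift a to ℕ using ha0.le
  have h8n : (8 : ℤ) ∣ n := by exact_mod_cast h8
  have ha8 : a % 8 = 1 := by
    have := h8n.trans ha
    omega
  have hcop (t : ℤ) : IsCoprime (a : ℤ) (b + n * t * a) := hab.add_mul_right_right _
  have hdiv (t : ℤ) : (n : ℤ) ∣ b + n * t * a := hb.add (by rw [mul_assoc]; exact dvd_mul_right _ _)
  have hprime {B : ℤ} (hB0 : B ≠ 0) (hB : IsCoprime (a : ℤ) B) (hnB : (n : ℤ) ∣ B) :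
      ∃ p : ℕ, p.Prime ∧ p % 8 = 7 ∧ B ∣ p + a := by
    obtain ⟨p, -, hp, hpm⟩ := Nat.forall_exists_prime_gt_and_zmodEq 0 (q := B.natAbs) (a := -a)
      (by simpa using hB0) (by
        rw [IsCoprime.neg_left_iff, Int.natCast_natAbs]
        exact hB.abs_right)
    have hd : B ∣ p + a := by
      have := (Int.modEq_iff_dvd.1 hpm.symm)
      rw [Int.natAbs_dvd] at this
      simpa using this
    refine ⟨p, hp, ?_, hd⟩
    have := (h8n.trans hnB).trans hd
    omega
  have hsq {p : ℕ} (hp : p.Prime) {B : ℤ} (h : jacobiSym B p = 1) : IsSquare (B : ZMod p) := by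
    have : Fact p.Prime := ⟨hp⟩
    exact ZMod.isSquare_of_jacobiSym_eq_one h
  have hn1 : (1 : ℤ) ≤ n := by exact_mod_cast Nat.one_le_iff_ne_zero.2 hn
  have hna : (1 : ℤ) ≤ n * a := by nlinarith
  have hinv (t : ℤ) : jacobiSym (b + n * t * a) a = jacobiSym b a :=
    jacobiSym.mod_left' (by simp)
  rcases jacobiSym.eq_one_or_neg_one (Int.isCoprime_iff_gcd_eq_one.1 hab.symm) with h1 | h1
  · set t : ℤ := |b| + 1
    have hB : 0 < b + n * t * a := by
      have : b + n * t * a = b + (n * a) * t := by ring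
      have := neg_abs_le b
      have : t ≤ n * a * t := by nlinarith [abs_nonneg b]
      grind
    obtain ⟨p, hp, hp8, k, hk⟩ := hprime hB.ne' (hcop t) (hdiv t)
    refine ⟨t, -k, p, hp, by linear_combination -hk, hsq hp ?_⟩
    obtain ⟨B, hBeq⟩ := Int.eq_ofNat_of_zero_le hB.le
    have := hinv t
    rw [hBeq] at this hB hk ⊢
    rw [jacobiSym_natCast_eq_of_dvd_add ha8 hp8 (by omega) (by exact_mod_cast Dvd.intro k hk.symm),
      this, h1]
  · set t : ℤ := -(|b| + 1)
    have hB : b + n * t * a < 0 := by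
      have : b + n * t * a = b + (n * a) * t := by ring
      have := le_abs_self b
      have : n * a * t ≤ t := by nlinarith [abs_nonneg b]
      grind
    obtain ⟨p, hp, hp8, k, hk⟩ := hprime hB.ne (hcop t) (hdiv t)
    refine ⟨t, -k, p, hp, by linear_combination -hk, hsq hp ?_⟩
    obtain ⟨B, hBeq⟩ := Int.eq_ofNat_of_zero_le (neg_nonneg.2 hB.le)
    have := hinv t
    rw [← neg_neg (b + n * t * a), hBeq] at this hB hk ⊢
    rw [jacobiSym_neg_natCast_eq_of_dvd_add ha8 hp8 (by omega)
      (by exact_mod_cast (Dvd.intro (-k) (by rw [hk]; ring) : (B : ℤ) ∣ p + a)), this, h1, neg_neg]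

/-- A nonzero square modulo `p ≡ -1 mod n` is a `2e`-th power if `e ∣ n` and `8 ∣ n`. -/
theorem exists_pow_eq_of_isSquare {n e p : ℕ} (he : e ∣ n) (h8 : 8 ∣ n) (hp : p.Prime)
    (hpn : n ∣ p + 1) {x : ZMod p} (hx0 : x ≠ 0) (hx : IsSquare x) :
    ∃ z : ℤ, x = (z : ZMod p) ^ (2 * e) := by
  have : Fact p.Prime := ⟨hp⟩
  have hp8 : p % 8 = 7 := by have := h8.trans hpn; omega
  obtain ⟨m, hm⟩ : ∃ m, p = 2 * m + 1 := ⟨p / 2, by omega⟩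
  have hxm : x ^ m = 1 := by
    have := (ZMod.euler_criterion p hx0).1 hx
    rwa [show p / 2 = m by omega] at this
  have hcop : Nat.Coprime (2 * e) m := by
    refine Nat.Coprime.mul_left (Nat.coprime_two_left.2 (Nat.odd_iff.2 (by omega))) ?_
    refine Nat.coprime_of_dvd fun q hq hqe hqm => ?_
    have h1 : q ∣ 2 * m + 2 := by
      have := (hqe.trans he).trans hpn
      rwa [hm] at this
    have h2 : q ∣ 2 := (Nat.dvd_add_right (hqm.mul_left 2)).1 h1
    have : q = 2 := (Nat.prime_dvd_prime_iff_eq hq Nat.prime_two).1 h2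
    subst this
    omega
  obtain ⟨k, -, hk⟩ := Nat.exists_mul_mod_eq_one_of_coprime hcop (by omega)
  refine ⟨((x ^ k).val : ℤ), ?_⟩
  rw [Int.cast_natCast, ZMod.natCast_zmod_val, ← pow_mul, mul_comm k,
    ← Nat.mod_add_div (2 * e * k) m, hk, pow_add, pow_mul, hxm, one_pow, pow_one, mul_one]

namespace Sp4Z

/-- The `4 × 4` matrix with the given entries, listed row by row. -/
def ofEntries (a b c d e f g h i j k l m n o p : ℤ) :
    Matrix (Fin 2 ⊕ Fin 2) (Fin 2 ⊕ Fin 2) ℤ :=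
  fromBlocks !![a, b; e, f] !![c, d; g, h] !![i, j; m, n] !![k, l; o, p]

theorem ofEntries_mul (a b c d e f g h i j k l m n o p
    a' b' c' d' e' f' g' h' i' j' k' l' m' n' o' p' : ℤ) :
    ofEntries a b c d e f g h i j k l m n o p *
      ofEntries a' b' c' d' e' f' g' h' i' j' k' l' m' n' o' p' =
    ofEntries
      (a * a' + b * e' + c * i' + d * m') (a * b' + b * f' + c * j' + d * n')
      (a * c' + b * g' + c * k' + d * o') (a * d' + b * h' + c * l' + d * p')
      (e * a' + f * e' + g * i' + h * m') (e * b' + f * f' + g * j' + h * n')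
      (e * c' + f * g' + g * k' + h * o') (e * d' + f * h' + g * l' + h * p')
      (i * a' + j * e' + k * i' + l * m') (i * b' + j * f' + k * j' + l * n')
      (i * c' + j * g' + k * k' + l * o') (i * d' + j * h' + k * l' + l * p')
      (m * a' + n * e' + o * i' + p * m') (m * b' + n * f' + o * j' + p * n')
      (m * c' + n * g' + o * k' + p * o') (m * d' + n * h' + o * l' + p * p') := by
  simp only [ofEntries, fromBlocks_multiply, Matrix.mul_fin_two]
  congr 1 <;> ext x y <;> fin_cases x <;> fin_cases y <;> simp <;> ring

theorem ofEntries_transpose (a b c d e f g h i j k l m n o p : ℤ) :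
    (ofEntries a b c d e f g h i j k l m n o p)ᵀ =
      ofEntries a e i m b f j n c g k o d h l p := by
  simp only [ofEntries, fromBlocks_transpose]
  congr 1 <;> ext x y <;> fin_cases x <;> fin_cases y <;> rfl

theorem eq_ofEntries (M : Matrix (Fin 2 ⊕ Fin 2) (Fin 2 ⊕ Fin 2) ℤ) :
    M = ofEntries
      (M (.inl 0) (.inl 0)) (M (.inl 0) (.inl 1)) (M (.inl 0) (.inr 0)) (M (.inl 0) (.inr 1))
      (M (.inl 1) (.inl 0)) (M (.inl 1) (.inl 1)) (M (.inl 1) (.inr 0)) (M (.inl 1) (.inr 1))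
      (M (.inr 0) (.inl 0)) (M (.inr 0) (.inl 1)) (M (.inr 0) (.inr 0)) (M (.inr 0) (.inr 1))
      (M (.inr 1) (.inl 0)) (M (.inr 1) (.inl 1)) (M (.inr 1) (.inr 0)) (M (.inr 1) (.inr 1)) := by
  ext (x | x) (y | y) <;> fin_cases x <;> fin_cases y <;> rfl

theorem one_eq_ofEntries :
    (1 : Matrix (Fin 2 ⊕ Fin 2) (Fin 2 ⊕ Fin 2) ℤ) =
      ofEntries 1 0 0 0 0 1 0 0 0 0 1 0 0 0 0 1 := by
  ext (x | x) (y | y) <;> fin_cases x <;> fin_cases y <;> rfl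

theorem fromBlocks_eq_ofEntries :
    (fromBlocks 0 1 (-1) 0 : Matrix (Fin 2 ⊕ Fin 2) (Fin 2 ⊕ Fin 2) ℤ) =
      ofEntries 0 0 1 0 0 0 0 1 (-1) 0 0 0 0 (-1) 0 0 := by
  ext (x | x) (y | y) <;> fin_cases x <;> fin_cases y <;> rfl

theorem ofEntries_inj {a b c d e f g h i j k l m n o p
    a' b' c' d' e' f' g' h' i' j' k' l' m' n' o' p' : ℤ} :
    ofEntries a b c d e f g h i j k l m n o p =
      ofEntries a' b' c' d' e' f' g' h' i' j' k' l' m' n' o' p' ↔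
    (a = a' ∧ b = b' ∧ c = c' ∧ d = d') ∧ (e = e' ∧ f = f' ∧ g = g' ∧ h = h') ∧
    (i = i' ∧ j = j' ∧ k = k' ∧ l = l') ∧ (m = m' ∧ n = n' ∧ o = o' ∧ p = p') := by
  refine ⟨fun H => ?_, by rintro ⟨⟨rfl, rfl, rfl, rfl⟩, ⟨rfl, rfl, rfl, rfl⟩,
    ⟨rfl, rfl, rfl, rfl⟩, ⟨rfl, rfl, rfl, rfl⟩⟩; rfl⟩
  have hxy := fun x y => congrFun (congrFun H x) y
  exact ⟨⟨hxy (.inl 0) (.inl 0), hxy (.inl 0) (.inl 1), hxy (.inl 0) (.inr 0), hxy (.inl 0) (.inr 1)⟩,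
    ⟨hxy (.inl 1) (.inl 0), hxy (.inl 1) (.inl 1), hxy (.inl 1) (.inr 0), hxy (.inl 1) (.inr 1)⟩,
    ⟨hxy (.inr 0) (.inl 0), hxy (.inr 0) (.inl 1), hxy (.inr 0) (.inr 0), hxy (.inr 0) (.inr 1)⟩,
    ⟨hxy (.inr 1) (.inl 0), hxy (.inr 1) (.inl 1), hxy (.inr 1) (.inr 0), hxy (.inr 1) (.inr 1)⟩⟩

/-- The underlying matrix of an element of `Sp(4, ℤ)`. -/
def mat (g : Sp4Z) : Matrix (Fin 2 ⊕ Fin 2) (Fin 2 ⊕ Fin 2) ℤ :=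
  ((g : GL (Fin 2 ⊕ Fin 2) ℤ) : Matrix (Fin 2 ⊕ Fin 2) (Fin 2 ⊕ Fin 2) ℤ)

theorem mat_mul (g h : Sp4Z) : mat (g * h) = mat g * mat h := rfl

theorem mat_one : mat 1 = 1 := rfl

theorem mat_injective : Function.Injective mat :=
  fun _ _ h => Subtype.ext (Units.ext h)

theorem transpose_mat_mul (g : Sp4Z) :
    (mat g)ᵀ * fromBlocks 0 1 (-1) 0 * mat g = fromBlocks 0 1 (-1) 0 := g.2

theorem mat_mul_transpose (g : Sp4Z) :
    mat g * fromBlocks 0 1 (-1) 0 * (mat g)ᵀ = fromBlocks 0 1 (-1) 0 := by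
  have hJ : Matrix.J (Fin 2) ℤ = -fromBlocks 0 1 (-1) 0 := by
    simp [Matrix.J, fromBlocks_neg]
  have h : mat g ∈ symplecticGroup (Fin 2) ℤ := by
    rw [SymplecticGroup.mem_iff', hJ, mul_neg, neg_mul, transpose_mat_mul]
  rwa [SymplecticGroup.mem_iff, hJ, mul_neg, neg_mul, neg_inj] at h

/-- The element of `Sp(4, ℤ)` with a given symplectic matrix. -/
def ofMat (A : Matrix (Fin 2 ⊕ Fin 2) (Fin 2 ⊕ Fin 2) ℤ)
    (h : Aᵀ * fromBlocks 0 1 (-1) 0 * A = fromBlocks 0 1 (-1) 0) : Sp4Z :=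
  have hinv : -fromBlocks 0 1 (-1) 0 * (Aᵀ * fromBlocks 0 1 (-1) 0) * A = 1 := by
    rw [Matrix.mul_assoc, h, neg_mul, fromBlocks_multiply]; simp [fromBlocks_neg]
  ⟨⟨A, -fromBlocks 0 1 (-1) 0 * (Aᵀ * fromBlocks 0 1 (-1) 0), mul_eq_one_comm.1 hinv, hinv⟩, h⟩

theorem mat_ofMat (A : Matrix (Fin 2 ⊕ Fin 2) (Fin 2 ⊕ Fin 2) ℤ)
    (h : Aᵀ * fromBlocks 0 1 (-1) 0 * A = fromBlocks 0 1 (-1) 0) : mat (ofMat A h) = A := rfl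

/-- `SL(2, ℤ)` embedded along the first long root. -/
def long₁ (a b c d : ℤ) (h : a * d - b * c = 1) : Sp4Z :=
  ofMat (ofEntries a 0 b 0 0 1 0 0 c 0 d 0 0 0 0 1) (by
    rw [fromBlocks_eq_ofEntries, ofEntries_transpose, ofEntries_mul, ofEntries_mul, ofEntries_inj]
    refine ⟨⟨?_, ?_, ?_, ?_⟩, ⟨?_, ?_, ?_, ?_⟩, ⟨?_, ?_, ?_, ?_⟩, ⟨?_, ?_, ?_, ?_⟩⟩ <;> grind)

/-- `SL(2, ℤ)` embedded along the second long root. -/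
def long₂ (a b c d : ℤ) (h : a * d - b * c = 1) : Sp4Z :=
  ofMat (ofEntries 1 0 0 0 0 a 0 b 0 0 1 0 0 c 0 d) (by
    rw [fromBlocks_eq_ofEntries, ofEntries_transpose, ofEntries_mul, ofEntries_mul, ofEntries_inj]
    refine ⟨⟨?_, ?_, ?_, ?_⟩, ⟨?_, ?_, ?_, ?_⟩, ⟨?_, ?_, ?_, ?_⟩, ⟨?_, ?_, ?_, ?_⟩⟩ <;> grind)

/-- `SL(2, ℤ)` embedded in the Siegel Levi subgroup. -/
def levi (a b c d : ℤ) (h : a * d - b * c = 1) : Sp4Z :=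
  ofMat (ofEntries a b 0 0 c d 0 0 0 0 d (-c) 0 0 (-b) a) (by
    rw [fromBlocks_eq_ofEntries, ofEntries_transpose, ofEntries_mul, ofEntries_mul, ofEntries_inj]
    refine ⟨⟨?_, ?_, ?_, ?_⟩, ⟨?_, ?_, ?_, ?_⟩, ⟨?_, ?_, ?_, ?_⟩, ⟨?_, ?_, ?_, ?_⟩⟩ <;> grind)

/-- The permutation matrix exchanging the two hyperbolic planes. -/
def swap : Sp4Z :=
  ofMat (ofEntries 0 1 0 0 1 0 0 0 0 0 0 1 0 0 1 0) (by
    rw [fromBlocks_eq_ofEntries, ofEntries_transpose, ofEntries_mul, ofEntries_mul, ofEntries_inj]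
    norm_num)

/-- The unipotent radical of the Siegel parabolic subgroup. -/
def upper (p q r : ℤ) : Sp4Z :=
  ofMat (ofEntries 1 0 p q 0 1 q r 0 0 1 0 0 0 0 1) (by
    rw [fromBlocks_eq_ofEntries, ofEntries_transpose, ofEntries_mul, ofEntries_mul, ofEntries_inj]
    norm_num)

/-- The unipotent radical of the opposite Siegel parabolic subgroup. -/
def lower (p q r : ℤ) : Sp4Z :=
  ofMat (ofEntries 1 0 0 0 0 1 0 0 p q 1 0 q r 0 1) (by
    rw [fromBlocks_eq_ofEntries, ofEntries_transpose, ofEntries_mul, ofEntries_mul, ofEntries_inj]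
    norm_num)

/-- The principal congruence subgroup of level `n`. -/
def principalCongruence (n : ℕ) : Subgroup Sp4Z :=
  ((Matrix.GeneralLinearGroup.map (Int.castRingHom (ZMod n))).comp Sp4Z.subtype).ker

instance (n : ℕ) : (principalCongruence n).Normal := MonoidHom.normal_ker _

theorem mem_principalCongruence_iff {n : ℕ} {g : Sp4Z} :
    g ∈ principalCongruence n ↔
      ∀ i j, (n : ℤ) ∣ mat g i j - (1 : Matrix (Fin 2 ⊕ Fin 2) (Fin 2 ⊕ Fin 2) ℤ) i j := by
  rw [principalCongruence, MonoidHom.mem_ker, Units.ext_iff, ← Matrix.ext_iff]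
  refine forall₂_congr fun i j => ?_
  rw [← ZMod.intCast_eq_intCast_iff_dvd_sub, eq_comm]
  simp [mat, Matrix.one_apply]

theorem ofMat_mem_principalCongruence {n : ℕ} {a b c d e f g h i j k l m t o p : ℤ}
    (hA : (ofEntries a b c d e f g h i j k l m t o p)ᵀ * fromBlocks 0 1 (-1) 0 *
      ofEntries a b c d e f g h i j k l m t o p = fromBlocks 0 1 (-1) 0)
    (h1 : (n : ℤ) ∣ a - 1 ∧ (n : ℤ) ∣ b ∧ (n : ℤ) ∣ c ∧ (n : ℤ) ∣ d)
    (h2 : (n : ℤ) ∣ e ∧ (n : ℤ) ∣ f - 1 ∧ (n : ℤ) ∣ g ∧ (n : ℤ) ∣ h)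
    (h3 : (n : ℤ) ∣ i ∧ (n : ℤ) ∣ j ∧ (n : ℤ) ∣ k - 1 ∧ (n : ℤ) ∣ l)
    (h4 : (n : ℤ) ∣ m ∧ (n : ℤ) ∣ t ∧ (n : ℤ) ∣ o ∧ (n : ℤ) ∣ p - 1) :
    ofMat (ofEntries a b c d e f g h i j k l m t o p) hA ∈ principalCongruence n := by
  rw [mem_principalCongruence_iff, one_eq_ofEntries]
  rintro (x | x) (y | y) <;> fin_cases x <;> fin_cases y <;>
    simp [mat_ofMat, ofEntries, h1, h2, h3, h4]

theorem mat_mem_principalCongruence {n : ℕ} {g : Sp4Z} (hg : g ∈ principalCongruence n) :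
    ∃ a b c d e f g' h i j k l m t o p : ℤ,
      mat g = ofEntries (1 + n * a) (n * b) (n * c) (n * d) (n * e) (1 + n * f) (n * g') (n * h)
        (n * i) (n * j) (1 + n * k) (n * l) (n * m) (n * t) (n * o) (1 + n * p) := by
  rw [mem_principalCongruence_iff] at hg
  choose A hA using hg
  have h : mat g = 1 + (n : ℤ) • Matrix.of A := by
    ext i j
    simp [← hA]
  refine ⟨A (.inl 0) (.inl 0), A (.inl 0) (.inl 1), A (.inl 0) (.inr 0), A (.inl 0) (.inr 1),
    A (.inl 1) (.inl 0), A (.inl 1) (.inl 1), A (.inl 1) (.inr 0), A (.inl 1) (.inr 1),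
    A (.inr 0) (.inl 0), A (.inr 0) (.inl 1), A (.inr 0) (.inr 0), A (.inr 0) (.inr 1),
    A (.inr 1) (.inl 0), A (.inr 1) (.inl 1), A (.inr 1) (.inr 0), A (.inr 1) (.inr 1), ?_⟩
  rw [h, eq_ofEntries (1 + _), ofEntries_inj]
  simp

variable {N : Subgroup Sp4Z} {n : ℕ}

/-- The subgroup `N` contains all elementary symplectic matrices of level `n`. -/
structure ContainsElementary (N : Subgroup Sp4Z) (n : ℕ) : Prop where
  upper : ∀ {p q r : ℤ}, (n : ℤ) ∣ p → (n : ℤ) ∣ q → (n : ℤ) ∣ r → upper p q r ∈ N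
  lower : ∀ {p q r : ℤ}, (n : ℤ) ∣ p → (n : ℤ) ∣ q → (n : ℤ) ∣ r → lower p q r ∈ N
  levi_upper : ∀ {t : ℤ}, (n : ℤ) ∣ t → levi 1 t 0 1 (by ring) ∈ N
  levi_lower : ∀ {t : ℤ}, (n : ℤ) ∣ t → levi 1 0 t 1 (by ring) ∈ N

theorem upper_pow (p q r : ℤ) (k : ℕ) : upper p q r ^ k = upper (k * p) (k * q) (k * r) := by
  induction k with
  | zero =>
    apply mat_injective
    simp [mat_one, upper, mat_ofMat, one_eq_ofEntries]
  | succ k ih =>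
    apply mat_injective
    rw [pow_succ, ih, mat_mul]
    simp only [upper, mat_ofMat, ofEntries_mul, ofEntries_inj]
    refine ⟨⟨?_, ?_, ?_, ?_⟩, ⟨?_, ?_, ?_, ?_⟩, ⟨?_, ?_, ?_, ?_⟩, ⟨?_, ?_, ?_, ?_⟩⟩ <;> grind

theorem lower_pow (p q r : ℤ) (k : ℕ) : lower p q r ^ k = lower (k * p) (k * q) (k * r) := by
  induction k with
  | zero =>
    apply mat_injective
    simp [mat_one, lower, mat_ofMat, one_eq_ofEntries]
  | succ k ih =>
    apply mat_injective
    rw [pow_succ, ih, mat_mul]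
    simp only [lower, mat_ofMat, ofEntries_mul, ofEntries_inj]
    refine ⟨⟨?_, ?_, ?_, ?_⟩, ⟨?_, ?_, ?_, ?_⟩, ⟨?_, ?_, ?_, ?_⟩, ⟨?_, ?_, ?_, ?_⟩⟩ <;> grind

theorem levi_upper_pow (t : ℤ) (k : ℕ) :
    levi 1 t 0 1 (by ring) ^ k = levi 1 (k * t) 0 1 (by ring) := by
  induction k with
  | zero =>
    apply mat_injective
    simp [mat_one, levi, mat_ofMat, one_eq_ofEntries]
  | succ k ih =>
    apply mat_injective
    rw [pow_succ, ih, mat_mul]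
    simp only [levi, mat_ofMat, ofEntries_mul, ofEntries_inj]
    refine ⟨⟨?_, ?_, ?_, ?_⟩, ⟨?_, ?_, ?_, ?_⟩, ⟨?_, ?_, ?_, ?_⟩, ⟨?_, ?_, ?_, ?_⟩⟩ <;> grind

theorem levi_lower_pow (t : ℤ) (k : ℕ) :
    levi 1 0 t 1 (by ring) ^ k = levi 1 0 (k * t) 1 (by ring) := by
  induction k with
  | zero =>
    apply mat_injective
    simp [mat_one, levi, mat_ofMat, one_eq_ofEntries]
  | succ k ih =>
    apply mat_injective
    rw [pow_succ, ih, mat_mul]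
    simp only [levi, mat_ofMat, ofEntries_mul, ofEntries_inj]
    refine ⟨⟨?_, ?_, ?_, ?_⟩, ⟨?_, ?_, ?_, ?_⟩, ⟨?_, ?_, ?_, ?_⟩, ⟨?_, ?_, ?_, ?_⟩⟩ <;> grind

theorem containsElementary_of_pow_mem {e : ℕ} (hN : ∀ g : Sp4Z, g ^ e ∈ N) (he : e ∣ n) :
    ContainsElementary N n := by
  have hdvd {x : ℤ} (hx : (n : ℤ) ∣ x) : ∃ y, x = e * y := (Int.natCast_dvd_natCast.2 he).trans hx
  constructor
  · intro p q r hp hq hr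
    obtain ⟨p, rfl⟩ := hdvd hp
    obtain ⟨q, rfl⟩ := hdvd hq
    obtain ⟨r, rfl⟩ := hdvd hr
    exact upper_pow p q r e ▸ hN _
  · intro p q r hp hq hr
    obtain ⟨p, rfl⟩ := hdvd hp
    obtain ⟨q, rfl⟩ := hdvd hq
    obtain ⟨r, rfl⟩ := hdvd hr
    exact lower_pow p q r e ▸ hN _
  · intro t ht
    obtain ⟨t, rfl⟩ := hdvd ht
    exact levi_upper_pow t e ▸ hN _
  · intro t ht
    obtain ⟨t, rfl⟩ := hdvd ht
    exact levi_lower_pow t e ▸ hN _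

/-- An element of the principal congruence subgroup fixing the first basis row vector is a product
of elementary matrices and an element of the second long root `SL(2, ℤ)`. -/
theorem exists_eq_mul_long₂ (hN : ContainsElementary N n) {g : Sp4Z}
    (hg : g ∈ principalCongruence n) (h0 : mat g (.inl 0) (.inl 0) = 1)
    (h1 : mat g (.inl 0) (.inl 1) = 0) (h2 : mat g (.inl 0) (.inr 0) = 0)
    (h3 : mat g (.inl 0) (.inr 1) = 0) :
    ∃ (p q r s : ℤ) (h : p * s - q * r = 1), (n : ℤ) ∣ p - 1 ∧ (n : ℤ) ∣ q ∧ (n : ℤ) ∣ r ∧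
      mat g (.inl 1) (.inl 1) = p ∧ ∃ k ∈ N, g = k * long₂ p q r s h := by
  obtain ⟨a, b, c, d, x, p, x', q, t, u, v, w, y, r, z, s, hM⟩ := mat_mem_principalCongruence hg
  have hJ := mat_mul_transpose g
  rw [hM] at h0 h1 h2 h3 hJ ⊢
  simp only [ofEntries, fromBlocks_apply₁₁, fromBlocks_apply₁₂, Matrix.of_apply, Matrix.cons_val',
    Matrix.cons_val_zero, Matrix.cons_val_one] at h0 h1 h2 h3
  rw [h0, h1, h2, h3] at hJ hM
  rw [fromBlocks_eq_ofEntries, ofEntries_transpose, ofEntries_mul, ofEntries_mul,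
    ofEntries_inj] at hJ
  obtain ⟨⟨-, e12, e13, e14⟩, ⟨-, -, e23, e24⟩, ⟨-, -, -, e34⟩, -⟩ := hJ
  have hdet : (1 + n * p) * (1 + n * s) - n * q * (n * r) = 1 := by
    linear_combination e24 + n * y * e12 - n * x * e14
  refine ⟨1 + n * p, n * q, n * r, 1 + n * s, hdet, by simp, by simp, by simp, rfl,
    lower (n * t - n * x * (n * y)) (n * y) 0 * levi 1 0 (n * x) 1 (by ring),
    mul_mem (hN.lower ?_ (by simp) (by simp)) (hN.levi_lower (by simp)), ?_⟩
  · exact dvd_sub (dvd_mul_right _ _) (by rw [mul_assoc]; exact dvd_mul_right _ _)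
  · apply mat_injective
    rw [mat_mul, mat_mul, hM]
    simp only [lower, levi, long₂, mat_ofMat, ofEntries_mul, ofEntries_inj]
    have e12' : n * x' = 0 := by linear_combination e12
    have e13' : 1 + n * v = 1 := by linear_combination e13
    have e14' : n * z = 0 := by linear_combination e14
    refine ⟨⟨?_, ?_, ?_, ?_⟩, ⟨?_, ?_, ?_, ?_⟩, ⟨?_, ?_, ?_, ?_⟩, ⟨?_, ?_, ?_, ?_⟩⟩ <;> grind

theorem mul_mul_mem {G : Type*} [Group G] {K : Subgroup G} [hK : K.Normal] {x y z : G}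
    (hxz : x * z ∈ K) (hy : y ∈ K) : x * y * z ∈ K := by
  have := mul_mem (hK.conj_mem y hy x) hxz
  rwa [← mul_assoc, inv_mul_cancel_right] at this

theorem containsElementary_principalCongruence (n : ℕ) :
    ContainsElementary (principalCongruence n) n := by
  constructor <;> intros <;> apply ofMat_mem_principalCongruence <;> simp_all

theorem long₁_mem_principalCongruence {a b c d : ℤ} (h : a * d - b * c = 1)
    (ha : (n : ℤ) ∣ a - 1) (hb : (n : ℤ) ∣ b) (hc : (n : ℤ) ∣ c) (hd : (n : ℤ) ∣ d - 1) :
    long₁ a b c d h ∈ principalCongruence n := by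
  apply ofMat_mem_principalCongruence <;> simp_all

theorem long₂_mem_principalCongruence {a b c d : ℤ} (h : a * d - b * c = 1)
    (ha : (n : ℤ) ∣ a - 1) (hb : (n : ℤ) ∣ b) (hc : (n : ℤ) ∣ c) (hd : (n : ℤ) ∣ d - 1) :
    long₂ a b c d h ∈ principalCongruence n := by
  apply ofMat_mem_principalCongruence <;> simp_all

theorem levi_mem_principalCongruence {a b c d : ℤ} (h : a * d - b * c = 1)
    (ha : (n : ℤ) ∣ a - 1) (hb : (n : ℤ) ∣ b) (hc : (n : ℤ) ∣ c) (hd : (n : ℤ) ∣ d - 1) :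
    levi a b c d h ∈ principalCongruence n := by
  apply ofMat_mem_principalCongruence <;> simp_all

theorem long₂_eq {a b c d : ℤ} (h : a * d - b * c = 1) :
    long₂ a b c d h = swap * long₁ a b c d h * swap := by
  apply mat_injective
  simp only [mat_mul, swap, long₁, long₂, mat_ofMat, ofEntries_mul, ofEntries_inj]
  norm_num

theorem swap_mul_swap : swap * swap = 1 := by
  apply mat_injective
  simp only [mat_mul, swap, mat_ofMat, ofEntries_mul, one_eq_ofEntries, ofEntries_inj, mat_one]
  norm_num

theorem mul_long₁ {a b c d : ℤ} (h : a * d - b * c = 1) :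
    long₁ a b c d h * long₁ d (-b) (-c) a (by linarith) = 1 := by
  apply mat_injective
  simp only [mat_mul, long₁, mat_ofMat, ofEntries_mul, one_eq_ofEntries, ofEntries_inj, mat_one]
  refine ⟨⟨?_, ?_, ?_, ?_⟩, ⟨?_, ?_, ?_, ?_⟩, ⟨?_, ?_, ?_, ?_⟩, ⟨?_, ?_, ?_, ?_⟩⟩ <;> grind

theorem mat_levi_mul_long₂_mul_levi {a z r c d : ℤ} (h1 : a * d - z * (r * z * c) = 1)
    (h2 : a * d - r * (z ^ 2 * c) = 1) :
    mat (levi a z (r * z * c) d h1 * long₂ a r (z ^ 2 * c) d h2 * levi 1 (-z) 0 1 (by ring)) =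
      ofEntries a 0 (r * z ^ 2) (r * z) (r * z * c) 1 (z * d * r) (d * r)
        0 (-(r * z * c * (z ^ 2 * c))) (d - r * z * c * d * z) (-(r * z * c * d))
        0 (a * (z ^ 2 * c)) (a * d * z - z) (a * d) := by
  simp only [mat_mul, levi, long₂, mat_ofMat, ofEntries_mul, ofEntries_inj]
  refine ⟨⟨?_, ?_, ?_, ?_⟩, ⟨?_, ?_, ?_, ?_⟩, ⟨?_, ?_, ?_, ?_⟩, ⟨?_, ?_, ?_, ?_⟩⟩
  · ring
  · ring
  · ring
  · ring
  · ring
  · linear_combination h1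
  all_goals ring

theorem exists_mat_mul_eq {Q : Sp4Z} {a z r u v w c d i j k l m t o p x y : ℤ}
    (hQ : mat Q = ofEntries a 0 (r * z ^ 2) (r * z) w 1 x y i j k l m t o p)
    (h0 : a * u + z * v = 1) (h : a * d - r * z ^ 2 * c = 1)
    (h3 : d * a - -(r * z ^ 2) * -c = 1) :
    ∃ x₁ x₂ x₃ x₄ x₅ x₆ x₇ x₈ x₉ x₁₀ x₁₁,
      mat (Q * levi 1 0 v 1 (by ring) * upper 0 (-(z * r * u)) 0 *
        long₁ d (-(r * z ^ 2)) (-c) a h3) =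
      ofEntries 1 0 0 0 x₁ 1 x₂ x₃ x₄ x₅ x₆ x₇ x₈ x₉ x₁₀ x₁₁ := by
  rw [mat_mul, mat_mul, mat_mul, hQ]
  simp only [levi, upper, long₁, mat_ofMat, ofEntries_mul]
  refine ⟨_, _, _, _, _, _, _, _, _, _, _, ofEntries_inj.2
    ⟨⟨?_, ?_, ?_, ?_⟩, ⟨rfl, ?_, rfl, rfl⟩, ⟨rfl, rfl, rfl, rfl⟩, ⟨rfl, rfl, rfl, rfl⟩⟩⟩
  · linear_combination h
  · ring
  · ring
  · linear_combination (-r * z) * h0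
  · ring

theorem long₂_one_mem (hN : ContainsElementary N n) {q r s : ℤ}
    (h : 1 * s - q * r = 1) (hq : (n : ℤ) ∣ q) (hr : (n : ℤ) ∣ r) : long₂ 1 q r s h ∈ N := by
  have : long₂ 1 q r s h = lower 0 0 r * upper 0 0 q := by
    apply mat_injective
    simp only [mat_mul, long₂, upper, lower, mat_ofMat, ofEntries_mul, ofEntries_inj]
    refine ⟨⟨?_, ?_, ?_, ?_⟩, ⟨?_, ?_, ?_, ?_⟩, ⟨?_, ?_, ?_, ?_⟩, ⟨?_, ?_, ?_, ?_⟩⟩ <;> grind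
  rw [this]
  exact mul_mem (hN.lower (dvd_zero _) (dvd_zero _) hr) (hN.upper (dvd_zero _) (dvd_zero _) hq)

section Quotient

variable [N.Normal]

theorem mk_long₁_eq (hN : ContainsElementary N n) {a b c d c' d' : ℤ} (h : a * d - b * c = 1)
    (h' : a * d' - b * c' = 1) (hc : (n : ℤ) ∣ c) (hc' : (n : ℤ) ∣ c') :
    (long₁ a b c' d' h' : Sp4Z ⧸ N) = long₁ a b c d h := by
  have hk : lower (c' * d - d' * c) 0 0 ∈ N :=
    hN.lower (dvd_sub (hc'.mul_right _) (hc.mul_left _)) (dvd_zero _) (dvd_zero _)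
  have : long₁ a b c' d' h' = lower (c' * d - d' * c) 0 0 * long₁ a b c d h := by
    apply mat_injective
    simp only [mat_mul, lower, long₁, mat_ofMat, ofEntries_mul, ofEntries_inj]
    refine ⟨⟨?_, ?_, ?_, ?_⟩, ⟨?_, ?_, ?_, ?_⟩, ⟨?_, ?_, ?_, ?_⟩, ⟨?_, ?_, ?_, ?_⟩⟩ <;> grind
  rw [this, QuotientGroup.mk_mul, (QuotientGroup.eq_one_iff _).2 hk, one_mul]

theorem mk_levi_eq (hN : ContainsElementary N n) {a b c d c' d' : ℤ} (h : a * d - b * c = 1)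
    (h' : a * d' - b * c' = 1) (hc : (n : ℤ) ∣ c) (hc' : (n : ℤ) ∣ c') :
    (levi a b c' d' h' : Sp4Z ⧸ N) = levi a b c d h := by
  have hk : levi 1 0 (c' * d - d' * c) 1 (by ring) ∈ N :=
    hN.levi_lower (dvd_sub (hc'.mul_right _) (hc.mul_left _))
  have : levi a b c' d' h' = levi 1 0 (c' * d - d' * c) 1 (by ring) * levi a b c d h := by
    apply mat_injective
    simp only [mat_mul, levi, mat_ofMat, ofEntries_mul, ofEntries_inj]
    refine ⟨⟨?_, ?_, ?_, ?_⟩, ⟨?_, ?_, ?_, ?_⟩, ⟨?_, ?_, ?_, ?_⟩, ⟨?_, ?_, ?_, ?_⟩⟩ <;> grind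
  rw [this, QuotientGroup.mk_mul, (QuotientGroup.eq_one_iff _).2 hk, one_mul]

/-- Multiplying the upper right entry by a square amounts to multiplying the class modulo `N`
by fixed elements on both sides. -/
theorem exists_mk_long₁_mul_sq (hN : ContainsElementary N n) {a z : ℤ} (ha : (n : ℤ) ∣ a - 1)
    (hz : IsCoprime a z) :
    ∃ P P' : Sp4Z ⧸ N, ∀ {r c d c' d' : ℤ} (h : a * d - r * z ^ 2 * c = 1)
      (h' : a * d' - r * c' = 1), (n : ℤ) ∣ r → (n : ℤ) ∣ c → (n : ℤ) ∣ c' →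
      (long₁ a (r * z ^ 2) c d h : Sp4Z ⧸ N) = P * long₁ a r c' d' h' * P' := by
  have hn : IsCoprime a n := by
    obtain ⟨x, hx⟩ := ha
    exact ⟨1, -x, by linear_combination hx⟩
  obtain ⟨u, v, huv⟩ := hz.mul_right hn
  have h0 : a * u - z * (-(v * n)) = 1 := by linear_combination huv
  refine ⟨((levi a z (-(v * n)) u h0 * swap : Sp4Z) : Sp4Z ⧸ N),
    ((swap * levi 1 (-z) 0 1 (by ring) : Sp4Z) : Sp4Z ⧸ N), fun {r c d c' d'} h h' hr hc hc' => ?_⟩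
  have hd : (n : ℤ) ∣ d - 1 := by
    rw [show d - 1 = r * (z ^ 2 * c) - (a - 1) * d by linear_combination h]
    exact dvd_sub (hr.mul_right _) (ha.mul_right _)
  have h1 : a * d - z * (r * z * c) = 1 := by linear_combination h
  have h2 : a * d - r * (z ^ 2 * c) = 1 := by linear_combination h
  have h3 : d * a - -(r * z ^ 2) * -c = 1 := by linear_combination h
  set Q := levi a z (r * z * c) d h1 * long₂ a r (z ^ 2 * c) d h2 *
    levi 1 (-z) 0 1 (by ring) with hQ
  have hE := containsElementary_principalCongruence n
  have hQn : Q ∈ principalCongruence n := by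
    refine mul_mul_mem ?_ (long₂_mem_principalCongruence h2 ha hr (hc.mul_left _) hd)
    have h4 : a * (d - r * z * c * z) - (z - a * z) * (r * z * c) = 1 := by linear_combination h
    have : levi a z (r * z * c) d h1 * levi 1 (-z) 0 1 (by ring) =
        levi a (z - a * z) (r * z * c) (d - r * z * c * z) h4 := by
      apply mat_injective
      simp only [mat_mul, levi, mat_ofMat, ofEntries_mul, ofEntries_inj]
      refine ⟨⟨?_, ?_, ?_, ?_⟩, ⟨?_, ?_, ?_, ?_⟩, ⟨?_, ?_, ?_, ?_⟩, ⟨?_, ?_, ?_, ?_⟩⟩ <;> ring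
    rw [this]
    refine levi_mem_principalCongruence _ ha ?_ (hc.mul_left _) ?_
    · rw [show z - a * z = -((a - 1) * z) by ring]
      exact (ha.mul_right _).neg_right
    · rw [show d - r * z * c * z - 1 = (d - 1) - r * (z * c * z) by ring]
      exact dvd_sub hd (hr.mul_right _)
  have hβ : (n : ℤ) ∣ v * n := dvd_mul_left _ _
  have hα : (n : ℤ) ∣ -(z * r * u) := ((hr.mul_left _).mul_right _).neg_right
  set E := levi 1 0 (v * n) 1 (by ring) * upper 0 (-(z * r * u)) 0 with hEdef
  have hEN : E ∈ N :=
    mul_mem (hN.levi_lower hβ) (hN.upper (dvd_zero _) hα (dvd_zero _))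
  have hTn : Q * E * long₁ d (-(r * z ^ 2)) (-c) a h3 ∈ principalCongruence n :=
    mul_mem (mul_mem hQn
      (mul_mem (hE.levi_lower hβ) (hE.upper (dvd_zero _) hα (dvd_zero _))))
      (long₁_mem_principalCongruence h3 hd (hr.mul_right _).neg_right hc.neg_right ha)
  have hT : Q * E * long₁ d (-(r * z ^ 2)) (-c) a h3 ∈ N := by
    have hQmat : mat Q = ofEntries a 0 (r * z ^ 2) (r * z) (r * z * c) 1 (z * d * r) (d * r)
        0 (-(r * z * c * (z ^ 2 * c))) (d - r * z * c * d * z) (-(r * z * c * d))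
        0 (a * (z ^ 2 * c)) (a * d * z - z) (a * d) :=
      mat_levi_mul_long₂_mul_levi h1 h2
    obtain ⟨x₁, x₂, x₃, x₄, x₅, x₆, x₇, x₈, x₉, x₁₀, x₁₁, hmat⟩ :=
      exists_mat_mul_eq (u := u) (v := v * n) hQmat (by linear_combination h0) h h3
    rw [mul_assoc Q, ← hEdef] at hmat
    obtain ⟨p, q, y, s, hp, -, hq, hy, hp1, k, hk, hT⟩ := exists_eq_mul_long₂ hN hTn
      (by rw [hmat]; rfl) (by rw [hmat]; rfl) (by rw [hmat]; rfl) (by rw [hmat]; rfl)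
    have hp2 : p = 1 := by rw [← hp1, hmat]; rfl
    subst hp2
    rw [hT]
    exact mul_mem hk (long₂_one_mem hN hp hq hy)
  have hmk := (QuotientGroup.eq_one_iff _).2 hT
  have hinv := congrArg (QuotientGroup.mk (s := N)) (mul_long₁ h)
  rw [QuotientGroup.mk_mul, QuotientGroup.mk_mul, (QuotientGroup.eq_one_iff _).2 hEN,
    mul_one] at hmk
  rw [QuotientGroup.mk_mul, QuotientGroup.mk_one] at hinv
  rw [mul_right_cancel (hinv.trans hmk.symm), hQ, long₂_eq]
  simp only [QuotientGroup.mk_mul]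
  rw [mk_levi_eq hN h0 h1 hβ.neg_right (hc.mul_left _),
    mk_long₁_eq hN h' h2 hc' (hc.mul_left _)]
  simp only [mul_assoc]

end Quotient

/-- The subgroup `N` contains all elements of the first long root `SL(2, ℤ)` with first row
`(a, b)` and lower left entry divisible by `n`. -/
def ContainsRow (N : Subgroup Sp4Z) (n : ℕ) (a b : ℤ) : Prop :=
  ∀ (c d : ℤ) (h : a * d - b * c = 1), (n : ℤ) ∣ c → long₁ a b c d h ∈ N

theorem containsRow_one (hN : ContainsElementary N n) {b : ℤ} (hb : (n : ℤ) ∣ b) :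
    ContainsRow N n 1 b := by
  intro c d h hc
  have : long₁ 1 b c d h = lower c 0 0 * upper b 0 0 := by
    apply mat_injective
    simp only [mat_mul, long₁, upper, lower, mat_ofMat, ofEntries_mul, ofEntries_inj]
    refine ⟨⟨?_, ?_, ?_, ?_⟩, ⟨?_, ?_, ?_, ?_⟩, ⟨?_, ?_, ?_, ?_⟩, ⟨?_, ?_, ?_, ?_⟩⟩ <;> grind
  rw [this]
  exact mul_mem (hN.lower hc (dvd_zero _) (dvd_zero _)) (hN.upper hb (dvd_zero _) (dvd_zero _))

theorem ContainsRow.of_add_mul_right (hN : ContainsElementary N n) {a b t : ℤ} (ht : (n : ℤ) ∣ t)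
    (H : ContainsRow N n a (b + a * t)) : ContainsRow N n a b := by
  intro c d h hc
  have h' : a * (d + c * t) - (b + a * t) * c = 1 := by linear_combination h
  have : long₁ a b c d h = long₁ a (b + a * t) c (d + c * t) h' * Sp4Z.upper (-t) 0 0 := by
    apply mat_injective
    simp only [mat_mul, long₁, Sp4Z.upper, mat_ofMat, ofEntries_mul, ofEntries_inj]
    refine ⟨⟨?_, ?_, ?_, ?_⟩, ⟨?_, ?_, ?_, ?_⟩, ⟨?_, ?_, ?_, ?_⟩, ⟨?_, ?_, ?_, ?_⟩⟩ <;> ring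
  rw [this]
  exact mul_mem (H _ _ _ hc) (hN.upper ht.neg_right (dvd_zero _) (dvd_zero _))

theorem ContainsRow.of_add_mul_left [hN : N.Normal] {a b : ℤ} (ha : (n : ℤ) ∣ a - 1)
    (hb : (n : ℤ) ∣ b) (t : ℤ) (H : ContainsRow N n (a + t * b) b) : ContainsRow N n a b := by
  intro c d h hc
  have h' : (a + t * b) * (d - t * b) - b * (c + t * (d - a - t * b)) = 1 := by
    linear_combination h
  have hd : (n : ℤ) ∣ d - a - t * b := by
    rw [show d - a - t * b = b * (c - t) - (a - 1) * (d + 1) by linear_combination h]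
    exact dvd_sub (hb.mul_right _) (ha.mul_right _)
  have hmem := hN.conj_mem _ (H _ _ h' (hc.add (hd.mul_left _))) (Sp4Z.lower t 0 0)
  have : long₁ a b c d h * Sp4Z.lower t 0 0 = Sp4Z.lower t 0 0 * long₁ _ _ _ _ h' := by
    apply mat_injective
    simp only [mat_mul, long₁, Sp4Z.lower, mat_ofMat, ofEntries_mul, ofEntries_inj]
    refine ⟨⟨?_, ?_, ?_, ?_⟩, ⟨?_, ?_, ?_, ?_⟩, ⟨?_, ?_, ?_, ?_⟩, ⟨?_, ?_, ?_, ?_⟩⟩ <;>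
      first | trivial | ring
  rwa [← this, mul_inv_cancel_right] at hmem

theorem ContainsRow.mul_pow [N.Normal] (hN : ContainsElementary N n) {e : ℕ}
    (he : ∀ x : Sp4Z ⧸ N, x ^ e = 1) {a r z : ℤ} (ha : (n : ℤ) ∣ a - 1) (hr : (n : ℤ) ∣ r)
    (hz : IsCoprime a z) (H : ContainsRow N n a r) : ContainsRow N n a (r * z ^ (2 * e)) := by
  obtain ⟨P, P', hP⟩ := exists_mk_long₁_mul_sq hN ha hz
  have key (k : ℕ) : ∀ (b c d : ℤ) (h : a * d - b * c = 1), b = r * z ^ (2 * k) → (n : ℤ) ∣ c →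
      (long₁ a b c d h : Sp4Z ⧸ N) = P ^ k * P' ^ k := by
    induction k with
    | zero =>
      intro b c d h hb hc
      obtain rfl : b = r := by simpa using hb
      simpa using (QuotientGroup.eq_one_iff _).2 (H c d h hc)
    | succ k ih =>
      intro b c d h hb hc
      obtain rfl : b = r * z ^ (2 * k) * z ^ 2 := by rw [hb]; ring
      have h' : a * d - r * z ^ (2 * k) * (z ^ 2 * c) = 1 := by linear_combination h
      rw [hP h h' (hr.mul_right _) hc (hc.mul_left _), ih _ _ _ h' rfl (hc.mul_left _), pow_succ',
        pow_succ]
      simp only [mul_assoc]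
  intro c d h hc
  rw [← QuotientGroup.eq_one_iff, key e _ _ _ h rfl hc, he, he, one_mul]

theorem containsRow_of_pos [N.Normal] (hN : ContainsElementary N n) {e : ℕ}
    (he : ∀ x : Sp4Z ⧸ N, x ^ e = 1) (hn : n ≠ 0) (hen : e ∣ n) (h8 : 8 ∣ n) {a b : ℤ}
    (ha0 : 0 < a) (ha : (n : ℤ) ∣ a - 1) (hb : (n : ℤ) ∣ b) (hab : IsCoprime a b) :
    ContainsRow N n a b := by
  obtain ⟨t, k, p, hp, hpk, hsq⟩ := exists_prime_isSquare hn h8 ha0 ha hb hab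
  have he0 : e ≠ 0 := by rintro rfl; exact hn (zero_dvd_iff.1 hen)
  have hb' : (n : ℤ) ∣ b + n * t * a := hb.add (by rw [mul_assoc]; exact dvd_mul_right _ _)
  have hab' : IsCoprime (-(p : ℤ)) (b + n * t * a) :=
    hpk ▸ (hab.add_mul_right_right _).add_mul_right_left k
  have hpn : (n : ℤ) ∣ p + 1 := by
    rw [show (p : ℤ) + 1 = -((a - 1) + k * (b + n * t * a)) by linear_combination -hpk]
    exact (ha.add (hb'.mul_left _)).neg_right
  have hpn' : (n : ℤ) ∣ -p - 1 := by
    rw [show -(p : ℤ) - 1 = -(p + 1) by ring]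
    exact hpn.neg_right
  refine ContainsRow.of_add_mul_right hN (t := n * t) (dvd_mul_right _ _) ?_
  rw [mul_comm a]
  refine ContainsRow.of_add_mul_left ha hb' k ?_
  rw [← hpk]
  generalize b + n * t * a = B at *
  have := Fact.mk hp
  have hpprime : Prime (p : ℤ) := Nat.prime_iff_prime_int.1 hp
  have hB0 : (B : ZMod p) ≠ 0 := by
    rw [Ne, ZMod.intCast_zmod_eq_zero_iff_dvd]
    intro h
    exact hpprime.not_isUnit (((IsCoprime.neg_left_iff _ _).1 hab').isUnit_of_dvd' dvd_rfl h)
  obtain ⟨z, hz⟩ := exists_pow_eq_of_isSquare hen h8 hp (by exact_mod_cast hpn) hB0 hsq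
  have hpz : IsCoprime (-(p : ℤ)) z := by
    rw [IsCoprime.neg_left_iff, hpprime.coprime_iff_not_dvd, ← ZMod.intCast_zmod_eq_zero_iff_dvd]
    intro h
    rw [hz, h, zero_pow (by omega)] at hB0
    exact hB0 rfl
  have hpn1 : (n : ℤ) ∣ 1 + p := add_comm (p : ℤ) 1 ▸ hpn
  have hbase : ContainsRow N n (-p) (1 + p) := by
    refine ContainsRow.of_add_mul_left hpn' hpn1 1 ?_
    rw [show -(p : ℤ) + 1 * (1 + p) = 1 by ring]
    exact containsRow_one hN hpn1
  have hpow := hbase.mul_pow hN he hpn' hpn1 hpz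
  have hdp : (p : ℤ) ∣ (1 + p) * z ^ (2 * e) - B := by
    rw [← ZMod.intCast_eq_intCast_iff_dvd_sub]
    push_cast
    simp [hz]
  have hdn : (n : ℤ) ∣ (1 + p) * z ^ (2 * e) - B := dvd_sub (hpn1.mul_right _) hb'
  have hcop : IsCoprime (p : ℤ) n := by
    obtain ⟨x, hx⟩ := hpn
    exact ⟨-1, x, by linear_combination -hx⟩
  obtain ⟨s, hs⟩ := hcop.mul_dvd hdp hdn
  refine ContainsRow.of_add_mul_right hN (t := -(n * s)) (dvd_mul_right _ _).neg_right ?_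
  rwa [show B + -(p : ℤ) * -(n * s) = (1 + p) * z ^ (2 * e) by linear_combination -hs]

theorem containsRow_of_isCoprime [N.Normal] (hN : ContainsElementary N n) {e : ℕ}
    (he : ∀ x : Sp4Z ⧸ N, x ^ e = 1) (hn : n ≠ 0) (hen : e ∣ n) (h8 : 8 ∣ n) {a b : ℤ}
    (ha : (n : ℤ) ∣ a - 1) (hb : (n : ℤ) ∣ b) (hab : IsCoprime a b) :
    ContainsRow N n a b := by
  have ha0 : a ≠ 0 := by
    rintro rfl
    have : (8 : ℤ) ∣ 0 - 1 := dvd_trans (by exact_mod_cast h8) ha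
    omega
  set B := b + a * (n * (a * (|b| + 1))) with hB
  have hBn : (n : ℤ) ∣ B := hb.add ((dvd_mul_right _ _).mul_left _)
  have hB0 : 0 < B := by
    have h1 : 0 < (n : ℤ) * (a * a) := mul_pos (by positivity) (mul_self_pos.2 ha0)
    have h2 : |b| + 1 ≤ n * (a * a) * (|b| + 1) := le_mul_of_one_le_left (by positivity) h1
    linarith [neg_abs_le b, show B = b + n * (a * a) * (|b| + 1) by rw [hB]; ring]
  have hA0 : 0 < a + (|a| + 1) * B := by
    have h2 : |a| + 1 ≤ (|a| + 1) * B := le_mul_of_one_le_right (by positivity) hB0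
    linarith [neg_abs_le a]
  refine ContainsRow.of_add_mul_right hN (t := n * (a * (|b| + 1))) (dvd_mul_right _ _) ?_
  refine ContainsRow.of_add_mul_left ha hBn (|a| + 1) ?_
  refine containsRow_of_pos hN he hn hen h8 hA0 ?_ hBn
    ((hab.add_mul_left_right _).add_mul_right_left _)
  rw [add_sub_right_comm]
  exact ha.add (hBn.mul_left _)

/-- The first row of the matrix of an element of `Sp(4, ℤ)`, given by its entries. -/
def row (a b c d : ℤ) : Fin 2 ⊕ Fin 2 → ℤ := Sum.elim ![a, b] ![c, d]

theorem row_vecMul (x y z w a b c d e f g h i j k l m n o p : ℤ) :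
    row x y z w ᵥ* ofEntries a b c d e f g h i j k l m n o p =
      row (x * a + y * e + z * i + w * m) (x * b + y * f + z * j + w * n)
        (x * c + y * g + z * k + w * o) (x * d + y * h + z * l + w * p) := by
  ext (j | j) <;> fin_cases j <;> simp [vecMul, dotProduct, ofEntries, row, add_assoc]

theorem eq_row (v : Fin 2 ⊕ Fin 2 → ℤ) :
    v = row (v (.inl 0)) (v (.inl 1)) (v (.inr 0)) (v (.inr 1)) := by
  ext (j | j) <;> fin_cases j <;> rfl

/-- Every element of the principal congruence subgroup with first row `v` lies in `N`. -/
def ContainsFirstRow (N : Subgroup Sp4Z) (n : ℕ) (v : Fin 2 ⊕ Fin 2 → ℤ) : Prop :=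
  ∀ g ∈ principalCongruence n, mat g (.inl 0) = v → g ∈ N

theorem ContainsFirstRow.of_vecMul {v : Fin 2 ⊕ Fin 2 → ℤ} {u : Sp4Z} (hu : u ∈ N)
    (hun : u ∈ principalCongruence n) (H : ContainsFirstRow N n (v ᵥ* mat u)) :
    ContainsFirstRow N n v := by
  intro g hg hv
  rw [← Subgroup.mul_mem_cancel_right _ hu]
  refine H _ (mul_mem hg hun) ?_
  rw [mat_mul, mul_apply_eq_vecMul, hv]

theorem ContainsFirstRow.of_upper (hN : ContainsElementary N n) {a₁ a₂ b₁ b₂ p q r : ℤ}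
    (hp : (n : ℤ) ∣ p) (hq : (n : ℤ) ∣ q) (hr : (n : ℤ) ∣ r)
    (H : ContainsFirstRow N n (row a₁ a₂ (b₁ + p * a₁ + q * a₂) (b₂ + q * a₁ + r * a₂))) :
    ContainsFirstRow N n (row a₁ a₂ b₁ b₂) := by
  refine .of_vecMul (hN.upper hp hq hr)
    ((containsElementary_principalCongruence n).upper hp hq hr) ?_
  rw [upper, mat_ofMat, row_vecMul]
  convert H using 2 <;> ring

theorem ContainsFirstRow.of_levi (hN : ContainsElementary N n) {a₁ a₂ b₁ b₂ t : ℤ}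
    (ht : (n : ℤ) ∣ t) (H : ContainsFirstRow N n (row a₁ (a₂ + t * a₁) (b₁ - t * b₂) b₂)) :
    ContainsFirstRow N n (row a₁ a₂ b₁ b₂) := by
  refine .of_vecMul (hN.levi_upper ht)
    ((containsElementary_principalCongruence n).levi_upper ht) ?_
  rw [levi, mat_ofMat, row_vecMul]
  convert H using 2 <;> ring

theorem exists_isCoprime_add_mul {a b m : ℤ} (ha : a ≠ 0)
    (h : ∃ x y z, a * x + b * y + m * z = 1) : ∃ k, IsCoprime a (b + k * m) := by
  obtain ⟨x, y, z, h⟩ := h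
  refine ⟨∏ p ∈ ({p ∈ a.natAbs.primeFactors | ¬ (p : ℤ) ∣ b} : Finset ℕ), (p : ℤ), ?_⟩
  rw [Int.isCoprime_iff_gcd_eq_one]
  by_contra hne
  obtain ⟨p, hp, hpd⟩ := Nat.exists_prime_and_dvd hne
  have hpa : (p : ℤ) ∣ a := (Int.natCast_dvd_natCast.2 hpd).trans (Int.gcd_dvd_left ..)
  have hpb := (Int.natCast_dvd_natCast.2 hpd).trans (Int.gcd_dvd_right ..)
  have hp' : Prime (p : ℤ) := Nat.prime_iff_prime_int.1 hp
  by_cases hb : (p : ℤ) ∣ b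
  · rcases hp'.dvd_or_dvd ((dvd_add_right hb).1 hpb) with hk | hm
    · obtain ⟨q, hq, hpq⟩ := (hp'.dvd_finsetProd_iff _).1 hk
      simp only [Finset.mem_filter, Nat.mem_primeFactors] at hq
      rw [Int.natCast_dvd_natCast, Nat.prime_dvd_prime_iff_eq hp hq.1.1] at hpq
      exact hq.2 (hpq ▸ hb)
    · refine hp'.not_isUnit (isUnit_of_dvd_one ?_)
      rw [← h]
      exact ((hpa.mul_right _).add (hb.mul_right _)).add (hm.mul_right _)
  · refine hb ((dvd_add_left (Dvd.dvd.mul_right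
      (Finset.dvd_prod_of_mem (fun p : ℕ => (p : ℤ)) ?_) _)).1 hpb)
    simpa [hp, hb, ha] using Int.natCast_dvd.1 hpa

theorem long₁_mem
    (hrow : ∀ a b : ℤ, (n : ℤ) ∣ a - 1 → (n : ℤ) ∣ b → IsCoprime a b → ContainsRow N n a b)
    {a b c d : ℤ} (h : a * d - b * c = 1) (ha : (n : ℤ) ∣ a - 1) (hb : (n : ℤ) ∣ b)
    (hc : (n : ℤ) ∣ c) : long₁ a b c d h ∈ N :=
  hrow a b ha hb ⟨d, -c, by linear_combination h⟩ c d h hc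

theorem containsFirstRow_one_zero [N.Normal] (hN : ContainsElementary N n)
    (hrow : ∀ a b : ℤ, (n : ℤ) ∣ a - 1 → (n : ℤ) ∣ b → IsCoprime a b → ContainsRow N n a b) :
    ContainsFirstRow N n (row 1 0 0 0) := by
  intro g hg hv
  obtain ⟨p, q, r, s, h, hp, hq, hr, -, k, hk, rfl⟩ := exists_eq_mul_long₂ hN hg
    (by rw [hv]; rfl) (by rw [hv]; rfl) (by rw [hv]; rfl) (by rw [hv]; rfl)
  refine mul_mem hk ?_
  rw [long₂_eq]
  exact mul_mul_mem (by rw [swap_mul_swap]; exact one_mem N) (long₁_mem hrow h hp hq hr)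

theorem containsFirstRow_one [N.Normal] (hN : ContainsElementary N n)
    (hrow : ∀ a b : ℤ, (n : ℤ) ∣ a - 1 → (n : ℤ) ∣ b → IsCoprime a b → ContainsRow N n a b)
    (a₂ b₂ : ℤ) (ha₂ : (n : ℤ) ∣ a₂) (hb₂ : (n : ℤ) ∣ b₂) :
    ContainsFirstRow N n (row 1 a₂ 0 b₂) := by
  refine .of_levi hN ha₂.neg_right (.of_upper hN (p := -(a₂ * b₂)) (q := -b₂)
    (ha₂.mul_right _).neg_right hb₂.neg_right (dvd_zero _) ?_)
  convert containsFirstRow_one_zero hN hrow using 2 <;> ring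

theorem containsFirstRow_of_isCoprime [N.Normal] (hN : ContainsElementary N n)
    (hrow : ∀ a b : ℤ, (n : ℤ) ∣ a - 1 → (n : ℤ) ∣ b → IsCoprime a b → ContainsRow N n a b)
    {a₁ a₂ b₁ b₂ : ℤ} (ha₁ : (n : ℤ) ∣ a₁ - 1)
    (ha₂ : (n : ℤ) ∣ a₂) (hb₁ : (n : ℤ) ∣ b₁) (hb₂ : (n : ℤ) ∣ b₂) (hab : IsCoprime a₁ b₁) :
    ContainsFirstRow N n (row a₁ a₂ b₁ b₂) := by
  have hn : IsCoprime a₁ n := by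
    obtain ⟨x, hx⟩ := ha₁
    exact ⟨1, -x, by linear_combination hx⟩
  obtain ⟨u, v, huv⟩ := hab.mul_right hn
  have h : u * a₁ - -b₁ * (v * n) = 1 := by linear_combination huv
  have hu : (n : ℤ) ∣ u - 1 := by
    rw [show u - 1 = -(b₁ * (v * n)) - (a₁ - 1) * u by linear_combination h]
    exact dvd_sub (hb₁.mul_right _).neg_right (ha₁.mul_right _)
  refine .of_vecMul (long₁_mem hrow h hu hb₁.neg_right (dvd_mul_left _ _))
    (long₁_mem_principalCongruence h hu hb₁.neg_right (dvd_mul_left _ _) ha₁) ?_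
  rw [long₁, mat_ofMat, row_vecMul]
  convert containsFirstRow_one hN hrow a₂ b₂ ha₂ hb₂ using 2
  · linear_combination huv
  all_goals ring

theorem principalCongruence_le [N.Normal] (hN : ContainsElementary N n)
    (hrow : ∀ a b : ℤ, (n : ℤ) ∣ a - 1 → (n : ℤ) ∣ b → IsCoprime a b → ContainsRow N n a b)
    (h8 : 8 ∣ n) : principalCongruence n ≤ N := by
  intro g hg
  have h1 : (mat g * mat g⁻¹) (.inl 0) (.inl 0) = 1 := by
    rw [← mat_mul, mul_inv_cancel, mat_one, one_apply_eq]
  have hdvd := mem_principalCongruence_iff.1 hg (.inl 0)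
  have ha₁ := hdvd (.inl 0)
  have ha₂ := hdvd (.inl 1)
  have hb₁ := hdvd (.inr 0)
  have hb₂ := hdvd (.inr 1)
  simp only [one_apply_eq, ne_eq, reduceCtorEq, not_false_eq_true, one_apply_ne, sub_zero,
    Sum.inl.injEq, zero_ne_one] at ha₁ ha₂ hb₁ hb₂
  simp only [mul_apply, Fintype.sum_sum_type, Fin.sum_univ_two] at h1
  refine (?_ : ContainsFirstRow N n (row _ _ _ _)) g hg (eq_row _)
  generalize mat g (.inl 0) (.inl 0) = a₁, mat g (.inl 0) (.inl 1) = a₂,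
    mat g (.inl 0) (.inr 0) = b₁, mat g (.inl 0) (.inr 1) = b₂,
    mat g⁻¹ (.inl 0) (.inl 0) = x, mat g⁻¹ (.inl 1) (.inl 0) = y,
    mat g⁻¹ (.inr 0) (.inl 0) = z, mat g⁻¹ (.inr 1) (.inl 0) = w at *
  have ha0 : a₁ ≠ 0 := by
    rintro rfl
    have : (8 : ℤ) ∣ 0 - 1 := dvd_trans (by exact_mod_cast h8) ha₁
    omega
  obtain ⟨u, hu⟩ := ha₁
  obtain ⟨k, hk⟩ := exists_isCoprime_add_mul (a := a₁) (b := b₁) (m := n * (a₂ * y + b₂ * w)) ha0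
    ⟨1 - n * u * x, -(n * u * z), -u, by linear_combination hu - n * u * h1⟩
  have ha₁ : (n : ℤ) ∣ a₁ - 1 := ⟨u, hu⟩
  have ht : (n : ℤ) ∣ n * (k * y) := dvd_mul_right _ _
  have hs : (n : ℤ) ∣ -(n * (k * w)) := (dvd_mul_right _ _).neg_right
  refine .of_upper hN (dvd_zero _) ht (dvd_zero _) (.of_levi hN hs ?_)
  refine containsFirstRow_of_isCoprime hN hrow ha₁ (ha₂.add (hs.mul_right _))
    (dvd_sub ((hb₁.add (dvd_zero _ |>.mul_right _)).add (ht.mul_right _)) (hs.mul_right _))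
    ((hb₂.add (ht.mul_right _)).add (dvd_zero _ |>.mul_right _)) ?_
  refine Eq.subst ?_ (hk.add_mul_left_right (n * (k * w) * (n * (k * y))))
  ring

theorem principalCongruence_le_of_finiteIndex [N.Normal] [N.FiniteIndex] :
    principalCongruence (8 * N.index) ≤ N := by
  have hpow (x : Sp4Z ⧸ N) : x ^ N.index = 1 := pow_card_eq_one'
  have hN : ContainsElementary N (8 * N.index) :=
    containsElementary_of_pow_mem (fun g => (QuotientGroup.eq_one_iff _).1 (hpow g))
      (dvd_mul_left _ _)
  have h0 : 8 * N.index ≠ 0 := mul_ne_zero (by norm_num) Subgroup.FiniteIndex.index_ne_zero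
  exact principalCongruence_le hN
    (fun _ _ => containsRow_of_isCoprime hN hpow h0 (dvd_mul_left _ _) (dvd_mul_right _ _))
    (dvd_mul_right _ _)

end Sp4Z

/-- Every subgroup `H` of finite index in `Sp(4,ℤ)` contains a principal congruence
subgroup `Γ_2(n) = {M ∈ Sp(4,ℤ) : M ≡ I mod n}` for some `n ≥ 1`. -/
theorem finiteIndex_subgroup_contains_congruence_subgroup
    (H : Subgroup Sp4Z) (hH : H.FiniteIndex) :
    ∃ n : ℕ, 1 ≤ n ∧ ∀ M : Sp4Z,
      (∀ i j : Fin 2 ⊕ Fin 2,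
        (n : ℤ) ∣ (((M : GL (Fin 2 ⊕ Fin 2) ℤ) : Matrix (Fin 2 ⊕ Fin 2) (Fin 2 ⊕ Fin 2) ℤ) i j
          - (1 : Matrix (Fin 2 ⊕ Fin 2) (Fin 2 ⊕ Fin 2) ℤ) i j)) → M ∈ H := by
  have := H.finiteIndex_normalCore
  refine ⟨8 * H.normalCore.index, ?_, fun M hM => H.normalCore_le ?_⟩
  · have := Subgroup.FiniteIndex.index_ne_zero (H := H.normalCore)
    omega
  · exact Sp4Z.principalCongruence_le_of_finiteIndex (Sp4Z.mem_principalCongruence_iff.2 hM)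
end

section
/- Let g ≥ 1 and equip ℚ^{2g} with the standard symplectic form given by J = ((0, I_g), (−I_g, 0)). Let U_1 ⊊ U_2 ⊊ ⋯ ⊊ U_g be a flag of ℚ-subspaces of ℚ^{2g} with dim U_i = i, each U_i isotropic for this form. Then there exists h ∈ Sp(2g,ℤ) such that the image h(U_i) equals the span of the first i standard basis vectors e_1,…,e_i, for every i = 1,…,g. In other words, Sp(2g,ℤ) acts transitively on complete rational isotropic flags. -/
open Matrix

/-- The standard symplectic form `J = ((0, I_g), (−I_g, 0))` over a commutative ring. -/
def Jstd (g : ℕ) (R : Type*) [CommRing R] : Matrix (Fin g ⊕ Fin g) (Fin g ⊕ Fin g) R :=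
  Matrix.fromBlocks 0 1 (-1) 0

section Hyperbolic

variable {R M ι : Type*} [CommRing R] [AddCommGroup M] [Module R M]

/-- The component of `x` orthogonal to the hyperbolic pairs `(v i, w i)`, `i ∈ s`. -/
def hyperbolicCompl (B : LinearMap.BilinForm R M) (s : Finset ι) (v w : ι → M) (x : M) : M :=
  x - ∑ i ∈ s, B x (w i) • v i + ∑ i ∈ s, B x (v i) • w i

variable {B : LinearMap.BilinForm R M} {s : Finset ι} {v w : ι → M}

theorem apply_hyperbolicCompl {y : M} (hv : ∀ i ∈ s, B y (v i) = 0) (hw : ∀ i ∈ s, B y (w i) = 0)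
    (x : M) : B y (hyperbolicCompl B s v w x) = B y x := by
  have h₁ : ∑ i ∈ s, B x (w i) * B y (v i) = 0 :=
    Finset.sum_eq_zero fun i hi => by rw [hv i hi, mul_zero]
  have h₂ : ∑ i ∈ s, B x (v i) * B y (w i) = 0 :=
    Finset.sum_eq_zero fun i hi => by rw [hw i hi, mul_zero]
  simp [hyperbolicCompl, h₁, h₂]

variable [DecidableEq ι]

/-- The pairs `(v i, w i)`, `i ∈ s`, are pairwise orthogonal hyperbolic pairs for `B`. -/
def IsHyperbolicOn (B : LinearMap.BilinForm R M) (s : Finset ι) (v w : ι → M) : Prop :=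
  ∀ i ∈ s, ∀ j ∈ s,
    B (v i) (v j) = 0 ∧ B (w i) (w j) = 0 ∧ B (v i) (w j) = if i = j then 1 else 0

theorem IsHyperbolicOn.compl_left (hB : B.IsAlt) (h : IsHyperbolicOn B s v w) (x : M)
    {j : ι} (hj : j ∈ s) : B (hyperbolicCompl B s v w x) (v j) = 0 := by
  have h₁ : ∑ i ∈ s, B x (w i) * B (v i) (v j) = 0 :=
    Finset.sum_eq_zero fun i hi => by rw [(h i hi j hj).1, mul_zero]
  have h₂ : ∑ i ∈ s, B x (v i) * B (w i) (v j) = -B x (v j) := by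
    rw [Finset.sum_eq_single_of_mem j hj]
    · rw [← hB.neg_eq (v j) (w j), (h j hj j hj).2.2]; simp
    · intro i hi hij
      rw [← hB.neg_eq (v j) (w i), (h j hj i hi).2.2, if_neg hij.symm]; simp
  simp [hyperbolicCompl, LinearMap.sum_apply, h₁, h₂]

theorem IsHyperbolicOn.compl_right (h : IsHyperbolicOn B s v w) (x : M)
    {j : ι} (hj : j ∈ s) : B (hyperbolicCompl B s v w x) (w j) = 0 := by
  have h₁ : ∑ i ∈ s, B x (v i) * B (w i) (w j) = 0 :=
    Finset.sum_eq_zero fun i hi => by rw [(h i hi j hj).2.1, mul_zero]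
  have h₂ : ∑ i ∈ s, B x (w i) * B (v i) (w j) = B x (w j) := by
    rw [Finset.sum_eq_single_of_mem j hj]
    · rw [(h j hj j hj).2.2]; simp
    · intro i hi hij
      rw [(h i hi j hj).2.2, if_neg hij]; simp
  simp [hyperbolicCompl, LinearMap.sum_apply, h₁, h₂]

theorem IsHyperbolicOn.insert_update (hB : B.IsAlt) (h : IsHyperbolicOn B s v w) {k : ι}
    (hk : k ∉ s) {x y : M} (hxv : ∀ i ∈ s, B x (v i) = 0) (hxw : ∀ i ∈ s, B x (w i) = 0)
    (hyv : ∀ i ∈ s, B y (v i) = 0) (hyw : ∀ i ∈ s, B y (w i) = 0) (hxy : B x y = 1) :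
    IsHyperbolicOn B (insert k s) (Function.update v k x) (Function.update w k y) := by
  intro i hi j hj
  rcases Finset.mem_insert.1 hi with rfl | his <;> rcases Finset.mem_insert.1 hj with rfl | hjs
  · simp [hB x, hB y, hxy]
  · have hji : j ≠ i := fun e => hk (e ▸ hjs)
    simp [hji, hji.symm, hxv j hjs, hxw j hjs, hyw j hjs]
  · have hij : i ≠ j := fun e => hk (e ▸ his)
    simp [hij, ← hB.neg_eq x (v i), ← hB.neg_eq y (v i), ← hB.neg_eq y (w i), hxv i his, hyv i his,
      hyw i his]
  · have hik : i ≠ k := fun e => hk (e ▸ his)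
    have hjk : j ≠ k := fun e => hk (e ▸ hjs)
    simpa [hik, hjk] using h i his j hjs

end Hyperbolic

section IntegerVectors

variable {n : Type*}

/-- The inclusion of integer vectors into rational vectors. -/
def intCastVec (n : Type*) : (n → ℤ) →ₗ[ℤ] (n → ℚ) := (Algebra.linearMap ℤ ℚ).compLeft n

@[simp] theorem intCastVec_apply (x : n → ℤ) (a : n) : intCastVec n x a = x a := rfl

theorem exists_intCastVec_eq_smul [Finite n] (u : n → ℚ) :
    ∃ (d : ℤ) (x : n → ℤ), d ≠ 0 ∧ intCastVec n x = d • u := by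
  obtain ⟨d, hd⟩ := IsLocalization.exist_integer_multiples_of_finite (nonZeroDivisors ℤ) u
  choose x hx using hd
  exact ⟨d, x, nonZeroDivisors.coe_ne_zero d, funext hx⟩

theorem exists_eq_smul_and_dotProduct_eq_one [Fintype n] {x : n → ℤ} (hx : x ≠ 0) :
    ∃ (c : ℤ) (y z : n → ℤ), c ≠ 0 ∧ x = c • y ∧ y ⬝ᵥ z = 1 := by
  obtain ⟨a, ha⟩ := Function.ne_iff.1 hx
  obtain ⟨y, hy, hy₁⟩ := Finset.univ.extract_gcd x ⟨a, Finset.mem_univ a⟩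
  obtain ⟨z, hz⟩ := Finset.univ.gcd_eq_sum_mul y
  refine ⟨Finset.univ.gcd x, y, z, fun h => ha ?_, funext fun b => hy b (Finset.mem_univ b), ?_⟩
  · exact Finset.gcd_eq_zero_iff.1 h a (Finset.mem_univ a)
  · rw [dotProduct, ← hz, hy₁]

theorem intCastVec_mem_of_smul {V : Submodule ℚ (n → ℚ)} {c : ℤ} (hc : c ≠ 0) {y : n → ℤ}
    (h : intCastVec n (c • y) ∈ V) : intCastVec n y ∈ V := by
  rw [map_smul, ← Int.cast_smul_eq_zsmul ℚ] at h
  exact (V.smul_mem_iff (Int.cast_ne_zero.2 hc)).1 h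

end IntegerVectors

section StandardForm

variable (g : ℕ) (R : Type*) [CommRing R]

/-- The alternating bilinear form with Gram matrix `Jstd g R`. -/
noncomputable def stdForm : LinearMap.BilinForm R (Fin g ⊕ Fin g → R) :=
  Matrix.toBilin' (Jstd g R)

variable {g R}

theorem stdForm_apply (x y : Fin g ⊕ Fin g → R) : stdForm g R x y = x ⬝ᵥ (Jstd g R *ᵥ y) :=
  Matrix.toBilin'_apply' _ _ _

theorem stdForm_isAlt : (stdForm g R).IsAlt := fun x => by
  rw [stdForm_apply, Jstd, Matrix.fromBlocks_mulVec]
  simp [dotProduct, Matrix.neg_mulVec, mul_comm]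

theorem Jstd_mul_Jstd : Jstd g R * Jstd g R = -1 := by
  simp [Jstd, Matrix.fromBlocks_multiply, ← Matrix.fromBlocks_one, Matrix.fromBlocks_neg]

theorem stdForm_neg_Jstd_mulVec (x y : Fin g ⊕ Fin g → R) :
    stdForm g R x (-(Jstd g R *ᵥ y)) = x ⬝ᵥ y := by
  rw [stdForm_apply, Matrix.mulVec_neg, Matrix.mulVec_mulVec, Jstd_mul_Jstd]
  simp [Matrix.neg_mulVec]

theorem intCast_stdForm (x y : Fin g ⊕ Fin g → ℤ) :
    ((stdForm g ℤ x y : ℤ) : ℚ) = stdForm g ℚ (intCastVec _ x) (intCastVec _ y) := by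
  simp [stdForm_apply, Jstd, dotProduct, Matrix.fromBlocks_mulVec, Matrix.neg_mulVec]

/-- The matrix whose rows form a family of `g` hyperbolic pairs is symplectic. -/
theorem IsHyperbolicOn.mul_Jstd_mul_transpose {v w : Fin g → (Fin g ⊕ Fin g → R)}
    (h : IsHyperbolicOn (stdForm g R) Finset.univ v w) :
    Matrix.of (Sum.elim v w) * Jstd g R * (Matrix.of (Sum.elim v w))ᵀ = Jstd g R := by
  have key (a b) : (Matrix.of (Sum.elim v w) * Jstd g R * (Matrix.of (Sum.elim v w))ᵀ) a b =
      stdForm g R (Sum.elim v w a) (Sum.elim v w b) := by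
    rw [stdForm_apply, Matrix.mul_assoc]
    rfl
  ext a b
  rw [key]
  rcases a with i | i <;> rcases b with j | j <;>
    have h₁ := h i (Finset.mem_univ i) j (Finset.mem_univ j)
  · simp [h₁.1, Jstd]
  · simp [h₁.2.2, Jstd, Matrix.one_apply]
  · have h₂ := h j (Finset.mem_univ j) i (Finset.mem_univ i)
    simp [← stdForm_isAlt.neg_eq (v j) (w i), h₂.2.2, Jstd, Matrix.one_apply, eq_comm]
  · simp [h₁.2.1, Jstd]

/-- A complete rational isotropic flag is adapted to the first halves of integral
hyperbolic pairs. -/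
theorem exists_isHyperbolicOn_of_isotropic_flag {U : Fin g → Submodule ℚ (Fin g ⊕ Fin g → ℚ)}
    (hdim : ∀ i : Fin g, Module.finrank ℚ (U i) = (i : ℕ) + 1) (hmono : Monotone U)
    (hiso : ∀ i : Fin g, ∀ x ∈ U i, ∀ y ∈ U i, stdForm g ℚ x y = 0) (k : ℕ) (hk : k ≤ g) :
    ∃ v w : Fin g → (Fin g ⊕ Fin g → ℤ),
      IsHyperbolicOn (stdForm g ℤ) ({i | (i : ℕ) < k} : Finset (Fin g)) v w ∧
      ∀ i : Fin g, (i : ℕ) < k → intCastVec _ (v i) ∈ U i := by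
  induction k with
  | zero => exact ⟨0, 0, by simp [IsHyperbolicOn], by simp⟩
  | succ k ih =>
    obtain ⟨v, w, hvw, hvU⟩ := ih (by omega)
    set s : Finset (Fin g) := {i | (i : ℕ) < k} with hs
    let l : Fin g := ⟨k, hk⟩
    have hls : l ∉ s := by simp [hs, l]
    have hcard : s.card = k := by
      rw [hs, Fin.card_filter_val_lt]; omega
    have hvl (i) (hi : i ∈ s) : intCastVec _ (v i) ∈ U l := by
      have hi' : (i : ℕ) < k := by simpa [hs] using hi
      exact hmono (Fin.le_def.2 hi'.le) (hvU i hi')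
    let S : Submodule ℚ (Fin g ⊕ Fin g → ℚ) :=
      Submodule.span ℚ (s.image fun i => intCastVec _ (v i))
    have hvS (i) (hi : i ∈ s) : intCastVec _ (v i) ∈ S :=
      Submodule.subset_span (Finset.mem_coe.2 (Finset.mem_image_of_mem _ hi))
    have hSU : ¬ U l ≤ S := fun hle => by
      have h₁ := Submodule.finrank_mono hle
      have h₂ : Module.finrank ℚ S ≤ _ := finrank_span_finset_le_card _
      have h₃ := Finset.card_image_le (s := s) (f := fun i => intCastVec _ (v i))
      rw [hdim l] at h₁
      simp only [l] at h₁
      omega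
    obtain ⟨u, huU, huS⟩ := Set.not_subset.1 hSU
    obtain ⟨d, x, hd, hx⟩ := exists_intCastVec_eq_smul u
    have hdq : (d : ℚ) ≠ 0 := Int.cast_ne_zero.2 hd
    rw [← Int.cast_smul_eq_zsmul ℚ] at hx
    have hxU : intCastVec _ x ∈ U l := hx ▸ (U l).smul_mem _ huU
    have hxS : intCastVec _ x ∉ S := fun h => huS ((S.smul_mem_iff hdq).1 (hx ▸ h))
    have hcompl : hyperbolicCompl (stdForm g ℤ) s v w x =
        x - ∑ i ∈ s, stdForm g ℤ x (w i) • v i := by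
      have h₀ : ∑ i ∈ s, stdForm g ℤ x (v i) • w i = 0 := Finset.sum_eq_zero fun i hi => by
        have : stdForm g ℤ x (v i) = 0 := by
          rw [← Int.cast_inj (α := ℚ), intCast_stdForm, Int.cast_zero]
          exact hiso l _ hxU _ (hvl i hi)
        rw [this, zero_smul]
      rw [hyperbolicCompl, h₀, add_zero]
    have hsum {V : Submodule ℚ (Fin g ⊕ Fin g → ℚ)} (hV : ∀ i ∈ s, intCastVec _ (v i) ∈ V) :
        intCastVec _ (∑ i ∈ s, stdForm g ℤ x (w i) • v i) ∈ V := by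
      rw [map_sum]
      refine V.sum_mem fun i hi => ?_
      rw [map_smul]
      exact V.toAddSubgroup.zsmul_mem (hV i hi) _
    have hx₀ : hyperbolicCompl (stdForm g ℤ) s v w x ≠ 0 := fun h => by
      rw [hcompl, sub_eq_zero] at h
      exact hxS (h ▸ hsum hvS)
    have hcU : intCastVec _ (hyperbolicCompl (stdForm g ℤ) s v w x) ∈ U l := by
      rw [hcompl, map_sub]
      exact (U l).sub_mem hxU (hsum hvl)
    obtain ⟨c, y, z, hc, hcy, hyz⟩ := exists_eq_smul_and_dotProduct_eq_one hx₀
    have hyv (i) (hi : i ∈ s) : stdForm g ℤ y (v i) = 0 := by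
      have := hvw.compl_left stdForm_isAlt x hi
      rw [hcy, map_smul, LinearMap.smul_apply] at this
      exact (smul_eq_zero.1 this).resolve_left hc
    have hyw (i) (hi : i ∈ s) : stdForm g ℤ y (w i) = 0 := by
      have := hvw.compl_right x hi
      rw [hcy, map_smul, LinearMap.smul_apply] at this
      exact (smul_eq_zero.1 this).resolve_left hc
    have hins : ({i | (i : ℕ) < k + 1} : Finset (Fin g)) = insert l s := by
      ext i
      simp only [hs, l, Finset.mem_filter, Finset.mem_univ, true_and, Finset.mem_insert, Fin.ext_iff]
      omega
    refine ⟨Function.update v l y,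
      Function.update w l (hyperbolicCompl (stdForm g ℤ) s v w (-(Jstd g ℤ *ᵥ z))), ?_, ?_⟩
    · rw [hins]
      refine hvw.insert_update stdForm_isAlt hls hyv hyw
        (fun i => hvw.compl_left stdForm_isAlt _) (fun i => hvw.compl_right _) ?_
      rw [apply_hyperbolicCompl hyv hyw, stdForm_neg_Jstd_mulVec, hyz]
    · intro i hi
      by_cases hil : i = l
      · subst hil
        rw [Function.update_self]
        exact intCastVec_mem_of_smul hc (hcy ▸ hcU)
      · rw [Function.update_of_ne hil]
        refine hvU i ?_
        have : (i : ℕ) ≠ k := fun e => hil (Fin.ext e)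
        omega

end StandardForm

/-- `Sp(2g,ℤ)` acts transitively on complete rational isotropic flags: if
`U 0 ⊊ U 1 ⊊ ⋯ ⊊ U (g-1)` is a flag of subspaces of `ℚ^{2g}` with `dim (U i) = i + 1`,
each isotropic for the standard symplectic form given by `J`, then there is an integral
symplectic matrix `h` carrying `U i` onto the span of the first `i + 1` standard basis
vectors. -/
theorem Sp2gZ_transitive_on_isotropic_flags
    (g : ℕ) (hg : 1 ≤ g) (U : Fin g → Submodule ℚ (Fin g ⊕ Fin g → ℚ))
    (hdim : ∀ i : Fin g, Module.finrank ℚ (U i) = (i : ℕ) + 1)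
    (hmono : StrictMono U)
    (hiso : ∀ i : Fin g, ∀ x ∈ U i, ∀ y ∈ U i, x ⬝ᵥ (Jstd g ℚ *ᵥ y) = 0) :
    ∃ h : Matrix (Fin g ⊕ Fin g) (Fin g ⊕ Fin g) ℤ,
      hᵀ * Jstd g ℤ * h = Jstd g ℤ ∧
      ∀ i : Fin g,
        Submodule.map (Matrix.toLin' (h.map (Int.cast : ℤ → ℚ))) (U i) =
          Submodule.span ℚ
            ((fun j : Fin g => (Pi.single (Sum.inl j) 1 : Fin g ⊕ Fin g → ℚ)) ''
              {j : Fin g | j ≤ i}) := by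
  obtain ⟨v, w, hvw, hvU⟩ := exists_isHyperbolicOn_of_isotropic_flag hdim hmono.monotone
    (fun i x hx y hy => (stdForm_apply x y).trans (hiso i x hx y hy)) g le_rfl
  have huniv : ({i | (i : ℕ) < g} : Finset (Fin g)) = Finset.univ := by ext; simp
  rw [huniv] at hvw
  set A : Matrix (Fin g ⊕ Fin g) (Fin g ⊕ Fin g) ℤ := Matrix.of (Sum.elim v w) with hA
  have hAJ : A * Jstd g ℤ * Aᵀ = Jstd g ℤ := hvw.mul_Jstd_mul_transpose
  have hinv : -(Jstd g ℤ * A * Jstd g ℤ) * Aᵀ = 1 := by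
    rw [Matrix.neg_mul, Matrix.mul_assoc, Matrix.mul_assoc, ← Matrix.mul_assoc A, hAJ,
      Jstd_mul_Jstd, neg_neg]
  obtain ⟨h, hh⟩ : ∃ h, h * Aᵀ = 1 := ⟨_, hinv⟩
  have hh' : A * hᵀ = 1 := by simpa using congrArg Matrix.transpose hh
  refine ⟨h, ?_, fun i => ?_⟩
  · calc hᵀ * Jstd g ℤ * h = (hᵀ * A) * Jstd g ℤ * (Aᵀ * h) := by
          conv_lhs => rw [← hAJ]
          simp only [Matrix.mul_assoc]
      _ = Jstd g ℤ := by
          rw [mul_eq_one_comm.1 hh, mul_eq_one_comm.1 hh', Matrix.one_mul,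
            Matrix.mul_one]
  · symm
    apply Submodule.eq_of_le_of_finrank_le
    · rw [Submodule.span_le]
      rintro _ ⟨j, hj, rfl⟩
      refine ⟨intCastVec _ (v j), hmono.monotone hj (hvU j j.2), ?_⟩
      ext a
      have hcol := congrFun (congrFun hh a) (Sum.inl j)
      rw [← Int.cast_inj (α := ℚ)] at hcol
      simpa [Matrix.mul_apply, Matrix.mulVec, dotProduct, hA, Matrix.one_apply, Pi.single_apply]
        using hcol
    · refine (Submodule.finrank_map_le _ _).trans ?_
      have hli : LinearIndependent ℚ fun j : {j : Fin g // j ≤ i} =>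
          (Pi.single (Sum.inl (j : Fin g)) 1 : Fin g ⊕ Fin g → ℚ) :=
        (Pi.linearIndependent_single_one (Fin g ⊕ Fin g) ℚ).comp
          (fun j : {j : Fin g // j ≤ i} => Sum.inl (j : Fin g))
          (Sum.inl_injective.comp Subtype.val_injective)
      have hcard := finrank_span_eq_card hli
      rw [Fintype.card_subtype, Finset.filter_ge_eq_Iic, Fin.card_Iic] at hcard
      rw [hdim i, Set.image_eq_range]
      exact hcard.ge
end
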